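/- arXiv:1308.2211 — 2 statements merged into one kernel-verified Lean document; each statement's English description precedes it below -/
import Mathlib

section
/- Every robust finite simple graph with average degree less than 7 (that is, with 2|E(G)| < 7|V(G)|) has a reducible vertex set. -/
open SimpleGraph

variable {V : Type*}

/-- `S` is a set of pairwise edge-disjoint triangles of `G` (two triangles, viewed as
3-element vertex sets, are edge-disjoint iff they share at most one vertex). -/
def EdgeDisjointTriangles [DecidableEq V] (G : SimpleGraph V) (S : Finset (Finset V)) : Prop :=
  (∀ t ∈ S, G.IsNClique 3 t) ∧
    ∀ t₁ ∈ S, ∀ t₂ ∈ S, t₁ ≠ t₂ → (t₁ ∩ t₂).card ≤ 1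

/-- `G` is robust: for every vertex `v`, every connected component of the subgraph induced
by the neighborhood of `v` has at least 5 vertices. -/
def Robust (G : SimpleGraph V) : Prop :=
  ∀ (v : V) (c : (G.induce (G.neighborSet v)).ConnectedComponent), 5 ≤ c.supp.ncard

/-- `V₀` is a reducible vertex set of `G`. -/
def ReducibleVertexSet [DecidableEq V] (G : SimpleGraph V) (V₀ : Finset V) : Prop :=
  V₀.Nonempty ∧
    ∃ (S : Finset (Finset V)) (X : Finset (Sym2 V)),
      EdgeDisjointTriangles G S ∧ ↑X ⊆ G.edgeSet ∧ X.card ≤ 2 * S.card ∧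
      (∀ t : Finset V, (G.deleteEdges ↑X).IsNClique 3 t → ∀ x ∈ V₀, x ∉ t) ∧
      (∀ t ∈ S, ∀ u ∈ t, ∀ v ∈ t, u ≠ v → u ∉ V₀ → v ∉ V₀ → s(u, v) ∈ X)

/-! ### A small certificate checker for reducible sets -/

/-- Decision trees: split on an edge, or close a branch. -/
inductive Tr
  | nd (i j : ℕ) (p q : Tr)
  | ct (k : ℕ)
  | cm (v i j k : ℕ)
  | cut (v : ℕ) (c : List ℕ)
  | cl

structure Cfg where
  n : ℕ
  nb : List (ℕ × List ℕ)
  pos : List (ℕ × ℕ)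
  neg : List (ℕ × ℕ)
  low : List ℕ
  conn : List ℕ
  cls : List (List (Bool × ℕ × ℕ))

abbrev Cert := List ℕ × List (ℕ × ℕ × ℕ) × List ℕ

/-- The complement of the neighbourhood of `v` is a matching. -/
def CoM (G : SimpleGraph V) (v : V) : Prop :=
  ∀ x y z, G.Adj v x → G.Adj v y → G.Adj v z → x ≠ y → x ≠ z → y ≠ z → G.Adj x y ∨ G.Adj x z

/-- The neighbourhood of `v` is connected, in terms of cuts. -/
def CoN (G : SimpleGraph V) (v : V) : Prop :=
  ∀ P : V → Prop, (∃ x, G.Adj v x ∧ P x) → (∃ y, G.Adj v y ∧ ¬ P y) →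
    ∃ x y, G.Adj v x ∧ P x ∧ G.Adj v y ∧ ¬ P y ∧ G.Adj x y

def has (m i j : ℕ) : Bool := decide (i < 16) && decide (j < 16) && m.testBit (16 * i + j)

def add2 (m i j : ℕ) : ℕ := (m ||| 2 ^ (16 * i + j)) ||| 2 ^ (16 * j + i)

def addAll (l : List (ℕ × ℕ)) : ℕ := l.foldr (fun p m => add2 m p.1 p.2) 0

def xe (X : List ℕ) (i j : ℕ) : Bool :=
  decide (i < 16) && decide (j < 16) && (X.contains (16 * i + j) || X.contains (16 * j + i))

def tset (t : ℕ × ℕ × ℕ) : Finset ℕ := {t.1, t.2.1, t.2.2}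

def pw : List (ℕ × ℕ × ℕ) → Bool
  | [] => true
  | t :: l => l.all (fun s => decide ((tset t ∩ tset s).card ≤ 1)) && pw l

def okPair (V0 X : List ℕ) (P i j : ℕ) : Bool :=
  has P i j && (V0.contains i || V0.contains j || xe X i j)

def okTri (n : ℕ) (V0 X : List ℕ) (P : ℕ) (t : ℕ × ℕ × ℕ) : Bool :=
  decide (t.1 < n) && decide (t.2.1 < n) && decide (t.2.2 < n) &&
  okPair V0 X P t.1 t.2.1 && okPair V0 X P t.1 t.2.2 && okPair V0 X P t.2.1 t.2.2

def okNb (X : List ℕ) (N x : ℕ) (p : ℕ × List ℕ) : Bool :=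
  p.1 == x && p.2.all (fun y => p.2.all (fun z => has N y z || xe X x y || xe X x z || xe X y z))

def okCert (C : Cfg) (P N : ℕ) (c : Cert) : Bool :=
  !c.1.isEmpty && c.1.all (fun x => C.nb.any (okNb c.2.2 N x)) &&
  c.2.1.all (okTri C.n c.1 c.2.2 P) && pw c.2.1 && decide (c.2.2.length ≤ 2 * c.2.1.length)

def okCm (C : Cfg) (P N v i j k : ℕ) : Bool :=
  C.low.contains v && has P v i && has P v j && has P v k && decide (i < C.n) && decide (j < C.n)
    && decide (k < C.n) && decide (i ≠ j) && decide (i ≠ k) && decide (j ≠ k) && has N i j && has N i k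

def okCut (C : Cfg) (N v : ℕ) (c : List ℕ) : Bool :=
  C.conn.contains v && C.nb.any (fun p => p.1 == v && p.2.all (fun x => decide (x < C.n)) &&
    p.2.any (fun x => c.contains x) && p.2.any (fun x => !c.contains x) &&
    p.2.all (fun x => p.2.all (fun y => !c.contains x || c.contains y || has N x y)))

def chk (C : Cfg) (cts : List Cert) : Tr → ℕ → ℕ → Bool
  | .nd i j p q, P, N => decide (i < 16) && decide (j < 16) &&
      chk C cts p (add2 P i j) N && chk C cts q P (add2 N i j)
  | .ct k, P, N => match cts[k]? with
    | some c => okCert C P N c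
    | none => false
  | .cm v i j k, P, N => okCm C P N v i j k
  | .cut v c, _, N => okCut C N v c
  | .cl, P, N => C.cls.any (fun c => c.all (fun l =>
      if l.1 then has N l.2.1 l.2.2 else has P l.2.1 l.2.2))

def initP (C : Cfg) : List (ℕ × ℕ) := C.nb.flatMap (fun p => p.2.map (fun j => (p.1, j))) ++ C.pos

def initN (C : Cfg) : List (ℕ × ℕ) :=
  C.nb.flatMap (fun p => ((List.range C.n).filter (fun j => !p.2.contains j)).map (fun j => (p.1, j)))
    ++ C.neg ++ (List.range C.n).map (fun i => (i, i))

def okIdx (C : Cfg) : Bool := decide (C.n ≤ 16) &&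
  C.nb.all (fun p => decide (p.1 < C.n) && p.2.all (fun j => decide (j < C.n))) &&
  C.pos.all (fun p => decide (p.1 < C.n) && decide (p.2 < C.n)) &&
  C.neg.all (fun p => decide (p.1 < C.n) && decide (p.2 < C.n))

def chkAll (C : Cfg) (cts : List Cert) (t : Tr) : Bool :=
  okIdx C && chk C cts t (addAll (initP C)) (addAll (initN C))

def MInv (m : ℕ) (R : ℕ → ℕ → Prop) : Prop := ∀ i j, has m i j = true → R i j

theorem MInv.add2 {m : ℕ} {R : ℕ → ℕ → Prop} (h : MInv m R) {i j : ℕ} (hi : i < 16) (hj : j < 16)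
    (h1 : R i j) (h2 : R j i) : MInv (add2 m i j) R := by
  intro a b hab
  simp only [has, _root_.add2, Nat.testBit_or, Nat.testBit_two_pow, Bool.and_eq_true, Bool.or_eq_true,
    decide_eq_true_eq] at hab
  obtain ⟨⟨ha, hb⟩, (h3 | h3) | h3⟩ := hab
  · exact h a b (by simp [has, ha, hb, h3])
  · have : i = a ∧ j = b := by omega
    rw [← this.1, ← this.2]; exact h1
  · have : j = a ∧ i = b := by omega
    rw [← this.1, ← this.2]; exact h2

theorem inv_addAll {R : ℕ → ℕ → Prop} (l : List (ℕ × ℕ))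
    (hl : ∀ p ∈ l, p.1 < 16 ∧ p.2 < 16 ∧ R p.1 p.2 ∧ R p.2 p.1) : MInv (addAll l) R := by
  induction l with
  | nil => intro a b hab; simp [has, addAll] at hab
  | cons p l ih =>
    have hp := hl p (by simp)
    exact (ih (fun q hq => hl q (by simp [hq]))).add2 hp.1 hp.2.1 hp.2.2.1 hp.2.2.2

structure Sem [DecidableEq V] (G : SimpleGraph V) (f : ℕ → V) (C : Cfg) : Prop where
  inj : ∀ i < C.n, ∀ j < C.n, f i = f j → i = j
  nb : ∀ p ∈ C.nb, ∀ w, G.Adj (f p.1) w ↔ w ∈ p.2.map f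
  pos : ∀ p ∈ C.pos, G.Adj (f p.1) (f p.2)
  neg : ∀ p ∈ C.neg, ¬ G.Adj (f p.1) (f p.2)
  low : ∀ v ∈ C.low, CoM G (f v)
  conn : ∀ v ∈ C.conn, CoN G (f v)
  cls : ∀ c ∈ C.cls, ∃ l ∈ c, if l.1 then G.Adj (f l.2.1) (f l.2.2) else ¬ G.Adj (f l.2.1) (f l.2.2)

theorem pw_spec : ∀ {l : List (ℕ × ℕ × ℕ)}, pw l = true →
    l.Pairwise (fun s t => (tset s ∩ tset t).card ≤ 1)
  | [], _ => List.Pairwise.nil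
  | t :: l, h => by
    simp only [pw, Bool.and_eq_true, List.all_eq_true, decide_eq_true_eq] at h
    exact List.Pairwise.cons h.1 (pw_spec h.2)

/-- Variant of reducibility where `X` need not consist of edges. -/
theorem reducible_of [DecidableEq V] (G : SimpleGraph V) (V₀ : Finset V) (hne : V₀.Nonempty)
    (S : Finset (Finset V)) (X : Finset (Sym2 V)) (hS : EdgeDisjointTriangles G S)
    (hc : X.card ≤ 2 * S.card)
    (h2 : ∀ x ∈ V₀, ∀ y z, G.Adj x y → G.Adj x z → G.Adj y z →
      s(x, y) ∈ X ∨ s(x, z) ∈ X ∨ s(y, z) ∈ X)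
    (h3 : ∀ t ∈ S, ∀ u ∈ t, ∀ v ∈ t, u ≠ v → u ∉ V₀ → v ∉ V₀ → s(u, v) ∈ X) :
    ReducibleVertexSet G V₀ := by
  classical
  refine ⟨hne, S, X.filter (fun e => e ∈ G.edgeSet), hS, ?_,
    (Finset.card_filter_le _ _).trans hc, ?_, ?_⟩
  · intro e he; simpa using (Finset.mem_filter.1 (Finset.mem_coe.1 he)).2
  · intro t ht x hx hxt
    have hcl := ht.1
    have : ∃ y z, y ≠ z ∧ t.erase x = {y, z} := by
      rw [← Finset.card_eq_two, Finset.card_erase_of_mem hxt, ht.2]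
    obtain ⟨y, z, hyz, he⟩ := this
    have hy : y ∈ t.erase x := by simp [he]
    have hz : z ∈ t.erase x := by simp [he]
    rw [Finset.mem_erase] at hy hz
    have a1 := hcl hxt hy.2 hy.1.symm
    have a2 := hcl hxt hz.2 hz.1.symm
    have a3 := hcl hy.2 hz.2 hyz
    simp only [SimpleGraph.deleteEdges_adj, Finset.coe_filter, Set.mem_ofPred_eq, SimpleGraph.mem_edgeSet] at a1 a2 a3
    rcases h2 x hx y z a1.1 a2.1 a3.1 with h | h | h
    · exact a1.2 ⟨h, a1.1⟩
    · exact a2.2 ⟨h, a2.1⟩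
    · exact a3.2 ⟨h, a3.1⟩
  · intro t ht u hu v hv huv hu0 hv0
    rw [Finset.mem_filter]
    exact ⟨h3 t ht u hu v hv huv hu0 hv0, (hS.1 t ht).1 hu hv huv⟩

theorem xe_spec [DecidableEq V] (f : ℕ → V) {X : List ℕ} {i j : ℕ} (h : xe X i j = true) :
    s(f i, f j) ∈ (X.map (fun k => s(f (k / 16), f (k % 16)))).toFinset := by
  simp only [xe, Bool.and_eq_true, Bool.or_eq_true, decide_eq_true_eq, List.contains_iff_mem] at h
  rw [List.mem_toFinset, List.mem_map]
  obtain ⟨⟨hi, hj⟩, h | h⟩ := h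
  · refine ⟨_, h, ?_⟩
    rw [show (16 * i + j) / 16 = i by omega, show (16 * i + j) % 16 = j by omega]
  · refine ⟨_, h, ?_⟩
    rw [show (16 * j + i) / 16 = j by omega, show (16 * j + i) % 16 = i by omega, Sym2.eq_swap]

theorem okCert_sound [DecidableEq V] (G : SimpleGraph V) (f : ℕ → V) (C : Cfg) (hs : Sem G f C)
    (P N : ℕ) (hP : MInv P (fun i j => G.Adj (f i) (f j)))
    (hN : MInv N (fun i j => ¬ G.Adj (f i) (f j))) (c : Cert) (hc : okCert C P N c = true) :
    ∃ V₀ : Finset V, ReducibleVertexSet G V₀ := by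
  obtain ⟨V0, S, X⟩ := c
  simp only [okCert, Bool.and_eq_true, Bool.not_eq_true', List.all_eq_true, decide_eq_true_eq,
    List.any_eq_true] at hc
  obtain ⟨⟨⟨⟨h1, h2⟩, h3⟩, h4⟩, h5⟩ := hc
  have hpw := pw_spec h4
  set tr : ℕ × ℕ × ℕ → Finset V := fun t => (tset t).image f with htr
  have hlt : ∀ t ∈ S, ∀ i ∈ tset t, i < C.n := by
    intro t ht i hi
    have := h3 t ht
    simp only [okTri, Bool.and_eq_true, decide_eq_true_eq] at this
    simp only [tset, Finset.mem_insert, Finset.mem_singleton] at hi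
    rcases hi with rfl | rfl | rfl
    · exact this.1.1.1.1.1
    · exact this.1.1.1.1.2
    · exact this.1.1.1.2
  have hpair : ∀ t ∈ S, ∀ i ∈ tset t, ∀ j ∈ tset t, f i ≠ f j →
      G.Adj (f i) (f j) ∧ (i ∈ V0 ∨ j ∈ V0 ∨
        s(f i, f j) ∈ (X.map (fun k => s(f (k / 16), f (k % 16)))).toFinset) := by
    intro t ht
    have := h3 t ht
    simp only [okTri, okPair, Bool.and_eq_true, decide_eq_true_eq, Bool.or_eq_true,
      List.contains_iff_mem] at this
    obtain ⟨⟨⟨_, a1, b1⟩, a2, b2⟩, a3, b3⟩ := this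
    have c1 := hP _ _ a1
    have c2 := hP _ _ a2
    have c3 := hP _ _ a3
    have key : ∀ {i j}, G.Adj (f i) (f j) → ((i ∈ V0 ∨ j ∈ V0) ∨ xe X i j = true) →
        (G.Adj (f i) (f j) ∧ (i ∈ V0 ∨ j ∈ V0 ∨
        s(f i, f j) ∈ (X.map (fun k => s(f (k / 16), f (k % 16)))).toFinset)) ∧
        (G.Adj (f j) (f i) ∧ (j ∈ V0 ∨ i ∈ V0 ∨
        s(f j, f i) ∈ (X.map (fun k => s(f (k / 16), f (k % 16)))).toFinset)) := by
      intro i j h h'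
      have h'' : (i ∈ V0 ∨ j ∈ V0) ∨ s(f i, f j) ∈ (X.map (fun k => s(f (k / 16), f (k % 16)))).toFinset :=
        h'.imp id (xe_spec f)
      refine ⟨⟨h, or_assoc.1 h''⟩, h.symm, ?_⟩
      have e : s(f j, f i) = s(f i, f j) := Sym2.eq_swap
      rw [e]
      rcases h'' with (h | h) | h
      · exact Or.inr (Or.inl h)
      · exact Or.inl h
      · exact Or.inr (Or.inr h)
    have d1 := key c1 b1
    have d2 := key c2 b2
    have d3 := key c3 b3
    intro i hi j hj hij
    simp only [tset, Finset.mem_insert, Finset.mem_singleton] at hi hj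
    rcases hi with rfl | rfl | rfl <;> rcases hj with rfl | rfl | rfl
    · exact absurd rfl hij
    · exact d1.1
    · exact d2.1
    · exact d1.2
    · exact absurd rfl hij
    · exact d3.1
    · exact d2.2
    · exact d3.2
    · exact absurd rfl hij
  have hinj : ∀ t ∈ S, ∀ s ∈ S, tr t ∩ tr s = (tset t ∩ tset s).image f := by
    intro t ht s hs'
    ext x
    simp only [htr, Finset.mem_inter, Finset.mem_image]
    constructor
    · rintro ⟨⟨i, hi, rfl⟩, j, hj, hij⟩
      have := hs.inj j (hlt s hs' j hj) i (hlt t ht i hi) hij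
      subst this
      exact ⟨j, ⟨hi, hj⟩, rfl⟩
    · rintro ⟨i, ⟨hi, hj⟩, rfl⟩
      exact ⟨⟨i, hi, rfl⟩, i, hj, rfl⟩
  have hcard : ∀ t ∈ S, (tr t).card = 3 := by
    intro t ht
    have := h3 t ht
    simp only [okTri, okPair, Bool.and_eq_true, decide_eq_true_eq] at this
    obtain ⟨⟨⟨_, a1, b1⟩, a2, b2⟩, a3, b3⟩ := this
    have c1 := (hP _ _ a1).ne
    have c2 := (hP _ _ a2).ne
    have c3 := (hP _ _ a3).ne
    rw [Finset.card_eq_three]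
    exact ⟨_, _, _, c1, c2, c3, by simp [htr, tset, Finset.image_insert]⟩
  have hpw' : S.Pairwise (fun s t => tr s ≠ tr t) := by
    refine hpw.imp_of_mem ?_
    intro s t hs' ht hle heq
    have h6 : (tr s ∩ tr t).card ≤ 1 := by
      rw [hinj s hs' t ht]; exact Finset.card_image_le.trans hle
    rw [heq, Finset.inter_self, hcard t ht] at h6
    omega
  refine ⟨(V0.map f).toFinset, reducible_of G _ ?_ (S.map tr).toFinset
    (X.map (fun k => s(f (k / 16), f (k % 16)))).toFinset ⟨?_, ?_⟩ ?_ ?_ ?_⟩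
  · cases V0 with
    | nil => simp at h1
    | cons a l => exact ⟨f a, by simp⟩
  · intro t ht
    simp only [List.mem_toFinset, List.mem_map] at ht
    obtain ⟨t, ht, rfl⟩ := ht
    refine ⟨?_, hcard t ht⟩
    intro x hx y hy hxy
    simp only [htr, Finset.coe_image, Set.mem_image, Finset.mem_coe] at hx hy
    obtain ⟨i, hi, rfl⟩ := hx
    obtain ⟨j, hj, rfl⟩ := hy
    exact (hpair t ht i hi j hj hxy).1
  · intro t₁ ht₁ t₂ ht₂ hne
    simp only [List.mem_toFinset, List.mem_map] at ht₁ ht₂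
    obtain ⟨t₁, ht₁, rfl⟩ := ht₁
    obtain ⟨t₂, ht₂, rfl⟩ := ht₂
    rw [hinj t₁ ht₁ t₂ ht₂]
    refine Finset.card_image_le.trans ?_
    have : Std.Symm (fun s t : ℕ × ℕ × ℕ => (tset s ∩ tset t).card ≤ 1) :=
      ⟨fun a b h => by rw [Finset.inter_comm]; exact h⟩
    refine hpw.forall ht₁ ht₂ ?_
    rintro rfl; exact hne rfl
  · have e1 : ((S.map tr).toFinset).card = S.length := by
      rw [List.toFinset_card_of_nodup, List.length_map]
      exact List.pairwise_map.2 hpw'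
    rw [e1]
    exact (List.toFinset_card_le _).trans (by simpa using h5)
  · intro x hx y z hxy hxz hyz
    simp only [List.mem_toFinset, List.mem_map] at hx
    obtain ⟨i, hi, rfl⟩ := hx
    obtain ⟨p, hp, hp2⟩ := h2 i hi
    simp only [okNb, Bool.and_eq_true, beq_iff_eq, List.all_eq_true, Bool.or_eq_true] at hp2
    obtain ⟨rfl, hp2⟩ := hp2
    rw [hs.nb p hp, List.mem_map] at hxy hxz
    obtain ⟨j, hj, rfl⟩ := hxy
    obtain ⟨k, hk, rfl⟩ := hxz
    rcases hp2 j hj k hk with ((h | h) | h) | h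
    · exact absurd hyz (hN _ _ h)
    · exact Or.inl (xe_spec f h)
    · exact Or.inr (Or.inl (xe_spec f h))
    · exact Or.inr (Or.inr (xe_spec f h))
  · intro t ht u hu v hv huv hu0 hv0
    simp only [List.mem_toFinset, List.mem_map] at ht
    obtain ⟨t, ht, rfl⟩ := ht
    simp only [htr, Finset.mem_image] at hu hv
    obtain ⟨i, hi, rfl⟩ := hu
    obtain ⟨j, hj, rfl⟩ := hv
    rcases (hpair t ht i hi j hj huv).2 with h | h | h
    · exact absurd (by simpa using ⟨i, h, rfl⟩) hu0
    · exact absurd (by simpa using ⟨j, h, rfl⟩) hv0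
    · exact h

theorem chk_sound [DecidableEq V] (G : SimpleGraph V) (f : ℕ → V) (C : Cfg) (hs : Sem G f C)
    (cts : List Cert) (t : Tr) : ∀ P N : ℕ, MInv P (fun i j => G.Adj (f i) (f j)) →
    MInv N (fun i j => ¬ G.Adj (f i) (f j)) → chk C cts t P N = true →
    ∃ V₀ : Finset V, ReducibleVertexSet G V₀ := by
  induction t with
  | nd i j p q ihp ihq =>
    intro P N hP hN h
    simp only [chk, Bool.and_eq_true, decide_eq_true_eq] at h
    obtain ⟨⟨⟨hi, hj⟩, h1⟩, h2⟩ := h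
    by_cases hadj : G.Adj (f i) (f j)
    · exact ihp _ _ (hP.add2 hi hj hadj hadj.symm) hN h1
    · exact ihq _ _ hP (hN.add2 hi hj hadj (fun h => hadj h.symm)) h2
  | ct k =>
    intro P N hP hN h
    simp only [chk] at h
    split at h
    · exact okCert_sound G f C hs P N hP hN _ h
    · exact absurd h (by simp)
  | cm v i j k =>
    intro P N hP hN h
    exfalso
    simp only [chk, okCm, Bool.and_eq_true, decide_eq_true_eq, List.contains_iff_mem] at h
    obtain ⟨⟨⟨⟨⟨⟨⟨⟨⟨⟨⟨hv, h1⟩, h2⟩, h3⟩, hi⟩, hj⟩, hk⟩, h4⟩, h5⟩, h6⟩, h7⟩, h8⟩ := h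
    rcases hs.low v hv (f i) (f j) (f k) (hP _ _ h1) (hP _ _ h2) (hP _ _ h3)
      (fun e => h4 (hs.inj _ hi _ hj e)) (fun e => h5 (hs.inj _ hi _ hk e))
      (fun e => h6 (hs.inj _ hj _ hk e)) with h | h
    · exact hN _ _ h7 h
    · exact hN _ _ h8 h
  | cut v c =>
    intro P N hP hN h
    exfalso
    simp only [chk, okCut, Bool.and_eq_true, List.contains_iff_mem, List.any_eq_true,
      beq_iff_eq, List.all_eq_true, decide_eq_true_eq, Bool.or_eq_true, Bool.not_eq_true'] at h
    obtain ⟨hv, p, hp, ⟨⟨⟨rfl, hlt⟩, x, hx, hxc⟩, y, hy, hyc⟩, hall⟩ := h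
    have hmem : ∀ z ∈ p.2, G.Adj (f p.1) (f z) := fun z hz =>
      (hs.nb p hp _).2 (List.mem_map.2 ⟨z, hz, rfl⟩)
    have hPi : ∀ z ∈ p.2, (∃ i ∈ p.2, i ∈ c ∧ f i = f z) → z ∈ c := by
      rintro z hz ⟨i, hi, hic, e⟩
      rw [← hs.inj i (hlt i hi) z (hlt z hz) e]; exact hic
    have hyc' : y ∉ c := fun h => by simp [h] at hyc
    obtain ⟨a, b, ha, hPa, hb, hPb, hab⟩ := hs.conn _ hv (fun w => ∃ i ∈ p.2, i ∈ c ∧ f i = w)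
      ⟨f x, hmem x hx, x, hx, hxc, rfl⟩ ⟨f y, hmem y hy, fun h => hyc' (hPi y hy h)⟩
    obtain ⟨i, hi, hic, rfl⟩ := hPa
    rw [hs.nb p hp, List.mem_map] at hb
    obtain ⟨j, hj, rfl⟩ := hb
    rcases hall i hi j hj with (h | h) | h
    · simp [hic] at h
    · exact hPb ⟨j, hj, h, rfl⟩
    · exact hN _ _ h hab
  | cl =>
    intro P N hP hN h
    exfalso
    simp only [chk, List.any_eq_true, List.all_eq_true] at h
    obtain ⟨c, hc, h⟩ := h
    obtain ⟨l, hl, hl2⟩ := hs.cls c hc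
    have := h l hl
    split at this
    · rename_i h1; rw [if_pos h1] at hl2; exact hN _ _ this hl2
    · rename_i h1; rw [if_neg h1] at hl2; exact hl2 (hP _ _ this)

theorem chkAll_sound [DecidableEq V] (G : SimpleGraph V) (f : ℕ → V) (C : Cfg) 
    (cts : List Cert) (t : Tr) (h : chkAll C cts t = true) (hs : Sem G f C) :
    ∃ V₀ : Finset V, ReducibleVertexSet G V₀ := by
  simp only [chkAll, okIdx, Bool.and_eq_true, decide_eq_true_eq, List.all_eq_true] at h
  obtain ⟨⟨⟨⟨hn, h1⟩, h2⟩, h3⟩, h⟩ := h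
  refine chk_sound G f C hs cts t _ _ (inv_addAll _ ?_) (inv_addAll _ ?_) h
  · intro q hq
    simp only [initP, List.mem_append, List.mem_flatMap, List.mem_map] at hq
    rcases hq with ⟨p, hp, j, hj, rfl⟩ | hq
    · have ha : G.Adj (f p.1) (f j) := (hs.nb p hp _).2 (List.mem_map.2 ⟨j, hj, rfl⟩)
      have := h1 p hp
      have := this.2 j hj
      exact ⟨by dsimp only; omega, by dsimp only; omega, ha, ha.symm⟩
    · have := h2 q hq
      exact ⟨by omega, by omega, hs.pos q hq, (hs.pos q hq).symm⟩
  · intro q hq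
    simp only [initN, List.mem_append, List.mem_flatMap, List.mem_map, List.mem_filter,
      List.mem_range] at hq
    rcases hq with (⟨p, hp, j, ⟨hj, hj2⟩, rfl⟩ | hq) | ⟨i, hi, rfl⟩
    · have hnot : ¬ G.Adj (f p.1) (f j) := by
        rw [hs.nb p hp, List.mem_map]
        rintro ⟨k, hk, e⟩
        have := hs.inj k ((h1 p hp).2 k hk) j hj e
        subst this
        simp [hk] at hj2
      have := h1 p hp
      exact ⟨by dsimp only; omega, by dsimp only; omega, hnot, fun h => hnot h.symm⟩
    · have := h3 q hq
      exact ⟨by omega, by omega, hs.neg q hq, fun h => hs.neg q hq h.symm⟩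
    · exact ⟨by dsimp only; omega, by dsimp only; omega, G.loopless.irrefl _, G.loopless.irrefl _⟩
/-- The map from indices to vertices given by a list. -/
def fL (l : List V) (d : V) : ℕ → V := fun i => l.getD i d

theorem fL_inj {l : List V} {d : V} (h : l.Nodup) :
    ∀ i < l.length, ∀ j < l.length, fL l d i = fL l d j → i = j := by
  intro i hi j hj e
  simp only [fL, List.getD_eq_getElem _ _ hi, List.getD_eq_getElem _ _ hj] at e
  exact (h.getElem_inj_iff).1 e

theorem fm_nil {α : Type*} (P : α → Prop) : ∀ x ∈ ([] : List α), P x := by simp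

theorem fm_cons {α : Type*} {P : α → Prop} {a : α} {l : List α} (h : P a) (h' : ∀ x ∈ l, P x) :
    ∀ x ∈ a :: l, P x := List.forall_mem_cons.2 ⟨h, h'⟩

def clT (G : SimpleGraph V) (f : ℕ → V) (c : List (Bool × ℕ × ℕ)) : Prop :=
  ∃ l ∈ c, if l.1 then G.Adj (f l.2.1) (f l.2.2) else ¬ G.Adj (f l.2.1) (f l.2.2)

def tri3 : List (ℕ × ℕ × ℕ) := [(4,5,6),(4,5,7),(4,5,8),(4,6,7),(4,6,8),(4,7,8),(5,6,7),(5,6,8),(5,7,8),(6,7,8)]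

def fcl : List (List (Bool × ℕ × ℕ)) :=
  tri3.map (fun t => [(true,3,t.1),(true,3,t.2.1),(true,3,t.2.2)]) ++
  [1,2].flatMap (fun a => tri3.map (fun t => [(false,a,t.1),(false,3,t.1),(false,a,t.2.1),(false,3,t.2.1),
    (false,a,t.2.2),(false,3,t.2.2)]))

def fcl3 : List (List (Bool × ℕ × ℕ)) :=
  [[5,6,7,8],[4,6,7,8],[4,5,7,8],[4,5,6,8],[4,5,6,7]].map (fun l => l.map (fun i => (false,3,i)))

def k5_ct : List Cert := [
  ([0],[(0,1,4),(0,2,3)],[4,5,20,35]),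
  ([0],[(0,2,3),(0,1,5)],[4,5,21,35]),
  ([0],[(0,2,5),(0,1,4)],[4,5,20,37]),
  ([0],[(0,1,4),(0,3,5)],[1,4,20,53]),
  ([0],[(0,1,5)],[4,21]),
  ([0],[(0,1,4)],[4,20]),
  ([0],[(0,1,5),(0,2,4)],[4,5,21,36]),
  ([0],[(0,1,5),(0,3,4)],[2,5,21,52]),
  ([0],[(0,1,5)],[5,21])]

def k5_tr : Tr :=
  (.nd 2 3 (.nd 1 4 (.ct 0) (.nd 1 5 (.ct 1) (.cut 0 [1]))) (.nd 1 4 (.nd 2 5 (.ct 2) (.nd 3 5 (.ct 3) (.nd 1 5 (.ct 4) (.ct 5)))) (.nd 1 5 (.nd 2 4 (.ct 6) (.nd 3 4 (.ct 7) (.ct 8))) (.cut 0 [1]))))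

def k5_C : Cfg :=
  ⟨6, [(0,[1,2,3,4,5])], [], [(1,2),(1,3)], [], [0], []⟩

theorem k5_red [DecidableEq V] (G : SimpleGraph V) (x0 x1 x2 x3 x4 x5 : V) (hnd : [x0, x1, x2, x3,
    x4, x5].Nodup) (hb0 : ∀ w, G.Adj x0 w ↔ w ∈ [x1, x2, x3, x4, x5]) (n12 : ¬ G.Adj x1 x2) (n13 :
    ¬ G.Adj x1 x3) (c0 : CoN G x0) :
    ∃ V₀ : Finset V, ReducibleVertexSet G V₀ :=
  chkAll_sound G (fL [x0, x1, x2, x3, x4, x5] x0) k5_C k5_ct k5_tr (by decide +kernel)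
    ⟨fL_inj hnd,
    (fm_cons hb0 (fm_nil _)),
    (fm_nil _),
    (fm_cons n12 (fm_cons n13 (fm_nil _))),
    (fm_nil _),
    (fm_cons c0 (fm_nil _)),
    (fm_nil _)⟩

def k61_ct : List Cert := [
  ([0],[(0,1,5),(0,2,6),(0,3,4)],[4,5,6,21,38,52]),
  ([0],[(0,3,6),(0,2,4),(0,1,5)],[1,4,5,21,36,54]),
  ([0],[(0,1,6),(0,3,4),(0,2,5)],[3,4,5,22,37,52]),
  ([0],[(0,1,5),(0,3,6)],[4,5,21,54]),
  ([0],[(0,3,4),(0,1,6)],[4,5,22,52]),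
  ([0],[(0,1,5),(0,3,4)],[4,5,21,52]),
  ([0],[(0,3,4),(0,1,6),(0,2,5)],[3,4,6,22,37,52]),
  ([0],[(0,2,6),(0,1,4),(0,3,5)],[2,4,6,20,38,53]),
  ([0],[(0,2,5),(0,3,4)],[4,6,37,52]),
  ([0],[(0,3,5),(0,2,6)],[4,6,38,53]),
  ([0],[(0,2,6),(0,3,4)],[4,6,38,52]),
  ([0],[(0,3,6),(0,2,5)],[4,5,37,54]),
  ([0],[(0,3,4),(0,2,5)],[4,5,37,52]),
  ([0],[(0,2,4),(0,3,5)],[4,6,36,53]),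
  ([0],[(0,2,4),(0,1,6)],[4,6,22,36]),
  ([0],[(0,2,4),(0,3,6)],[4,5,36,54]),
  ([0],[(0,3,4),(0,5,6)],[4,52,86]),
  ([0],[(0,2,4)],[4,36]),
  ([0],[(0,1,6),(0,3,5),(0,2,4)],[1,5,6,22,36,53]),
  ([0],[(0,3,5),(0,1,4)],[5,6,20,53]),
  ([0],[(0,1,6),(0,3,5)],[5,6,22,53]),
  ([0],[(0,1,4),(0,2,5),(0,3,6)],[1,4,6,20,37,54]),
  ([0],[(0,2,4),(0,3,6),(0,1,5)],[1,5,6,21,36,54]),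
  ([0],[(0,3,6),(0,1,4)],[5,6,20,54]),
  ([0],[(0,2,4),(0,1,6)],[5,6,22,36]),
  ([0],[(0,2,5),(0,3,6)],[5,6,37,54]),
  ([0],[(0,3,6),(0,1,5)],[5,6,21,54]),
  ([0],[(0,4,5),(0,3,6)],[2,6,54,69]),
  ([0],[(0,1,6)],[6,22]),
  ([0],[(0,1,5),(0,2,6)],[4,5,21,38]),
  ([0],[(0,4,6),(0,3,5)],[4,5,53,70]),
  ([0],[(0,3,5),(0,1,4)],[4,5,20,53]),
  ([0],[(0,2,4),(0,1,5)],[4,5,21,36]),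
  ([0],[(0,1,5)],[5,21]),
  ([0],[(0,2,5),(0,3,6),(0,1,4)],[3,4,6,20,37,54]),
  ([0],[(0,2,5),(0,1,4)],[4,6,20,37]),
  ([0],[(0,3,5),(0,1,4)],[4,6,20,53]),
  ([0],[(0,1,4),(0,3,6)],[4,6,20,54])]

def k61_tr : Tr :=
  (.nd 3 4 (.nd 1 5 (.nd 2 6 (.ct 0) (.nd 3 6 (.nd 2 4 (.ct 1) (.nd 1 6 (.nd 2 5 (.ct 2) (.cut 0 [1,3,4,5,6])) (.ct 3))) (.nd 1 6 (.ct 4) (.ct 5)))) (.nd 2 6 (.nd 2 5 (.nd 3 5 (.nd 1 6 (.ct 6) (.nd 1 4 (.ct 7) (.cut 0 [1]))) (.ct 8)) (.nd 3 5 (.ct 9) (.ct 10))) (.nd 2 5 (.nd 1 6 (.ct 2) (.nd 3 6 (.ct 11) (.ct 12))) (.nd 2 4 (.nd 3 5 (.ct 13) (.nd 1 6 (.ct 14) (.nd 3 6 (.ct 15) (.nd 5 6 (.ct 16) (.ct 17))))) (.cut 0 [1,3,4,5,6]))))) (.nd 1 6 (.nd 3 5 (.nd 2 4 (.ct 18)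 (.nd 1 4 (.ct 19) (.ct 20))) (.nd 3 6 (.nd 1 4 (.nd 2 4 (.nd 2 5 (.ct 21) (.nd 1 5 (.ct 22) (.ct 14))) (.ct 23)) (.nd 2 4 (.ct 24) (.nd 2 5 (.ct 25) (.nd 1 5 (.ct 26) (.nd 4 5 (.ct 27) (.ct 28)))))) (.cut 0 [1,2,4,5,6]))) (.nd 1 5 (.nd 2 6 (.nd 3 6 (.nd 2 4 (.ct 22) (.nd 1 4 (.ct 23) (.ct 26))) (.ct 29)) (.nd 3 6 (.ct 3) (.nd 3 5 (.nd 4 6 (.ct 30) (.nd 1 4 (.ct 31) (.nd 2 4 (.ct 32) (.ct 33)))) (.cut 0 [1,2,4,5,6])))) (.nd 1 4 (.nd 2 5 (.nd 3 5 (.nd 3 6 (.ct 34) (.nd 2 6 (.ct 7) (.ct 31))) (.ct 35)) (.nd 3 5 (.ct 36) (.nd 3 6 (.ct 37) (.cut 0 [1,2,4,5,6])))) (.cut 0 [1])))))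

def k61_C : Cfg :=
  ⟨7, [(0,[1,2,3,4,5,6])], [], [(1,2),(1,3),(2,3)], [], [0], []⟩

theorem k61_red [DecidableEq V] (G : SimpleGraph V) (x0 x1 x2 x3 x4 x5 x6 : V) (hnd : [x0, x1, x2,
    x3, x4, x5, x6].Nodup) (hb0 : ∀ w, G.Adj x0 w ↔ w ∈ [x1, x2, x3, x4, x5, x6]) (n12 : ¬ G.Adj
    x1 x2) (n13 : ¬ G.Adj x1 x3) (n23 : ¬ G.Adj x2 x3) (c0 : CoN G x0) :
    ∃ V₀ : Finset V, ReducibleVertexSet G V₀ :=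
  chkAll_sound G (fL [x0, x1, x2, x3, x4, x5, x6] x0) k61_C k61_ct k61_tr (by decide +kernel)
    ⟨fL_inj hnd,
    (fm_cons hb0 (fm_nil _)),
    (fm_nil _),
    (fm_cons n12 (fm_cons n13 (fm_cons n23 (fm_nil _)))),
    (fm_nil _),
    (fm_cons c0 (fm_nil _)),
    (fm_nil _)⟩

def k62_ct : List Cert := [
  ([0],[(0,2,3),(0,4,6),(0,1,5)],[4,5,6,21,35,70]),
  ([0],[(0,5,6),(0,1,4),(0,2,3)],[4,5,6,20,35,86]),
  ([0],[(0,2,3),(0,1,6),(0,4,5)],[1,2,3,22,35,69]),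
  ([0],[(0,3,6),(0,2,4),(0,1,5)],[2,3,4,21,36,54]),
  ([0],[(0,2,6),(0,1,4)],[3,5,20,38]),
  ([0],[(0,1,5),(0,2,4),(0,3,6)],[3,5,6,21,36,54]),
  ([0],[(0,3,4),(0,1,6)],[2,5,22,52]),
  ([0],[(0,3,4),(0,1,6),(0,2,5)],[3,4,6,22,37,52]),
  ([0],[(0,4,5),(0,1,6),(0,2,3)],[2,3,4,22,35,69]),
  ([0],[(0,1,4),(0,3,5),(0,2,6)],[2,4,6,20,38,53]),
  ([0],[(0,1,6),(0,2,5)],[3,4,22,37])]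

def k62_tr : Tr :=
  (.nd 1 5 (.nd 4 6 (.ct 0) (.nd 1 4 (.nd 5 6 (.ct 1) (.nd 4 5 (.nd 1 6 (.ct 2) (.nd 2 6 (.nd 3 6 (.nd 2 4 (.ct 3) (.ct 4)) (.cl)) (.cl))) (.cl))) (.nd 2 4 (.nd 1 6 (.nd 3 6 (.ct 5) (.nd 3 4 (.ct 6) (.cl))) (.cl)) (.cl)))) (.nd 3 5 (.nd 2 5 (.nd 5 6 (.nd 1 4 (.ct 1) (.nd 3 4 (.nd 1 6 (.ct 7) (.cut 0 [1])) (.cl))) (.nd 1 6 (.nd 2 6 (.nd 4 5 (.ct 8) (.nd 1 4 (.ct 9) (.cl))) (.ct 10)) (.cl))) (.cl)) (.cl)))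

def k62_C : Cfg :=
  ⟨7, [(0,[1,2,3,4,5,6])], [(2,3)], [(1,2),(1,3)], [], [0], [[(true,1,2),(true,1,3),(true,2,3)],[(true,1,2),(true,1,4),(true,2,4)],[(true,1,2),(true,1,5),(true,2,5)],[(true,1,2),(true,1,6),(true,2,6)],[(true,1,3),(true,1,4),(true,3,4)],[(true,1,3),(true,1,5),(true,3,5)],[(true,1,3),(true,1,6),(true,3,6)],[(true,1,4),(true,1,5),(true,4,5)],[(true,1,4),(true,1,6),(true,4,6)],[(true,1,5),(true,1,6),(true,5,6)],[(true,2,3),(true,2,4),(true,3,4)],[(true,2,3),(true,2,5),(true,3,5)],[(true,2,3),(true,2,6),(true,3,6)],[(true,2,4),(true,2,5),(true,4,5)],[(true,2,4),(true,2,6),(true,4,6)],[(true,2,5),(true,2,6),(true,5,6)],[(true,3,4),(true,3,5),(true,4,5)],[(true,3,4),(true,3,6),(true,4,6)],[(true,3,5),(true,3,6),(true,5,6)],[(true,4,5),(true,4,6),(true,5,6)]]⟩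

theorem k62_red [DecidableEq V] (G : SimpleGraph V) (x0 x1 x2 x3 x4 x5 x6 : V) (hnd : [x0, x1, x2,
    x3, x4, x5, x6].Nodup) (hb0 : ∀ w, G.Adj x0 w ↔ w ∈ [x1, x2, x3, x4, x5, x6]) (p23 : G.Adj x2
    x3) (n12 : ¬ G.Adj x1 x2) (n13 : ¬ G.Adj x1 x3) (c0 : CoN G x0) (hcl : ∀ c ∈ k62_C.cls, clT G
    (fL [x0, x1, x2, x3, x4, x5, x6] x0) c) :
    ∃ V₀ : Finset V, ReducibleVertexSet G V₀ :=
  chkAll_sound G (fL [x0, x1, x2, x3, x4, x5, x6] x0) k62_C k62_ct k62_tr (by decide +kernel)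
    ⟨fL_inj hnd,
    (fm_cons hb0 (fm_nil _)),
    (fm_cons p23 (fm_nil _)),
    (fm_cons n12 (fm_cons n13 (fm_nil _))),
    (fm_nil _),
    (fm_cons c0 (fm_nil _)),
    hcl⟩

def a55s_ct : List Cert := [
  ([0,1],[(1,4,5),(0,1,3),(0,2,5)],[1,3,19,36,37,69]),
  ([0,1],[(0,2,4),(0,1,3),(1,2,5)],[1,3,19,36,37]),
  ([0,1],[(0,4,5),(1,2,4),(0,1,3)],[1,3,19,36,69])]

def a55s_tr : Tr :=
  (.nd 2 5 (.nd 4 5 (.ct 0) (.nd 2 4 (.ct 1) (.cm 0 4 2 5))) (.nd 4 5 (.nd 2 4 (.ct 2) (.cm 0 2 4 5)) (.cm 0 5 2 4)))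

def a55s_C : Cfg :=
  ⟨6, [(0,[1,2,3,4,5]),(1,[0,2,3,4,5])], [], [], [0,1], [], []⟩

theorem a55s_red [DecidableEq V] (G : SimpleGraph V) (x0 x1 x2 x3 x4 x5 : V) (hnd : [x0, x1, x2,
    x3, x4, x5].Nodup) (hb0 : ∀ w, G.Adj x0 w ↔ w ∈ [x1, x2, x3, x4, x5]) (hb1 : ∀ w, G.Adj x1 w ↔
    w ∈ [x0, x2, x3, x4, x5]) (l0 : CoM G x0) (l1 : CoM G x1) :
    ∃ V₀ : Finset V, ReducibleVertexSet G V₀ :=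
  chkAll_sound G (fL [x0, x1, x2, x3, x4, x5] x0) a55s_C a55s_ct a55s_tr (by decide +kernel)
    ⟨fL_inj hnd,
    (fm_cons hb0 (fm_cons hb1 (fm_nil _))),
    (fm_nil _),
    (fm_nil _),
    (fm_cons l0 (fm_cons l1 (fm_nil _))),
    (fm_nil _),
    (fm_nil _)⟩

def a55d_ct : List Cert := [
  ([0,1],[(0,2,5),(1,3,6),(0,1,4)],[3,4,18,20,37,54])]

def a55d_tr : Tr :=
  (.nd 2 5 (.nd 3 6 (.ct 0) (.cm 1 6 0 3)) (.cm 0 5 1 2))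

def a55d_C : Cfg :=
  ⟨7, [(0,[1,2,3,4,5]),(1,[0,2,3,4,6])], [], [], [0,1], [], []⟩

theorem a55d_red [DecidableEq V] (G : SimpleGraph V) (x0 x1 x2 x3 x4 x5 x6 : V) (hnd : [x0, x1,
    x2, x3, x4, x5, x6].Nodup) (hb0 : ∀ w, G.Adj x0 w ↔ w ∈ [x1, x2, x3, x4, x5]) (hb1 : ∀ w,
    G.Adj x1 w ↔ w ∈ [x0, x2, x3, x4, x6]) (l0 : CoM G x0) (l1 : CoM G x1) :
    ∃ V₀ : Finset V, ReducibleVertexSet G V₀ :=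
  chkAll_sound G (fL [x0, x1, x2, x3, x4, x5, x6] x0) a55d_C a55d_ct a55d_tr (by decide +kernel)
    ⟨fL_inj hnd,
    (fm_cons hb0 (fm_cons hb1 (fm_nil _))),
    (fm_nil _),
    (fm_nil _),
    (fm_cons l0 (fm_cons l1 (fm_nil _))),
    (fm_nil _),
    (fm_nil _)⟩

def a56_ct : List Cert := [
  ([0,1],[(1,4,5),(0,1,2),(0,3,5),(1,3,6)],[1,2,18,22,52,53,54,69]),
  ([0,1],[(0,1,3),(1,4,6),(0,4,5),(1,2,5)],[3,4,18,19,21,37,69,70]),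
  ([0,1],[(0,2,5),(0,1,3),(1,5,6),(1,2,4)],[1,2,3,19,22,36,37,86])]

def a56_tr : Tr :=
  (.nd 2 6 (.nd 5 6 (.nd 3 6 (.nd 4 6 (.nd 4 5 (.nd 3 5 (.ct 0) (.nd 2 5 (.ct 1) (.cm 0 5 2 3))) (.nd 2 5 (.nd 2 4 (.ct 2) (.cm 0 4 2 5)) (.cm 0 5 2 4))) (.cm 1 6 0 4)) (.cm 1 6 0 3)) (.cm 1 6 0 5)) (.cm 1 6 0 2))

def a56_C : Cfg :=
  ⟨7, [(0,[1,2,3,4,5]),(1,[0,2,3,4,5,6])], [], [], [0,1], [], []⟩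

theorem a56_red [DecidableEq V] (G : SimpleGraph V) (x0 x1 x2 x3 x4 x5 x6 : V) (hnd : [x0, x1, x2,
    x3, x4, x5, x6].Nodup) (hb0 : ∀ w, G.Adj x0 w ↔ w ∈ [x1, x2, x3, x4, x5]) (hb1 : ∀ w, G.Adj x1
    w ↔ w ∈ [x0, x2, x3, x4, x5, x6]) (l0 : CoM G x0) (l1 : CoM G x1) :
    ∃ V₀ : Finset V, ReducibleVertexSet G V₀ :=
  chkAll_sound G (fL [x0, x1, x2, x3, x4, x5, x6] x0) a56_C a56_ct a56_tr (by decide +kernel)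
    ⟨fL_inj hnd,
    (fm_cons hb0 (fm_cons hb1 (fm_nil _))),
    (fm_nil _),
    (fm_nil _),
    (fm_cons l0 (fm_cons l1 (fm_nil _))),
    (fm_nil _),
    (fm_nil _)⟩

def a66s_ct : List Cert := [
  ([0,1],[(0,3,6),(1,2,3),(0,2,5),(1,5,6),(0,1,4)],[1,2,4,18,20,35,37,53,54,86]),
  ([0,1],[(0,1,4),(0,2,3),(0,5,6),(1,2,5)],[1,4,20,35,37,38,53,86]),
  ([0,1],[(0,1,4),(0,2,3),(1,2,6),(0,5,6)],[1,3,4,19,20,35,38,86]),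
  ([0,1],[(0,3,6),(0,2,4),(0,1,5),(1,3,4)],[1,5,6,21,22,36,52,54]),
  ([0,1],[(0,3,5),(0,1,4),(1,2,5),(1,3,6)],[1,2,4,18,20,37,53,54])]

def a66s_tr : Tr :=
  (.nd 5 6 (.nd 2 3 (.nd 2 5 (.nd 3 6 (.ct 0) (.ct 1)) (.nd 2 6 (.ct 2) (.cm 0 2 5 6))) (.nd 3 4 (.nd 3 6 (.nd 2 4 (.ct 3) (.cm 0 2 3 4)) (.cm 0 3 2 6)) (.cm 0 3 2 4))) (.nd 3 6 (.nd 3 5 (.nd 2 5 (.ct 4) (.cm 0 5 2 6)) (.cm 0 5 3 6)) (.cm 0 6 3 5)))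

def a66s_C : Cfg :=
  ⟨7, [(0,[1,2,3,4,5,6]),(1,[0,2,3,4,5,6])], [], [], [0,1], [], []⟩

theorem a66s_red [DecidableEq V] (G : SimpleGraph V) (x0 x1 x2 x3 x4 x5 x6 : V) (hnd : [x0, x1,
    x2, x3, x4, x5, x6].Nodup) (hb0 : ∀ w, G.Adj x0 w ↔ w ∈ [x1, x2, x3, x4, x5, x6]) (hb1 : ∀ w,
    G.Adj x1 w ↔ w ∈ [x0, x2, x3, x4, x5, x6]) (l0 : CoM G x0) (l1 : CoM G x1) :
    ∃ V₀ : Finset V, ReducibleVertexSet G V₀ :=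
  chkAll_sound G (fL [x0, x1, x2, x3, x4, x5, x6] x0) a66s_C a66s_ct a66s_tr (by decide +kernel)
    ⟨fL_inj hnd,
    (fm_cons hb0 (fm_cons hb1 (fm_nil _))),
    (fm_nil _),
    (fm_nil _),
    (fm_cons l0 (fm_cons l1 (fm_nil _))),
    (fm_nil _),
    (fm_nil _)⟩

def a66d_ct : List Cert := [
  ([0,1],[(0,1,4),(0,3,5),(1,2,3),(1,5,7),(0,2,6)],[3,4,5,18,19,20,35,38,53,87]),
  ([0,1],[(1,2,7),(0,3,6),(1,3,5),(0,2,5),(0,1,4)],[1,2,4,5,20,23,37,39,53,54]),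
  ([0,1],[(0,2,5),(1,5,7),(0,1,4),(1,2,3),(0,3,6)],[1,2,4,5,20,23,35,37,54,87])]

def a66d_tr : Tr :=
  (.nd 5 6 (.nd 4 6 (.nd 2 6 (.nd 2 7 (.nd 3 6 (.nd 5 7 (.nd 3 7 (.nd 4 7 (.nd 3 5 (.nd 2 3 (.ct 0) (.nd 2 5 (.ct 1) (.cm 0 2 3 5))) (.nd 2 3 (.nd 2 5 (.ct 2) (.cm 0 5 2 3)) (.cm 0 3 2 5))) (.cm 1 7 0 4)) (.cm 1 7 0 3)) (.cm 1 7 0 5)) (.cm 0 6 1 3)) (.cm 1 7 0 2)) (.cm 0 6 1 2)) (.cm 0 6 1 4)) (.cm 0 6 1 5))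

def a66d_C : Cfg :=
  ⟨8, [(0,[1,2,3,4,5,6]),(1,[0,2,3,4,5,7])], [], [], [0,1], [], []⟩

theorem a66d_red [DecidableEq V] (G : SimpleGraph V) (x0 x1 x2 x3 x4 x5 x6 x7 : V) (hnd : [x0, x1,
    x2, x3, x4, x5, x6, x7].Nodup) (hb0 : ∀ w, G.Adj x0 w ↔ w ∈ [x1, x2, x3, x4, x5, x6]) (hb1 : ∀
    w, G.Adj x1 w ↔ w ∈ [x0, x2, x3, x4, x5, x7]) (l0 : CoM G x0) (l1 : CoM G x1) :
    ∃ V₀ : Finset V, ReducibleVertexSet G V₀ :=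
  chkAll_sound G (fL [x0, x1, x2, x3, x4, x5, x6, x7] x0) a66d_C a66d_ct a66d_tr (by decide +kernel)
    ⟨fL_inj hnd,
    (fm_cons hb0 (fm_cons hb1 (fm_nil _))),
    (fm_nil _),
    (fm_nil _),
    (fm_cons l0 (fm_cons l1 (fm_nil _))),
    (fm_nil _),
    (fm_nil _)⟩

def b57s_ct : List Cert := [
  ([0,1],[(1,4,5),(1,3,6),(0,1,2),(0,3,5),(2,3,4)],[1,22,23,35,36,37,52,53,54,69]),
  ([0,1],[(0,3,4),(0,1,5),(2,3,5),(1,2,4),(1,3,6)],[1,22,23,35,36,37,52,53,54,69]),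
  ([0,1],[(0,1,2),(1,4,6),(1,3,5),(2,3,4),(0,4,5)],[1,22,23,35,36,37,52,53,69,70]),
  ([0,1],[(0,1,2),(1,3,5),(1,4,6),(0,3,4)],[1,2,18,21,23,52,53,70]),
  ([0,1],[(0,3,5),(1,5,6),(0,1,2),(1,3,4)],[1,2,18,23,52,53,69,86]),
  ([0,1],[(0,2,4),(1,3,4),(1,2,6),(0,1,5)],[1,5,21,23,35,36,38,52]),
  ([0,1],[(0,3,4),(0,2,5),(1,3,5),(1,2,4)],[1,23,35,36,37,52,53,69]),
  ([0,1],[(0,1,4),(1,3,5),(0,2,3)],[1,4,20,23,35,53]),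
  ([0,1],[(1,4,5),(1,2,3),(0,3,5),(0,2,4)],[1,22,23,35,36,37,53,69]),
  ([0,1],[(1,3,4),(0,2,3),(0,4,5),(1,2,5)],[1,22,23,35,36,37,52,69]),
  ([0,1],[(1,2,4),(0,2,5),(1,3,5),(0,3,4)],[1,22,23,36,37,52,53,69]),
  ([0,1],[(0,2,5),(0,3,4),(1,4,5),(1,2,3)],[1,22,23,35,37,52,53,69])]

def b57s_tr : Tr :=
  (.nd 2 4 (.nd 2 3 (.nd 3 5 (.nd 3 4 (.nd 3 6 (.nd 4 5 (.ct 0) (.nd 2 5 (.ct 1) (.cm 0 5 2 4))) (.nd 4 6 (.nd 4 5 (.ct 2) (.ct 3)) (.nd 5 6 (.ct 4) (.nd 2 6 (.ct 5) (.nd 2 5 (.ct 6) (.ct 7)))))) (.nd 4 5 (.ct 8) (.cm 0 4 3 5))) (.nd 4 5 (.nd 2 5 (.nd 3 4 (.ct 9) (.cm 0 3 4 5)) (.cm 0 5 2 3)) (.cm 0 5 3 4))) (.nd 3 4 (.nd 2 5 (.nd 3 5 (.ct 10) (.cm 0 3 2 5)) (.cm 0 2 3 5)) (.cm 0 3 2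 4))) (.nd 4 5 (.nd 2 3 (.nd 3 4 (.nd 2 5 (.ct 11) (.cm 0 2 4 5)) (.cm 0 4 2 3)) (.cm 0 2 3 4)) (.cm 0 4 2 5)))

def b57s_C : Cfg :=
  ⟨8, [(0,[1,2,3,4,5]),(1,[0,2,3,4,5,6,7])], [], [], [0], [1], []⟩

theorem b57s_red [DecidableEq V] (G : SimpleGraph V) (x0 x1 x2 x3 x4 x5 x6 x7 : V) (hnd : [x0, x1,
    x2, x3, x4, x5, x6, x7].Nodup) (hb0 : ∀ w, G.Adj x0 w ↔ w ∈ [x1, x2, x3, x4, x5]) (hb1 : ∀ w,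
    G.Adj x1 w ↔ w ∈ [x0, x2, x3, x4, x5, x6, x7]) (l0 : CoM G x0) (c1 : CoN G x1) :
    ∃ V₀ : Finset V, ReducibleVertexSet G V₀ :=
  chkAll_sound G (fL [x0, x1, x2, x3, x4, x5, x6, x7] x0) b57s_C b57s_ct b57s_tr (by decide +kernel)
    ⟨fL_inj hnd,
    (fm_cons hb0 (fm_cons hb1 (fm_nil _))),
    (fm_nil _),
    (fm_nil _),
    (fm_cons l0 (fm_nil _)),
    (fm_cons c1 (fm_nil _)),
    (fm_nil _)⟩

def b67s_ct : List Cert := [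
  ([0,1],[(0,3,4),(0,5,6),(1,3,6),(1,4,5),(0,1,2)],[1,2,18,23,52,53,54,69,70,86]),
  ([0,1],[(1,3,5),(1,4,6),(0,1,2),(0,3,6),(0,4,5)],[1,2,5,18,21,23,53,54,69,70]),
  ([0,1],[(0,3,5),(1,4,5),(0,4,6),(0,1,2),(1,3,6)],[1,2,3,18,19,23,53,54,69,70]),
  ([0,1],[(0,5,6),(1,2,6),(1,3,5),(0,2,3),(0,1,4)],[1,2,4,18,20,23,35,38,53,86]),
  ([0,1],[(0,1,2),(0,3,4),(1,3,5),(0,5,6),(1,4,6)],[1,2,3,18,19,23,52,53,70,86])]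

def b67s_tr : Tr :=
  (.nd 4 5 (.nd 3 6 (.nd 5 6 (.nd 3 4 (.ct 0) (.nd 3 5 (.nd 4 6 (.ct 1) (.cm 0 4 3 6)) (.cm 0 3 4 5))) (.nd 4 6 (.nd 3 5 (.ct 2) (.cm 0 5 3 6)) (.cm 0 6 4 5))) (.nd 2 6 (.nd 3 5 (.nd 5 6 (.nd 2 3 (.ct 3) (.cm 0 3 2 6)) (.cm 0 6 3 5)) (.cm 0 3 5 6)) (.cm 0 6 2 3))) (.nd 5 6 (.nd 3 4 (.nd 4 6 (.nd 3 5 (.ct 4) (.cm 0 5 3 4)) (.cm 0 4 5 6)) (.cm 0 4 3 5)) (.cm 0 5 4 6)))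

def b67s_C : Cfg :=
  ⟨8, [(0,[1,2,3,4,5,6]),(1,[0,2,3,4,5,6,7])], [], [], [0], [1], []⟩

theorem b67s_red [DecidableEq V] (G : SimpleGraph V) (x0 x1 x2 x3 x4 x5 x6 x7 : V) (hnd : [x0, x1,
    x2, x3, x4, x5, x6, x7].Nodup) (hb0 : ∀ w, G.Adj x0 w ↔ w ∈ [x1, x2, x3, x4, x5, x6]) (hb1 : ∀
    w, G.Adj x1 w ↔ w ∈ [x0, x2, x3, x4, x5, x6, x7]) (l0 : CoM G x0) (c1 : CoN G x1) :
    ∃ V₀ : Finset V, ReducibleVertexSet G V₀ :=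
  chkAll_sound G (fL [x0, x1, x2, x3, x4, x5, x6, x7] x0) b67s_C b67s_ct b67s_tr (by decide +kernel)
    ⟨fL_inj hnd,
    (fm_cons hb0 (fm_cons hb1 (fm_nil _))),
    (fm_nil _),
    (fm_nil _),
    (fm_cons l0 (fm_nil _)),
    (fm_cons c1 (fm_nil _)),
    (fm_nil _)⟩

def b57d1_ct : List Cert := [
  ([0,1],[(0,3,5),(1,3,4),(0,1,2),(2,4,5),(1,6,8)],[1,22,23,24,36,37,52,53,69,104]),
  ([0,1],[(1,2,4),(0,2,5),(0,1,3),(3,4,5),(1,6,7)],[1,22,23,24,36,37,52,53,69,103]),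
  ([1],[(1,3,4),(1,7,8),(0,1,2)],[2,18,19,20,52,120]),
  ([0,1],[(0,3,5),(1,3,4),(2,4,5),(0,1,2)],[18,19,20,36,37,52,53,69])]

def b57d1_tr : Tr :=
  (.nd 3 4 (.nd 3 5 (.nd 2 5 (.nd 2 4 (.nd 4 5 (.nd 6 8 (.ct 0) (.nd 6 7 (.ct 1) (.nd 7 8 (.ct 2) (.ct 3)))) (.cm 0 5 1 4)) (.cm 0 2 3 4)) (.cm 0 2 3 5)) (.cm 0 3 2 5)) (.cm 0 3 2 4))

def b57d1_C : Cfg :=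
  ⟨9, [(0,[1,2,3,4,5]),(1,[0,2,3,4,6,7,8])], [], [(2,3)], [0], [1], []⟩

theorem b57d1_red [DecidableEq V] (G : SimpleGraph V) (x0 x1 x2 x3 x4 x5 x6 x7 x8 : V) (hnd : [x0,
    x1, x2, x3, x4, x5, x6, x7, x8].Nodup) (hb0 : ∀ w, G.Adj x0 w ↔ w ∈ [x1, x2, x3, x4, x5]) (hb1
    : ∀ w, G.Adj x1 w ↔ w ∈ [x0, x2, x3, x4, x6, x7, x8]) (n23 : ¬ G.Adj x2 x3) (l0 : CoM G x0)
    (c1 : CoN G x1) :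
    ∃ V₀ : Finset V, ReducibleVertexSet G V₀ :=
  chkAll_sound G (fL [x0, x1, x2, x3, x4, x5, x6, x7, x8] x0) b57d1_C b57d1_ct b57d1_tr (by decide +kernel)
    ⟨fL_inj hnd,
    (fm_cons hb0 (fm_cons hb1 (fm_nil _))),
    (fm_nil _),
    (fm_cons n23 (fm_nil _)),
    (fm_cons l0 (fm_nil _)),
    (fm_cons c1 (fm_nil _)),
    (fm_nil _)⟩

def b57d2_ct : List Cert := [
  ([0,1],[(0,2,3),(1,3,6),(1,7,8),(1,2,4),(0,4,5)],[2,3,20,23,24,35,36,54,69,120]),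
  ([0,1],[(1,3,6),(1,2,8),(0,4,5),(0,2,3),(1,4,7)],[2,3,20,23,24,35,40,54,69,71]),
  ([0,1],[(0,1,2),(0,3,5),(1,3,6),(1,4,8)],[2,4,18,19,22,53,54,72]),
  ([1],[(0,1,4),(1,2,8),(1,3,6)],[4,18,19,22,40,54]),
  ([0,1],[(1,2,8),(0,1,3),(0,2,5),(1,4,6),(2,3,4)],[1,5,23,24,35,36,37,40,52,70]),
  ([0,1],[(2,4,5),(0,1,2),(1,3,4),(1,6,8),(0,3,5)],[1,23,24,35,36,37,52,53,69,104]),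
  ([0,1],[(1,6,7),(0,2,3),(1,3,4),(1,2,8),(0,4,5)],[2,3,20,23,24,35,40,52,69,103]),
  ([1],[(0,1,2),(1,3,4),(1,6,8)],[2,19,20,23,52,104]),
  ([1],[(1,3,4),(0,1,2),(1,7,8)],[2,19,20,23,52,120]),
  ([1],[(1,6,7),(0,1,2),(1,3,4)],[2,19,20,23,52,103]),
  ([0,1],[(0,2,3),(1,2,7),(0,4,5),(1,3,4)],[2,3,19,20,35,39,52,69]),
  ([1],[(0,1,2),(1,3,4)],[2,19,20,52])]

def b57d2_tr : Tr :=
  (.nd 2 5 (.nd 3 5 (.nd 4 5 (.nd 2 8 (.nd 3 6 (.nd 7 8 (.ct 0) (.nd 4 7 (.ct 1) (.nd 4 8 (.ct 2) (.ct 3)))) (.nd 4 6 (.ct 4) (.nd 6 8 (.ct 5) (.nd 6 7 (.ct 6) (.cut 1 [0,2,3,4,7,8]))))) (.nd 6 8 (.ct 7) (.nd 7 8 (.ct 8) (.nd 6 7 (.ct 9) (.nd 2 7 (.ct 10) (.ct 11)))))) (.cm 0 5 1 4)) (.cm 0 5 1 3)) (.cm 0 5 1 2))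

def b57d2_C : Cfg :=
  ⟨9, [(0,[1,2,3,4,5]),(1,[0,2,3,4,6,7,8])], [(2,3),(2,4),(3,4)], [(2,6)], [0], [1], []⟩

theorem b57d2_red [DecidableEq V] (G : SimpleGraph V) (x0 x1 x2 x3 x4 x5 x6 x7 x8 : V) (hnd : [x0,
    x1, x2, x3, x4, x5, x6, x7, x8].Nodup) (hb0 : ∀ w, G.Adj x0 w ↔ w ∈ [x1, x2, x3, x4, x5]) (hb1
    : ∀ w, G.Adj x1 w ↔ w ∈ [x0, x2, x3, x4, x6, x7, x8]) (p23 : G.Adj x2 x3) (p24 : G.Adj x2 x4)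
    (p34 : G.Adj x3 x4) (n26 : ¬ G.Adj x2 x6) (l0 : CoM G x0) (c1 : CoN G x1) :
    ∃ V₀ : Finset V, ReducibleVertexSet G V₀ :=
  chkAll_sound G (fL [x0, x1, x2, x3, x4, x5, x6, x7, x8] x0) b57d2_C b57d2_ct b57d2_tr (by decide +kernel)
    ⟨fL_inj hnd,
    (fm_cons hb0 (fm_cons hb1 (fm_nil _))),
    (fm_cons p23 (fm_cons p24 (fm_cons p34 (fm_nil _)))),
    (fm_cons n26 (fm_nil _)),
    (fm_cons l0 (fm_nil _)),
    (fm_cons c1 (fm_nil _)),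
    (fm_nil _)⟩

def b67d1_ct : List Cert := [
  ([0,1],[(1,2,5),(3,4,5),(0,2,4),(0,1,3),(0,5,6)],[1,6,23,24,36,37,52,53,69,86]),
  ([0,1],[(1,2,4),(0,2,5),(1,3,5),(0,3,4)],[1,6,23,24,36,37,52,53])]

def b67d1_tr : Tr :=
  (.nd 3 6 (.nd 2 4 (.nd 5 6 (.nd 2 5 (.nd 3 5 (.nd 3 4 (.nd 4 5 (.ct 0) (.ct 1)) (.cm 0 3 2 4)) (.cm 0 3 2 5)) (.cm 0 2 3 5)) (.cm 0 6 1 5)) (.cm 0 2 3 4)) (.cm 0 3 2 6))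

def b67d1_C : Cfg :=
  ⟨9, [(0,[1,2,3,4,5,6]),(1,[0,2,3,4,5,7,8])], [], [(2,3)], [0], [1], []⟩

theorem b67d1_red [DecidableEq V] (G : SimpleGraph V) (x0 x1 x2 x3 x4 x5 x6 x7 x8 : V) (hnd : [x0,
    x1, x2, x3, x4, x5, x6, x7, x8].Nodup) (hb0 : ∀ w, G.Adj x0 w ↔ w ∈ [x1, x2, x3, x4, x5, x6])
    (hb1 : ∀ w, G.Adj x1 w ↔ w ∈ [x0, x2, x3, x4, x5, x7, x8]) (n23 : ¬ G.Adj x2 x3) (l0 : CoM G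
    x0) (c1 : CoN G x1) :
    ∃ V₀ : Finset V, ReducibleVertexSet G V₀ :=
  chkAll_sound G (fL [x0, x1, x2, x3, x4, x5, x6, x7, x8] x0) b67d1_C b67d1_ct b67d1_tr (by decide +kernel)
    ⟨fL_inj hnd,
    (fm_cons hb0 (fm_cons hb1 (fm_nil _))),
    (fm_nil _),
    (fm_cons n23 (fm_nil _)),
    (fm_cons l0 (fm_nil _)),
    (fm_cons c1 (fm_nil _)),
    (fm_nil _)⟩

def b67d2_ct : List Cert := [
  ([0,1],[(0,1,5),(1,3,4),(0,2,4),(1,2,8),(2,3,5),(0,3,6)],[1,6,23,24,35,36,37,40,52,53,54,69]),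
  ([1],[(0,1,2),(1,3,4),(1,7,8)],[2,19,20,21,52,120]),
  ([1],[(1,3,8),(1,4,5),(0,1,2)],[2,19,20,21,56,69]),
  ([1],[(0,1,2),(1,4,5),(1,3,7)],[2,19,20,21,55,69]),
  ([0,1],[(1,2,4),(0,1,5),(0,2,3),(0,4,6)],[2,3,5,20,21,35,36,70])]

def b67d2_tr : Tr :=
  (.nd 3 6 (.nd 2 8 (.ct 0) (.nd 7 8 (.ct 1) (.nd 4 6 (.nd 3 8 (.ct 2) (.nd 3 7 (.ct 3) (.ct 4))) (.cm 0 6 1 4)))) (.cm 0 6 1 3))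

def b67d2_C : Cfg :=
  ⟨9, [(0,[1,2,3,4,5,6]),(1,[0,2,3,4,5,7,8])], [(2,3),(2,4),(2,5),(3,4),(3,5),(4,5)], [(2,7)], [0], [1], []⟩

theorem b67d2_red [DecidableEq V] (G : SimpleGraph V) (x0 x1 x2 x3 x4 x5 x6 x7 x8 : V) (hnd : [x0,
    x1, x2, x3, x4, x5, x6, x7, x8].Nodup) (hb0 : ∀ w, G.Adj x0 w ↔ w ∈ [x1, x2, x3, x4, x5, x6])
    (hb1 : ∀ w, G.Adj x1 w ↔ w ∈ [x0, x2, x3, x4, x5, x7, x8]) (p23 : G.Adj x2 x3) (p24 : G.Adj x2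
    x4) (p25 : G.Adj x2 x5) (p34 : G.Adj x3 x4) (p35 : G.Adj x3 x5) (p45 : G.Adj x4 x5) (n27 : ¬
    G.Adj x2 x7) (l0 : CoM G x0) (c1 : CoN G x1) :
    ∃ V₀ : Finset V, ReducibleVertexSet G V₀ :=
  chkAll_sound G (fL [x0, x1, x2, x3, x4, x5, x6, x7, x8] x0) b67d2_C b67d2_ct b67d2_tr (by decide +kernel)
    ⟨fL_inj hnd,
    (fm_cons hb0 (fm_cons hb1 (fm_nil _))),
    (fm_cons p23 (fm_cons p24 (fm_cons p25 (fm_cons p34 (fm_cons p35 (fm_cons p45 (fm_nil _))))))),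
    (fm_cons n27 (fm_nil _)),
    (fm_cons l0 (fm_nil _)),
    (fm_cons c1 (fm_nil _)),
    (fm_nil _)⟩

def c55s_ct : List Cert := [
  ([0,1],[(0,3,4),(1,4,6),(1,3,5),(0,5,6)],[2,18,52,53,54,69,70,86]),
  ([0,1],[(0,2,5),(0,3,4),(1,3,5),(1,4,6)],[2,18,37,52,53,54,69,70]),
  ([0,1],[(0,4,6),(1,3,5),(1,2,4),(0,2,3)],[5,6,21,22,35,36,53,70]),
  ([0,1],[(1,2,5),(0,2,3),(1,4,6),(0,5,6)],[4,6,20,22,35,37,70,86]),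
  ([0,1],[(0,3,4),(1,3,6),(1,2,4),(0,2,6)],[2,5,18,21,36,38,52,54])]

def c55s_tr : Tr :=
  (.nd 4 6 (.nd 3 5 (.nd 3 4 (.nd 5 6 (.ct 0) (.nd 2 5 (.ct 1) (.cm 0 5 2 6))) (.nd 2 4 (.nd 2 3 (.ct 2) (.cm 0 3 2 4)) (.cm 0 4 2 3))) (.nd 2 3 (.nd 5 6 (.nd 2 5 (.ct 3) (.cm 0 5 2 3)) (.cm 0 5 3 6)) (.cm 0 3 2 5))) (.nd 3 4 (.nd 2 6 (.nd 3 6 (.nd 2 4 (.ct 4) (.cm 0 4 2 6)) (.cm 0 6 3 4)) (.cm 0 6 2 4)) (.cm 0 4 3 6)))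

def c55s_C : Cfg :=
  ⟨7, [(0,[2,3,4,5,6]),(1,[2,3,4,5,6])], [], [], [0,1], [], []⟩

theorem c55s_red [DecidableEq V] (G : SimpleGraph V) (x0 x1 x2 x3 x4 x5 x6 : V) (hnd : [x0, x1,
    x2, x3, x4, x5, x6].Nodup) (hb0 : ∀ w, G.Adj x0 w ↔ w ∈ [x2, x3, x4, x5, x6]) (hb1 : ∀ w,
    G.Adj x1 w ↔ w ∈ [x2, x3, x4, x5, x6]) (l0 : CoM G x0) (l1 : CoM G x1) :
    ∃ V₀ : Finset V, ReducibleVertexSet G V₀ :=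
  chkAll_sound G (fL [x0, x1, x2, x3, x4, x5, x6] x0) c55s_C c55s_ct c55s_tr (by decide +kernel)
    ⟨fL_inj hnd,
    (fm_cons hb0 (fm_cons hb1 (fm_nil _))),
    (fm_nil _),
    (fm_nil _),
    (fm_cons l0 (fm_cons l1 (fm_nil _))),
    (fm_nil _),
    (fm_nil _)⟩

def c55d_ct : List Cert := [
  ([0,1],[(1,2,5),(0,2,3),(0,4,5),(1,3,4)],[6,23,35,36,37,52,53,69]),
  ([0,1],[(0,3,4),(1,4,5),(1,2,3),(0,2,6)],[6,23,35,36,38,52,53,69]),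
  ([0,1],[(1,2,3),(1,4,5),(0,3,5),(0,4,6)],[2,6,18,23,35,53,69,70]),
  ([0,1],[(1,5,7),(0,2,4),(1,2,3),(0,3,5)],[6,23,35,36,37,52,53,87]),
  ([0,1],[(1,3,4),(0,2,4),(1,2,7),(0,3,5)],[5,6,21,23,36,39,52,53])]

def c55d_tr : Tr :=
  (.nd 2 3 (.nd 4 5 (.nd 3 4 (.nd 2 5 (.ct 0) (.nd 2 6 (.ct 1) (.cm 0 2 5 6))) (.nd 4 6 (.nd 3 5 (.ct 2) (.cm 0 3 4 5)) (.cm 0 4 3 6))) (.nd 5 7 (.nd 3 5 (.nd 2 4 (.ct 3) (.cm 0 4 2 5)) (.cm 0 5 3 4)) (.cm 1 5 4 7))) (.nd 3 4 (.nd 2 7 (.nd 2 4 (.nd 3 5 (.ct 4) (.cm 0 3 2 5)) (.cm 0 2 3 4)) (.cm 1 2 3 7)) (.cm 0 3 2 4)))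

def c55d_C : Cfg :=
  ⟨8, [(0,[2,3,4,5,6]),(1,[2,3,4,5,7])], [], [], [0,1], [], []⟩

theorem c55d_red [DecidableEq V] (G : SimpleGraph V) (x0 x1 x2 x3 x4 x5 x6 x7 : V) (hnd : [x0, x1,
    x2, x3, x4, x5, x6, x7].Nodup) (hb0 : ∀ w, G.Adj x0 w ↔ w ∈ [x2, x3, x4, x5, x6]) (hb1 : ∀ w,
    G.Adj x1 w ↔ w ∈ [x2, x3, x4, x5, x7]) (l0 : CoM G x0) (l1 : CoM G x1) :
    ∃ V₀ : Finset V, ReducibleVertexSet G V₀ :=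
  chkAll_sound G (fL [x0, x1, x2, x3, x4, x5, x6, x7] x0) c55d_C c55d_ct c55d_tr (by decide +kernel)
    ⟨fL_inj hnd,
    (fm_cons hb0 (fm_cons hb1 (fm_nil _))),
    (fm_nil _),
    (fm_nil _),
    (fm_cons l0 (fm_cons l1 (fm_nil _))),
    (fm_nil _),
    (fm_nil _)⟩

def c66d_ct : List Cert := [
  ([0,1],[(0,3,5),(1,4,5),(0,2,7),(1,2,8),(1,3,6),(0,4,6)],[2,7,18,24,39,40,52,53,54,69,70,86]),
  ([0,1],[(0,2,5),(1,2,8),(0,3,6),(1,4,6),(1,3,5),(0,4,7)],[2,7,18,24,37,40,52,53,54,70,71,86]),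
  ([0,1],[(1,3,5),(0,2,5),(0,4,7),(1,4,8),(1,2,6),(0,3,6)],[4,7,20,24,35,37,38,53,54,71,72,86]),
  ([0,1],[(0,4,6),(1,3,4),(0,2,7),(0,3,5),(1,5,6)],[2,7,18,24,39,52,53,69,70,86]),
  ([0,1],[(1,4,5),(1,2,3),(0,6,7),(0,3,5),(0,2,4),(1,6,8)],[6,7,22,24,35,36,37,52,53,69,103,104]),
  ([0,1],[(1,6,8),(1,2,4),(0,3,7),(0,4,6),(1,3,5),(0,2,5)],[4,6,7,20,22,24,36,37,53,55,70,104]),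
  ([0,1],[(0,2,7),(0,3,6),(1,3,8),(1,4,6),(0,4,5),(1,2,5)],[2,7,18,24,37,39,52,54,56,69,70,86]),
  ([0,1],[(0,2,5),(1,4,8),(1,3,5),(0,4,6),(0,3,7),(1,2,6)],[4,7,20,24,35,37,38,53,55,70,72,86]),
  ([0,1],[(1,3,6),(1,4,8),(1,2,5),(0,5,7),(0,4,6),(0,2,3)],[3,4,6,20,22,24,35,37,54,70,72,87]),
  ([0,1],[(0,4,6),(1,3,4),(1,5,8),(1,2,6),(0,5,7),(0,2,3)],[5,7,21,24,35,36,38,52,54,70,87,88]),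
  ([0,1],[(0,3,6),(1,5,6),(1,2,8),(0,4,5),(1,3,4)],[2,7,18,24,40,52,53,54,69,86]),
  ([0,1],[(0,2,6),(1,5,6),(0,4,5),(1,2,4),(1,3,8)],[3,7,19,24,36,37,38,56,69,86])]

def c66d_tr : Tr :=
  (.nd 4 6 (.nd 2 7 (.nd 3 5 (.nd 4 7 (.nd 3 6 (.nd 2 8 (.nd 4 5 (.ct 0) (.nd 2 5 (.ct 1) (.cm 0 5 2 4))) (.nd 2 5 (.nd 2 6 (.nd 4 8 (.ct 2) (.cm 1 8 2 4)) (.cm 1 2 6 8)) (.cm 1 2 5 8))) (.nd 5 6 (.nd 3 4 (.ct 3) (.cm 0 3 4 6)) (.cm 0 6 3 5))) (.nd 2 4 (.nd 5 7 (.nd 3 7 (.nd 6 7 (.nd 3 4 (.nd 4 5 (.nd 6 8 (.nd 2 3 (.ct 4) (.nd 2 5 (.ct 5) (.cm 0 2 3 5))) (.nd 2 8 (.nd 3 6 (.ct 0) (.cm 1 6 3 8)) (.cm 1 8 2 6))) (.cm 0 4 5 7)) (.cm 0 4 3 7)) (.cm 0 7 4 6)) (.cm 0 7 3 4)) (.cm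 0 7 4 5)) (.cm 0 4 2 7))) (.nd 4 5 (.nd 3 6 (.nd 3 8 (.nd 2 5 (.ct 6) (.cm 0 5 2 3)) (.cm 1 3 5 8)) (.cm 0 3 5 6)) (.cm 0 5 3 4))) (.nd 2 5 (.nd 3 7 (.nd 2 6 (.nd 6 7 (.nd 2 4 (.nd 5 7 (.nd 2 3 (.nd 4 7 (.nd 4 8 (.nd 3 5 (.nd 3 6 (.ct 2) (.ct 7)) (.nd 3 6 (.ct 8) (.cm 0 3 5 6))) (.nd 5 8 (.nd 3 4 (.ct 9) (.cm 1 4 3 8)) (.cm 1 8 4 5))) (.cm 0 7 2 4)) (.cm 0 2 3 7)) (.cm 0 7 2 5)) (.cm 0 2 4 7)) (.cm 0 7 2 6)) (.cm 0 2 6 7)) (.cm 0 7 2 3)) (.cm 0 2 5 7))) (.nd 4 5 (.nd 6 7 (.nd 3 4 (.nd 2 6 (.nd 5 6 (.nd 3 6 (.nd 2 4 (.nd 2 8 (.ct 10) (.nd 3 8 (.ct 11) (.cm 1 8 2 3))) (.cm 0 4 2 6)) (.cm 0 6 3 4)) (.cm 0 6 4 5)) (.cm 0 6 2 4)) (.cm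 0 4 3 6)) (.cm 0 6 4 7)) (.cm 0 4 5 6)))

def c66d_C : Cfg :=
  ⟨9, [(0,[2,3,4,5,6,7]),(1,[2,3,4,5,6,8])], [], [], [0,1], [], []⟩

theorem c66d_red [DecidableEq V] (G : SimpleGraph V) (x0 x1 x2 x3 x4 x5 x6 x7 x8 : V) (hnd : [x0,
    x1, x2, x3, x4, x5, x6, x7, x8].Nodup) (hb0 : ∀ w, G.Adj x0 w ↔ w ∈ [x2, x3, x4, x5, x6, x7])
    (hb1 : ∀ w, G.Adj x1 w ↔ w ∈ [x2, x3, x4, x5, x6, x8]) (l0 : CoM G x0) (l1 : CoM G x1) :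
    ∃ V₀ : Finset V, ReducibleVertexSet G V₀ :=
  chkAll_sound G (fL [x0, x1, x2, x3, x4, x5, x6, x7, x8] x0) c66d_C c66d_ct c66d_tr (by decide +kernel)
    ⟨fL_inj hnd,
    (fm_cons hb0 (fm_cons hb1 (fm_nil _))),
    (fm_nil _),
    (fm_nil _),
    (fm_cons l0 (fm_cons l1 (fm_nil _))),
    (fm_nil _),
    (fm_nil _)⟩

def d66_ct : List Cert := [
  ([0,1,6],[(0,3,5),(1,2,5),(4,5,6),(2,3,6),(0,2,4),(1,3,4)],[1,3,8,22,23,35,36,37,52,53,69,104])]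

def d66_tr : Tr :=
  (.ct 0)

def d66_C : Cfg :=
  ⟨9, [(0,[1,2,3,4,5,8]),(1,[0,2,3,4,5,6,7]),(6,[1,2,3,4,5,8])], [(2,3),(2,4),(2,5),(3,4),(3,5),(4,5)], [], [0,6], [], []⟩

theorem d66_red [DecidableEq V] (G : SimpleGraph V) (x0 x1 x2 x3 x4 x5 x6 x7 x8 : V) (hnd : [x0,
    x1, x2, x3, x4, x5, x6, x7, x8].Nodup) (hb0 : ∀ w, G.Adj x0 w ↔ w ∈ [x1, x2, x3, x4, x5, x8])
    (hb1 : ∀ w, G.Adj x1 w ↔ w ∈ [x0, x2, x3, x4, x5, x6, x7]) (hb6 : ∀ w, G.Adj x6 w ↔ w ∈ [x1,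
    x2, x3, x4, x5, x8]) (p23 : G.Adj x2 x3) (p24 : G.Adj x2 x4) (p25 : G.Adj x2 x5) (p34 : G.Adj
    x3 x4) (p35 : G.Adj x3 x5) (p45 : G.Adj x4 x5) (l0 : CoM G x0) (l6 : CoM G x6) :
    ∃ V₀ : Finset V, ReducibleVertexSet G V₀ :=
  chkAll_sound G (fL [x0, x1, x2, x3, x4, x5, x6, x7, x8] x0) d66_C d66_ct d66_tr (by decide +kernel)
    ⟨fL_inj hnd,
    (fm_cons hb0 (fm_cons hb1 (fm_cons hb6 (fm_nil _)))),
    (fm_cons p23 (fm_cons p24 (fm_cons p25 (fm_cons p34 (fm_cons p35 (fm_cons p45 (fm_nil _))))))),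
    (fm_nil _),
    (fm_cons l0 (fm_cons l6 (fm_nil _))),
    (fm_nil _),
    (fm_nil _)⟩

def e6_ct : List Cert := [
  ([0],[(0,3,8),(0,4,6),(0,1,7),(0,2,5)],[5,6,7,8,23,37,56,70]),
  ([0],[(0,3,8),(0,1,6),(0,2,5),(0,4,7)],[5,6,7,8,22,37,56,71]),
  ([0],[(0,4,6),(0,3,7),(0,2,5),(0,1,8)],[5,6,7,8,24,37,55,70]),
  ([0],[(0,1,6),(0,2,5),(0,4,8),(0,3,7)],[5,6,7,8,22,37,55,72]),
  ([0],[(0,2,7),(0,4,5),(0,3,8),(0,1,6)],[5,6,7,8,22,39,56,69]),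
  ([0],[(0,1,8),(0,2,7),(0,3,6),(0,4,5)],[5,6,7,8,24,39,54,69]),
  ([0],[(0,4,8),(0,3,5),(0,2,7),(0,1,6)],[5,6,7,8,22,39,53,72]),
  ([0],[(0,2,6),(0,4,8),(0,1,5)],[6,7,8,21,38,72])]

def e6_tr : Tr :=
  (.nd 2 5 (.nd 3 8 (.nd 4 6 (.ct 0) (.nd 4 7 (.ct 1) (.cl))) (.nd 3 7 (.nd 4 6 (.ct 2) (.nd 4 8 (.ct 3) (.cl))) (.cl))) (.nd 2 7 (.nd 2 8 (.nd 2 6 (.nd 4 5 (.nd 3 8 (.ct 4) (.nd 3 6 (.ct 5) (.cl))) (.nd 4 8 (.nd 3 5 (.ct 6) (.ct 7)) (.cl))) (.cl)) (.cl)) (.cl)))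

def e6_C : Cfg :=
  ⟨9, [(0,[1,2,3,4,5,6,7,8])], [(1,5),(1,6),(1,7),(1,8)], [(1,2),(1,3),(1,4),(2,3),(2,4),(3,4)], [], [], [[(true,1,5),(true,1,6)],[(true,1,5),(true,1,7)],[(true,1,5),(true,1,8)],[(true,1,6),(true,1,7)],[(true,1,6),(true,1,8)],[(true,1,7),(true,1,8)],[(true,2,5),(true,2,6)],[(true,2,5),(true,2,7)],[(true,2,5),(true,2,8)],[(true,2,6),(true,2,7)],[(true,2,6),(true,2,8)],[(true,2,7),(true,2,8)],[(true,3,5),(true,3,6)],[(true,3,5),(true,3,7)],[(true,3,5),(true,3,8)],[(true,3,6),(true,3,7)],[(true,3,6),(true,3,8)],[(true,3,7),(true,3,8)],[(true,4,5),(true,4,6)],[(true,4,5),(true,4,7)],[(true,4,5),(true,4,8)],[(true,4,6),(true,4,7)],[(true,4,6),(true,4,8)],[(true,4,7),(true,4,8)]]⟩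

theorem e6_red [DecidableEq V] (G : SimpleGraph V) (x0 x1 x2 x3 x4 x5 x6 x7 x8 : V) (hnd : [x0,
    x1, x2, x3, x4, x5, x6, x7, x8].Nodup) (hb0 : ∀ w, G.Adj x0 w ↔ w ∈ [x1, x2, x3, x4, x5, x6,
    x7, x8]) (p15 : G.Adj x1 x5) (p16 : G.Adj x1 x6) (p17 : G.Adj x1 x7) (p18 : G.Adj x1 x8) (n12
    : ¬ G.Adj x1 x2) (n13 : ¬ G.Adj x1 x3) (n14 : ¬ G.Adj x1 x4) (n23 : ¬ G.Adj x2 x3) (n24 : ¬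
    G.Adj x2 x4) (n34 : ¬ G.Adj x3 x4) (hcl : ∀ c ∈ e6_C.cls, clT G (fL [x0, x1, x2, x3, x4, x5,
    x6, x7, x8] x0) c) :
    ∃ V₀ : Finset V, ReducibleVertexSet G V₀ :=
  chkAll_sound G (fL [x0, x1, x2, x3, x4, x5, x6, x7, x8] x0) e6_C e6_ct e6_tr (by decide +kernel)
    ⟨fL_inj hnd,
    (fm_cons hb0 (fm_nil _)),
    (fm_cons p15 (fm_cons p16 (fm_cons p17 (fm_cons p18 (fm_nil _))))),
    (fm_cons n12 (fm_cons n13 (fm_cons n14 (fm_cons n23 (fm_cons n24 (fm_cons n34 (fm_nil _))))))),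
    (fm_nil _),
    (fm_nil _),
    hcl⟩

def e51_ct : List Cert := [
  ([0],[(0,2,8),(0,4,5),(0,3,7),(0,1,6)],[5,6,7,8,22,40,55,69]),
  ([0],[(0,2,8),(0,1,5),(0,3,7),(0,4,6)],[5,6,7,8,21,40,55,70]),
  ([0],[(0,1,6),(0,2,5),(0,4,7),(0,3,8)],[5,6,7,8,22,37,56,71]),
  ([0],[(0,2,5),(0,3,8),(0,1,7)],[5,6,8,23,37,56])]

def e51_tr : Tr :=
  (.nd 3 7 (.nd 4 5 (.ct 0) (.nd 4 6 (.ct 1) (.cl))) (.nd 3 8 (.nd 4 7 (.ct 2) (.ct 3)) (.cl)))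

def e51_C : Cfg :=
  ⟨9, [(0,[1,2,3,4,5,6,7,8])], [(1,5),(1,6),(1,7),(2,5),(2,6),(2,8)], [(1,2),(1,3),(1,4),(2,3),(2,4),(3,4),(1,8),(2,7)], [], [], [[(true,3,5),(true,3,6)],[(true,3,5),(true,3,7)],[(true,3,5),(true,3,8)],[(true,3,6),(true,3,7)],[(true,3,6),(true,3,8)],[(true,3,7),(true,3,8)],[(true,4,5),(true,4,6)],[(true,4,5),(true,4,7)],[(true,4,5),(true,4,8)],[(true,4,6),(true,4,7)],[(true,4,6),(true,4,8)],[(true,4,7),(true,4,8)]]⟩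

theorem e51_red [DecidableEq V] (G : SimpleGraph V) (x0 x1 x2 x3 x4 x5 x6 x7 x8 : V) (hnd : [x0,
    x1, x2, x3, x4, x5, x6, x7, x8].Nodup) (hb0 : ∀ w, G.Adj x0 w ↔ w ∈ [x1, x2, x3, x4, x5, x6,
    x7, x8]) (p15 : G.Adj x1 x5) (p16 : G.Adj x1 x6) (p17 : G.Adj x1 x7) (p25 : G.Adj x2 x5) (p26
    : G.Adj x2 x6) (p28 : G.Adj x2 x8) (n12 : ¬ G.Adj x1 x2) (n13 : ¬ G.Adj x1 x3) (n14 : ¬ G.Adj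
    x1 x4) (n23 : ¬ G.Adj x2 x3) (n24 : ¬ G.Adj x2 x4) (n34 : ¬ G.Adj x3 x4) (n18 : ¬ G.Adj x1 x8)
    (n27 : ¬ G.Adj x2 x7) (hcl : ∀ c ∈ e51_C.cls, clT G (fL [x0, x1, x2, x3, x4, x5, x6, x7, x8]
    x0) c) :
    ∃ V₀ : Finset V, ReducibleVertexSet G V₀ :=
  chkAll_sound G (fL [x0, x1, x2, x3, x4, x5, x6, x7, x8] x0) e51_C e51_ct e51_tr (by decide +kernel)
    ⟨fL_inj hnd,
    (fm_cons hb0 (fm_nil _)),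
    (fm_cons p15 (fm_cons p16 (fm_cons p17 (fm_cons p25 (fm_cons p26 (fm_cons p28 (fm_nil _))))))),
    (fm_cons n12 (fm_cons n13 (fm_cons n14 (fm_cons n23 (fm_cons n24 (fm_cons n34 (fm_cons n18
      (fm_cons n27 (fm_nil _))))))))),
    (fm_nil _),
    (fm_nil _),
    hcl⟩

def f41_ct : List Cert := [
  ([0,1],[(0,2,5),(0,1,4),(0,6,7),(1,5,7),(0,3,8)],[1,3,4,8,20,37,56,86,87,103]),
  ([0,1],[(0,2,5),(1,5,7),(0,4,7),(0,3,8),(0,1,6)],[1,3,4,8,20,37,56,71,86,87]),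
  ([0],[(0,3,6),(0,1,4),(0,2,8),(0,5,7)],[4,5,6,7,20,40,54,87]),
  ([0],[(0,2,8),(0,5,7),(0,3,4),(0,1,6)],[4,5,6,7,22,40,52,87]),
  ([0,1],[(0,2,5),(0,1,4),(1,5,6),(0,6,7)],[1,3,4,8,20,37,86,103])]

def f41_tr : Tr :=
  (.nd 5 7 (.nd 3 8 (.nd 6 7 (.ct 0) (.nd 4 7 (.ct 1) (.cm 1 7 4 6))) (.nd 3 6 (.ct 2) (.nd 3 4 (.ct 3) (.cl)))) (.nd 6 7 (.nd 5 6 (.ct 4) (.cm 1 5 6 7)) (.cm 1 7 5 6)))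

def f41_C : Cfg :=
  ⟨9, [(0,[1,2,3,4,5,6,7,8]),(1,[0,4,5,6,7])], [(1,4),(1,5),(1,6),(1,7),(2,4),(2,5),(2,8)], [(1,2),(1,3),(2,3),(1,8),(2,6),(2,7)], [1,2,3], [0], fcl⟩

theorem f41_red [DecidableEq V] (G : SimpleGraph V) (x0 x1 x2 x3 x4 x5 x6 x7 x8 : V) (hnd : [x0,
    x1, x2, x3, x4, x5, x6, x7, x8].Nodup) (hb0 : ∀ w, G.Adj x0 w ↔ w ∈ [x1, x2, x3, x4, x5, x6,
    x7, x8]) (hb1 : ∀ w, G.Adj x1 w ↔ w ∈ [x0, x4, x5, x6, x7]) (p14 : G.Adj x1 x4) (p15 : G.Adj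
    x1 x5) (p16 : G.Adj x1 x6) (p17 : G.Adj x1 x7) (p24 : G.Adj x2 x4) (p25 : G.Adj x2 x5) (p28 :
    G.Adj x2 x8) (n12 : ¬ G.Adj x1 x2) (n13 : ¬ G.Adj x1 x3) (n23 : ¬ G.Adj x2 x3) (n18 : ¬ G.Adj
    x1 x8) (n26 : ¬ G.Adj x2 x6) (n27 : ¬ G.Adj x2 x7) (l1 : CoM G x1) (l2 : CoM G x2) (l3 : CoM G
    x3) (c0 : CoN G x0) (hcl : ∀ c ∈ f41_C.cls, clT G (fL [x0, x1, x2, x3, x4, x5, x6, x7, x8] x0)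
    c) :
    ∃ V₀ : Finset V, ReducibleVertexSet G V₀ :=
  chkAll_sound G (fL [x0, x1, x2, x3, x4, x5, x6, x7, x8] x0) f41_C f41_ct f41_tr (by decide +kernel)
    ⟨fL_inj hnd,
    (fm_cons hb0 (fm_cons hb1 (fm_nil _))),
    (fm_cons p14 (fm_cons p15 (fm_cons p16 (fm_cons p17 (fm_cons p24 (fm_cons p25 (fm_cons p28
      (fm_nil _)))))))),
    (fm_cons n12 (fm_cons n13 (fm_cons n23 (fm_cons n18 (fm_cons n26 (fm_cons n27 (fm_nil _))))))),
    (fm_cons l1 (fm_cons l2 (fm_cons l3 (fm_nil _)))),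
    (fm_cons c0 (fm_nil _)),
    hcl⟩

def f31_ct : List Cert := [
  ([0],[(0,4,5),(0,2,7),(0,1,6),(0,3,8)],[4,5,6,7,22,39,56,69]),
  ([0],[(0,4,6),(0,1,5),(0,3,8),(0,2,7)],[4,5,6,7,21,39,56,70]),
  ([0],[(0,2,5),(0,6,8),(0,3,7),(0,1,4)],[4,5,6,7,20,37,55,104]),
  ([0],[(0,2,4),(0,3,7),(0,5,8),(0,1,6)],[3,4,5,7,22,36,55,88]),
  ([0],[(0,3,7),(0,2,5),(0,4,8),(0,1,6)],[4,5,6,7,22,37,55,72]),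
  ([0],[(0,2,4),(0,7,8),(0,3,6),(0,1,5)],[4,5,6,7,21,36,54,120]),
  ([0],[(0,2,5),(0,1,6),(0,3,7)],[4,5,7,22,37,55]),
  ([0],[(0,2,7),(0,1,4),(0,3,6)],[4,5,6,20,39,54])]

def f31_tr : Tr :=
  (.nd 3 8 (.nd 4 5 (.ct 0) (.nd 4 6 (.ct 1) (.cm 1 4 5 6))) (.nd 3 7 (.nd 6 8 (.ct 2) (.nd 3 6 (.nd 5 8 (.ct 3) (.nd 4 8 (.ct 4) (.nd 7 8 (.ct 5) (.cut 0 [1,2,3,4,5,6,7])))) (.ct 6))) (.nd 3 6 (.nd 7 8 (.ct 5) (.ct 7)) (.cl))))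

def f31_C : Cfg :=
  ⟨9, [(0,[1,2,3,4,5,6,7,8])], [(1,4),(1,5),(1,6),(2,4),(2,5),(2,7)], [(1,2),(1,3),(2,3),(1,7),(1,8),(2,6),(2,8)], [1,2,3], [0], fcl ++ fcl3⟩

theorem f31_red [DecidableEq V] (G : SimpleGraph V) (x0 x1 x2 x3 x4 x5 x6 x7 x8 : V) (hnd : [x0,
    x1, x2, x3, x4, x5, x6, x7, x8].Nodup) (hb0 : ∀ w, G.Adj x0 w ↔ w ∈ [x1, x2, x3, x4, x5, x6,
    x7, x8]) (p14 : G.Adj x1 x4) (p15 : G.Adj x1 x5) (p16 : G.Adj x1 x6) (p24 : G.Adj x2 x4) (p25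
    : G.Adj x2 x5) (p27 : G.Adj x2 x7) (n12 : ¬ G.Adj x1 x2) (n13 : ¬ G.Adj x1 x3) (n23 : ¬ G.Adj
    x2 x3) (n17 : ¬ G.Adj x1 x7) (n18 : ¬ G.Adj x1 x8) (n26 : ¬ G.Adj x2 x6) (n28 : ¬ G.Adj x2 x8)
    (l1 : CoM G x1) (l2 : CoM G x2) (l3 : CoM G x3) (c0 : CoN G x0) (hcl : ∀ c ∈ f31_C.cls, clT G
    (fL [x0, x1, x2, x3, x4, x5, x6, x7, x8] x0) c) :
    ∃ V₀ : Finset V, ReducibleVertexSet G V₀ :=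
  chkAll_sound G (fL [x0, x1, x2, x3, x4, x5, x6, x7, x8] x0) f31_C f31_ct f31_tr (by decide +kernel)
    ⟨fL_inj hnd,
    (fm_cons hb0 (fm_nil _)),
    (fm_cons p14 (fm_cons p15 (fm_cons p16 (fm_cons p24 (fm_cons p25 (fm_cons p27 (fm_nil _))))))),
    (fm_cons n12 (fm_cons n13 (fm_cons n23 (fm_cons n17 (fm_cons n18 (fm_cons n26 (fm_cons n28
      (fm_nil _)))))))),
    (fm_cons l1 (fm_cons l2 (fm_cons l3 (fm_nil _)))),
    (fm_cons c0 (fm_nil _)),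
    hcl⟩

def f32_ct : List Cert := [
  ([0],[(0,2,7),(0,5,8),(0,1,4),(0,3,6)],[4,5,6,8,20,39,54,88]),
  ([0],[(0,3,8),(0,2,7),(0,5,6),(0,1,4)],[4,5,6,8,20,39,56,86]),
  ([0],[(0,5,7),(0,3,8),(0,2,4),(0,1,6)],[2,4,5,6,22,36,56,87]),
  ([0],[(0,3,6),(0,4,7),(0,1,5),(0,2,8)],[4,6,7,8,21,40,54,71]),
  ([0],[(0,3,6),(0,2,7),(0,4,8),(0,1,5)],[4,6,7,8,21,39,54,72]),
  ([0],[(0,3,8),(0,5,7),(0,1,6),(0,2,4)],[4,5,7,8,22,36,56,87]),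
  ([0],[(0,2,7),(0,1,5),(0,3,8),(0,4,6)],[3,4,6,8,21,39,56,70]),
  ([0],[(0,3,6),(0,1,5),(0,4,8),(0,2,7)],[3,4,6,8,21,39,54,72]),
  ([0],[(0,5,6),(0,2,7),(0,1,4),(0,3,8)],[2,5,6,7,20,39,56,86]),
  ([0],[(0,3,8),(0,1,6),(0,2,7),(0,4,5)],[4,5,7,8,22,39,56,69]),
  ([0],[(0,4,7),(0,1,6),(0,2,8),(0,3,5)],[4,5,6,7,22,40,53,71]),
  ([0],[(0,5,7),(0,1,4),(0,3,6),(0,2,8)],[4,5,6,7,20,40,54,87]),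
  ([0],[(0,7,8),(0,2,4),(0,3,5),(0,1,6)],[4,5,7,8,22,36,53,120])]

def f32_tr : Tr :=
  (.nd 3 8 (.nd 5 7 (.nd 3 6 (.nd 3 5 (.nd 3 7 (.cl) (.nd 7 8 (.nd 5 8 (.ct 0) (.nd 5 6 (.ct 1) (.cm 3 5 6 8))) (.ct 2))) (.nd 4 7 (.ct 3) (.nd 4 8 (.ct 4) (.cm 2 4 7 8)))) (.ct 5)) (.nd 4 6 (.ct 6) (.nd 4 5 (.nd 3 6 (.nd 5 6 (.nd 4 8 (.ct 7) (.nd 3 4 (.cm 3 4 6 8) (.ct 8))) (.cm 1 6 4 5)) (.ct 9)) (.cm 1 4 5 6)))) (.nd 4 7 (.nd 3 5 (.ct 10) (.nd 3 6 (.ct 3) (.cl))) (.nd 7 8 (.nd 3 6 (.nd 5 7 (.ct 11) (.nd 4 8 (.ct 7) (.cm 2 4 7 8))) (.nd 3 5 (.ct 12) (.cl))) (.cm 2 7 4 8))))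

def f32_C : Cfg :=
  ⟨9, [(0,[1,2,3,4,5,6,7,8])], [(1,4),(1,5),(1,6),(2,4),(2,7),(2,8)], [(1,2),(1,3),(2,3),(1,7),(1,8),(2,5),(2,6)], [1,2,3], [0], fcl ++ fcl3⟩

theorem f32_red [DecidableEq V] (G : SimpleGraph V) (x0 x1 x2 x3 x4 x5 x6 x7 x8 : V) (hnd : [x0,
    x1, x2, x3, x4, x5, x6, x7, x8].Nodup) (hb0 : ∀ w, G.Adj x0 w ↔ w ∈ [x1, x2, x3, x4, x5, x6,
    x7, x8]) (p14 : G.Adj x1 x4) (p15 : G.Adj x1 x5) (p16 : G.Adj x1 x6) (p24 : G.Adj x2 x4) (p27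
    : G.Adj x2 x7) (p28 : G.Adj x2 x8) (n12 : ¬ G.Adj x1 x2) (n13 : ¬ G.Adj x1 x3) (n23 : ¬ G.Adj
    x2 x3) (n17 : ¬ G.Adj x1 x7) (n18 : ¬ G.Adj x1 x8) (n25 : ¬ G.Adj x2 x5) (n26 : ¬ G.Adj x2 x6)
    (l1 : CoM G x1) (l2 : CoM G x2) (l3 : CoM G x3) (c0 : CoN G x0) (hcl : ∀ c ∈ f32_C.cls, clT G
    (fL [x0, x1, x2, x3, x4, x5, x6, x7, x8] x0) c) :
    ∃ V₀ : Finset V, ReducibleVertexSet G V₀ :=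
  chkAll_sound G (fL [x0, x1, x2, x3, x4, x5, x6, x7, x8] x0) f32_C f32_ct f32_tr (by decide +kernel)
    ⟨fL_inj hnd,
    (fm_cons hb0 (fm_nil _)),
    (fm_cons p14 (fm_cons p15 (fm_cons p16 (fm_cons p24 (fm_cons p27 (fm_cons p28 (fm_nil _))))))),
    (fm_cons n12 (fm_cons n13 (fm_cons n23 (fm_cons n17 (fm_cons n18 (fm_cons n25 (fm_cons n26
      (fm_nil _)))))))),
    (fm_cons l1 (fm_cons l2 (fm_cons l3 (fm_nil _)))),
    (fm_cons c0 (fm_nil _)),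
    hcl⟩
/-- The list `l` enumerates `s`. -/
def En (s : Finset V) (l : List V) : Prop := l.Nodup ∧ ∀ w, w ∈ s ↔ w ∈ l

theorem exL {s : Finset V} {k : ℕ} (h : s.card = k) :
    ∃ l : List V, l.length = k ∧ l.Nodup ∧ ∀ w, w ∈ s ↔ w ∈ l :=
  ⟨s.toList, by simp [h], s.nodup_toList, by simp⟩

theorem En.cons [DecidableEq V] {s : Finset V} {l : List V} {x : V} (h : En (s.erase x) l) (hx : x ∈ s) :
    En s (x :: l) := by
  obtain ⟨h1, h2⟩ := h
  refine ⟨List.nodup_cons.2 ⟨fun h => ?_, h1⟩, fun w => ?_⟩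
  · have := (h2 x).2 h; simp at this
  · have := h2 w
    rw [Finset.mem_erase] at this
    rw [List.mem_cons, ← this]
    by_cases hw : w = x
    · subst hw; simp [hx]
    · simp [hw]

theorem En.append [DecidableEq V] {s t r : Finset V} {l m : List V} (h : En s l) (h' : En t m)
    (hd : ∀ w, w ∈ s → w ∈ t → False) (hr : ∀ w, w ∈ r ↔ w ∈ s ∨ w ∈ t) : En r (l ++ m) := by
  refine ⟨List.nodup_append'.2 ⟨h.1, h'.1, ?_⟩, fun w => ?_⟩
  · intro w h1 h2
    exact hd w ((h.2 w).2 h1) ((h'.2 w).2 h2)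
  · rw [hr, List.mem_append, h.2, h'.2]

theorem en0 {s : Finset V} (h : s.card = 0) :
    En s [] := by
  obtain ⟨l, hl, hn, hm⟩ := exL h
  match l, hl with
  | [], _ => exact ⟨hn, hm⟩

theorem en1 {s : Finset V} (h : s.card = 1) :
    ∃ a0, En s [a0] := by
  obtain ⟨l, hl, hn, hm⟩ := exL h
  match l, hl with
  | [a0], _ => exact ⟨a0, hn, hm⟩

theorem en2 {s : Finset V} (h : s.card = 2) :
    ∃ a0 a1, En s [a0, a1] := by
  obtain ⟨l, hl, hn, hm⟩ := exL h
  match l, hl with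
  | [a0, a1], _ => exact ⟨a0, a1, hn, hm⟩

theorem en3 {s : Finset V} (h : s.card = 3) :
    ∃ a0 a1 a2, En s [a0, a1, a2] := by
  obtain ⟨l, hl, hn, hm⟩ := exL h
  match l, hl with
  | [a0, a1, a2], _ => exact ⟨a0, a1, a2, hn, hm⟩

theorem en4 {s : Finset V} (h : s.card = 4) :
    ∃ a0 a1 a2 a3, En s [a0, a1, a2, a3] := by
  obtain ⟨l, hl, hn, hm⟩ := exL h
  match l, hl with
  | [a0, a1, a2, a3], _ => exact ⟨a0, a1, a2, a3, hn, hm⟩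

theorem en5 {s : Finset V} (h : s.card = 5) :
    ∃ a0 a1 a2 a3 a4, En s [a0, a1, a2, a3, a4] := by
  obtain ⟨l, hl, hn, hm⟩ := exL h
  match l, hl with
  | [a0, a1, a2, a3, a4], _ => exact ⟨a0, a1, a2, a3, a4, hn, hm⟩

theorem en6 {s : Finset V} (h : s.card = 6) :
    ∃ a0 a1 a2 a3 a4 a5, En s [a0, a1, a2, a3, a4, a5] := by
  obtain ⟨l, hl, hn, hm⟩ := exL h
  match l, hl with
  | [a0, a1, a2, a3, a4, a5], _ => exact ⟨a0, a1, a2, a3, a4, a5, hn, hm⟩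

/-- The neighbourhood as a finset. -/
noncomputable def Nb [Fintype V] (G : SimpleGraph V) (v : V) : Finset V := by
  classical exact Finset.univ.filter (G.Adj v)

theorem mem_Nb [Fintype V] {G : SimpleGraph V} {v w : V} : w ∈ Nb G v ↔ G.Adj v w := by
  simp [Nb]

theorem iso_red [DecidableEq V] (G : SimpleGraph V) (v : V) (h : ∀ w, ¬ G.Adj v w) :
    ∃ V₀ : Finset V, ReducibleVertexSet G V₀ := by
  refine ⟨{v}, reducible_of G {v} (by simp) ∅ ∅ ⟨by simp, by simp⟩ (by simp) ?_ (by simp)⟩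
  intro x hx y z hxy
  simp only [Finset.mem_singleton] at hx
  subst hx
  exact absurd hxy (h y)

theorem rob_aux [Fintype V] {G : SimpleGraph V} (hr : Robust G) {v : V} (P : V → Prop)
    (hP : ∀ x y, G.Adj v x → P x → G.Adj v y → G.Adj x y → P y) {x : V} (hx : G.Adj v x)
    (hPx : P x) : ∃ s : Finset V, 5 ≤ s.card ∧ ∀ w ∈ s, G.Adj v w ∧ P w := by
  classical
  set H := G.induce (G.neighborSet v)
  let x' : G.neighborSet v := ⟨x, hx⟩
  have h5 := hr v (H.connectedComponentMk x')
  refine ⟨((H.connectedComponentMk x').supp.image Subtype.val).toFinset, ?_, ?_⟩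
  · rw [← Set.ncard_eq_toFinset_card', Set.ncard_image_of_injective _ Subtype.val_injective]
    exact h5
  · intro w hw
    simp only [Set.mem_toFinset, Set.mem_image] at hw
    obtain ⟨y, hy, rfl⟩ := hw
    refine ⟨y.2, ?_⟩
    have hreach : H.Reachable x' y := (SimpleGraph.ConnectedComponent.exact hy).symm
    have key : ∀ {a b : G.neighborSet v}, H.Walk a b → P a → P b := by
      intro a b p
      induction p with
      | nil => exact id
      | cons hadj p ih =>
        intro ha
        exact ih (hP _ _ (Subtype.property _) ha (Subtype.property _) hadj)
    obtain ⟨p⟩ := hreach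
    exact key p hPx

theorem deg_ge [Fintype V] [DecidableEq V] {G : SimpleGraph V} (hr : Robust G)
    (hR : ¬ ∃ V₀ : Finset V, ReducibleVertexSet G V₀) (v : V) : 5 ≤ (Nb G v).card := by
  by_cases h : ∃ x, G.Adj v x
  · obtain ⟨x, hx⟩ := h
    obtain ⟨s, hs, hs2⟩ := rob_aux hr (fun _ => True) (by simp) hx trivial
    exact hs.trans (Finset.card_le_card fun w hw => mem_Nb.2 (hs2 w hw).1)
  · exact absurd (iso_red G v (by simpa using h)) hR

theorem conn_of [Fintype V] [DecidableEq V] {G : SimpleGraph V} (hr : Robust G) (v : V)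
    (h9 : (Nb G v).card ≤ 9) : CoN G v := by
  intro P hx hy
  by_contra hcon
  push Not at hcon
  obtain ⟨x, hx, hPx⟩ := hx
  obtain ⟨y, hy, hPy⟩ := hy
  obtain ⟨s, hs, hs2⟩ := rob_aux hr P
    (fun a b ha hPa hb hab => by_contra fun hPb => hcon a b ha hPa hb hPb hab) hx hPx
  obtain ⟨t, ht, ht2⟩ := rob_aux hr (fun z => ¬ P z)
    (fun a b ha hPa hb hab hPb => hcon b a hb hPb ha hPa hab.symm) hy hPy
  have hd : Disjoint s t := Finset.disjoint_left.2 fun w h1 h2 => (ht2 w h2).2 (hs2 w h1).2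
  have : (s ∪ t).card ≤ (Nb G v).card := Finset.card_le_card fun w hw => by
    rw [Finset.mem_union] at hw
    exact mem_Nb.2 (hw.elim (fun h => (hs2 w h).1) (fun h => (ht2 w h).1))
  rw [Finset.card_union_of_disjoint hd] at this
  omega

theorem com5 [Fintype V] [DecidableEq V] {G : SimpleGraph V}
    (hR : ¬ ∃ V₀ : Finset V, ReducibleVertexSet G V₀) {v : V} (h5 : (Nb G v).card = 5)
    (hc : CoN G v) : CoM G v := by
  intro x y z hx hy hz hxy hxz hyz
  by_contra hcon
  push Not at hcon
  have h2 : (Nb G v \ {x, y, z}).card = 2 := by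
    rw [Finset.card_sdiff_of_subset, h5]
    · simp [hxy, hxz, hyz]
    · intro w; simp only [Finset.mem_insert, Finset.mem_singleton, mem_Nb]; grind
  obtain ⟨p, q, hpq, hm⟩ := en2 h2
  have hv := G.loopless.irrefl v
  simp only [Finset.mem_sdiff, mem_Nb, Finset.mem_insert, Finset.mem_singleton, List.mem_cons,
    List.not_mem_nil, or_false] at hm
  refine hR (k5_red G v x y z p q ?_ ?_ hcon.1 hcon.2 hc)
  · simp; grind
  · simp; grind

theorem com6 [Fintype V] [DecidableEq V] {G : SimpleGraph V}
    (hR : ¬ ∃ V₀ : Finset V, ReducibleVertexSet G V₀) {v : V} (h5 : (Nb G v).card = 6)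
    (hc : CoN G v) : CoM G v := by
  have hv := G.loopless.irrefl v
  have hsp : ∀ x y z, G.Adj v x → G.Adj v y → G.Adj v z → x ≠ y → x ≠ z → y ≠ z →
      ∃ p q r, [v, x, y, z, p, q, r].Nodup ∧ ∀ w, G.Adj v w ↔ w ∈ [x, y, z, p, q, r] := by
    intro x y z hx hy hz hxy hxz hyz
    have h2 : (Nb G v \ {x, y, z}).card = 3 := by
      rw [Finset.card_sdiff_of_subset, h5]
      · simp [hxy, hxz, hyz]
      · intro w; simp only [Finset.mem_insert, Finset.mem_singleton, mem_Nb]; grind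
    obtain ⟨p, q, r, hpq, hm⟩ := en3 h2
    simp only [Finset.mem_sdiff, mem_Nb, Finset.mem_insert, Finset.mem_singleton, List.mem_cons,
      List.not_mem_nil, or_false] at hm
    refine ⟨p, q, r, ?_, ?_⟩
    · simp at hpq ⊢; grind
    · simp; grind
  have hind : ∀ x y z, G.Adj v x → G.Adj v y → G.Adj v z → x ≠ y → x ≠ z → y ≠ z →
      G.Adj x y ∨ G.Adj x z ∨ G.Adj y z := by
    intro x y z hx hy hz hxy hxz hyz
    by_contra hcon
    push Not at hcon
    obtain ⟨p, q, r, h1, h2⟩ := hsp x y z hx hy hz hxy hxz hyz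
    exact hR (k61_red G v x y z p q r h1 h2 hcon.1 hcon.2.1 hcon.2.2 hc)
  intro x y z hx hy hz hxy hxz hyz
  by_contra hcon
  push Not at hcon
  have h3 := hind x y z hx hy hz hxy hxz hyz
  obtain ⟨p, q, r, h1, h2⟩ := hsp x y z hx hy hz hxy hxz hyz
  refine hR (k62_red G v x y z p q r h1 h2 ?_ hcon.1 hcon.2 hc ?_)
  · tauto
  · have hall : ∀ w ∈ [x, y, z, p, q, r], G.Adj v w := fun w hw => (h2 w).2 hw
    simp only [List.mem_cons, List.not_mem_nil, or_false, forall_eq_or_imp, forall_eq] at hall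
    obtain ⟨b1, b2, b3, b4, b5, b6⟩ := hall
    simp only [List.nodup_cons, List.mem_cons, List.not_mem_nil, or_false, not_or] at h1
    obtain ⟨_, ⟨_, _, _, _, _⟩, ⟨_, _, _, _⟩, ⟨_, _, _⟩, ⟨_, _⟩, _, _⟩ := h1
    simp only [k62_C, List.forall_mem_cons, clT, List.exists_mem_cons_iff, fL]
    simp only [List.getD_cons_succ, List.getD_cons_zero, if_true, List.not_mem_nil, false_and,
      exists_false, or_false]
    refine ⟨?_, ?_, ?_, ?_, ?_, ?_, ?_, ?_, ?_, ?_, ?_, ?_, ?_, ?_, ?_, ?_, ?_, ?_, ?_, ?_, ?_⟩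
    on_goal 21 => simp
    all_goals apply hind <;> assumption

theorem card_adj [Fintype V] [DecidableEq V] {G : SimpleGraph V} {u v : V} (h : G.Adj u v) :
    (Nb G u).card = 1 + (Nb G u ∩ Nb G v).card + ((Nb G u \ Nb G v).erase v).card := by
  rw [Finset.card_erase_of_mem]
  · have := Finset.card_inter_add_card_sdiff (Nb G u) (Nb G v)
    have h1 : 0 < (Nb G u \ Nb G v).card := Finset.card_pos.2 ⟨v, by simp [mem_Nb, h]⟩
    omega
  · simp [mem_Nb, h]

theorem miss_le [Fintype V] [DecidableEq V] {G : SimpleGraph V} {u v : V} (h : G.Adj u v)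
    (hu : CoM G u) : ((Nb G u \ Nb G v).erase v).card ≤ 1 := by
  rw [Finset.card_le_one]
  intro a ha b hb
  simp only [Finset.mem_erase, Finset.mem_sdiff, mem_Nb] at ha hb
  by_contra hab
  rcases hu v a b h ha.2.1 hb.2.1 ha.1.symm hb.1.symm hab with h' | h'
  · exact ha.2.2 h'
  · exact hb.2.2 h'

theorem asm_adj [Fintype V] [DecidableEq V] {G : SimpleGraph V} {u v : V} (h : G.Adj u v)
    {lC lA lB : List V} (hC : En (Nb G u ∩ Nb G v) lC) (hA : En ((Nb G u \ Nb G v).erase v) lA)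
    (hB : En ((Nb G v \ Nb G u).erase u) lB) :
    (u :: v :: (lC ++ lA ++ lB)).Nodup ∧ (∀ w, G.Adj u w ↔ w ∈ v :: (lC ++ lA)) ∧
      (∀ w, G.Adj v w ↔ w ∈ u :: (lC ++ lB)) := by
  obtain ⟨nC, hC⟩ := hC
  obtain ⟨nA, hA⟩ := hA
  obtain ⟨nB, hB⟩ := hB
  have iu := G.loopless.irrefl u
  have iv := G.loopless.irrefl v
  have hne := h.ne
  have hs := h.symm
  simp only [Finset.mem_erase, Finset.mem_sdiff, Finset.mem_inter, mem_Nb] at hA hB hC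
  refine ⟨?_, ?_, ?_⟩
  · simp only [List.nodup_cons, List.nodup_append', List.mem_cons, List.mem_append, ← hA, ← hB, ← hC,
      List.disjoint_left]
    refine ⟨by tauto, by tauto, ⟨nC, nA, ?_⟩, nB, ?_⟩ <;> intro w <;> tauto
  · intro w
    simp only [List.mem_cons, List.mem_append, ← hA, ← hC]
    by_cases hw : w = v
    · subst hw; simp [h]
    · tauto
  · intro w
    simp only [List.mem_cons, List.mem_append, ← hB, ← hC]
    by_cases hw : w = u
    · subst hw; simp [hs]
    · tauto

theorem asm_non [Fintype V] [DecidableEq V] {G : SimpleGraph V} {u v : V} (h : ¬ G.Adj u v)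
    (hne : u ≠ v)
    {lC lA lB : List V} (hC : En (Nb G u ∩ Nb G v) lC) (hA : En (Nb G u \ Nb G v) lA)
    (hB : En (Nb G v \ Nb G u) lB) :
    (u :: v :: (lC ++ lA ++ lB)).Nodup ∧ (∀ w, G.Adj u w ↔ w ∈ lC ++ lA) ∧
      (∀ w, G.Adj v w ↔ w ∈ lC ++ lB) := by
  obtain ⟨nC, hC⟩ := hC
  obtain ⟨nA, hA⟩ := hA
  obtain ⟨nB, hB⟩ := hB
  have iu := G.loopless.irrefl u
  have iv := G.loopless.irrefl v
  have hs : ¬ G.Adj v u := fun h' => h h'.symm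
  simp only [Finset.mem_sdiff, Finset.mem_inter, mem_Nb] at hA hB hC
  refine ⟨?_, ?_, ?_⟩
  · simp only [List.nodup_cons, List.nodup_append', List.mem_cons, List.mem_append, ← hA, ← hB, ← hC,
      List.disjoint_left]
    refine ⟨by tauto, by tauto, ⟨nC, nA, ?_⟩, nB, ?_⟩ <;> intro w <;> tauto
  · intro w
    simp only [List.mem_append, ← hA, ← hC]
    tauto
  · intro w
    simp only [List.mem_append, ← hB, ← hC]
    tauto

theorem lowlow_aux [Fintype V] [DecidableEq V] {G : SimpleGraph V}
    (hR : ¬ ∃ V₀ : Finset V, ReducibleVertexSet G V₀) {u v : V} (h : G.Adj u v)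
    (hu : CoM G u) (hv : CoM G v) (h5 : 5 ≤ (Nb G u).card) (huv : (Nb G u).card ≤ (Nb G v).card)
    (h6 : (Nb G v).card ≤ 6) : False := by
  have e1 := card_adj h
  have e2 := card_adj h.symm
  have m1 := miss_le h hu
  have m2 := miss_le h.symm hv
  rw [Finset.inter_comm] at e2
  have key : ((Nb G u ∩ Nb G v).card = 4 ∧ ((Nb G u \ Nb G v).erase v).card = 0 ∧
        ((Nb G v \ Nb G u).erase u).card = 0) ∨
      ((Nb G u ∩ Nb G v).card = 3 ∧ ((Nb G u \ Nb G v).erase v).card = 1 ∧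
        ((Nb G v \ Nb G u).erase u).card = 1) ∨
      ((Nb G u ∩ Nb G v).card = 4 ∧ ((Nb G u \ Nb G v).erase v).card = 0 ∧
        ((Nb G v \ Nb G u).erase u).card = 1) ∨
      ((Nb G u ∩ Nb G v).card = 5 ∧ ((Nb G u \ Nb G v).erase v).card = 0 ∧
        ((Nb G v \ Nb G u).erase u).card = 0) ∨
      ((Nb G u ∩ Nb G v).card = 4 ∧ ((Nb G u \ Nb G v).erase v).card = 1 ∧
        ((Nb G v \ Nb G u).erase u).card = 1) := by omega
  rcases key with ⟨hC, hA, hB⟩ | ⟨hC, hA, hB⟩ | ⟨hC, hA, hB⟩ | ⟨hC, hA, hB⟩ | ⟨hC, hA, hB⟩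
  · obtain ⟨c0, c1, c2, c3, hC⟩ := en4 hC
    replace hA := en0 hA
    replace hB := en0 hB
    obtain ⟨h1, h2, h3⟩ := asm_adj h hC hA hB
    exact hR (a55s_red G u v c0 c1 c2 c3 h1 h2 h3 hu hv)
  · obtain ⟨c0, c1, c2, hC⟩ := en3 hC
    obtain ⟨x, hA⟩ := en1 hA
    obtain ⟨y, hB⟩ := en1 hB
    obtain ⟨h1, h2, h3⟩ := asm_adj h hC hA hB
    exact hR (a55d_red G u v c0 c1 c2 x y h1 h2 h3 hu hv)
  · obtain ⟨c0, c1, c2, c3, hC⟩ := en4 hC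
    replace hA := en0 hA
    obtain ⟨y, hB⟩ := en1 hB
    obtain ⟨h1, h2, h3⟩ := asm_adj h hC hA hB
    exact hR (a56_red G u v c0 c1 c2 c3 y h1 h2 h3 hu hv)
  · obtain ⟨c0, c1, c2, c3, c4, hC⟩ := en5 hC
    replace hA := en0 hA
    replace hB := en0 hB
    obtain ⟨h1, h2, h3⟩ := asm_adj h hC hA hB
    exact hR (a66s_red G u v c0 c1 c2 c3 c4 h1 h2 h3 hu hv)
  · obtain ⟨c0, c1, c2, c3, hC⟩ := en4 hC
    obtain ⟨x, hA⟩ := en1 hA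
    obtain ⟨y, hB⟩ := en1 hB
    obtain ⟨h1, h2, h3⟩ := asm_adj h hC hA hB
    exact hR (a66d_red G u v c0 c1 c2 c3 x y h1 h2 h3 hu hv)

structure Ctx [Fintype V] [DecidableEq V] (G : SimpleGraph V) : Prop where
  hR : ¬ ∃ V₀ : Finset V, ReducibleVertexSet G V₀
  ge5 : ∀ v, 5 ≤ (Nb G v).card
  com : ∀ v, (Nb G v).card ≤ 6 → CoM G v
  con : ∀ v, (Nb G v).card ≤ 9 → CoN G v

theorem mkCtx [Fintype V] [DecidableEq V] {G : SimpleGraph V} (hr : Robust G)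
    (hR : ¬ ∃ V₀ : Finset V, ReducibleVertexSet G V₀) : Ctx G := by
  refine ⟨hR, deg_ge hr hR, fun v hv => ?_, conn_of hr⟩
  have h5 := deg_ge hr hR v
  have hc := conn_of hr v (by omega)
  rcases (by omega : (Nb G v).card = 5 ∨ (Nb G v).card = 6) with h | h
  · exact com5 hR h hc
  · exact com6 hR h hc

theorem lowlow [Fintype V] [DecidableEq V] {G : SimpleGraph V} (hX : Ctx G) {u v : V}
    (hu : (Nb G u).card ≤ 6) (hv : (Nb G v).card ≤ 6) : ¬ G.Adj u v := by
  intro h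
  rcases le_total (Nb G u).card (Nb G v).card with hle | hle
  · exact lowlow_aux hX.hR h (hX.com u hu) (hX.com v hv) (hX.ge5 u) hle hv
  · exact lowlow_aux hX.hR h.symm (hX.com v hv) (hX.com u hu) (hX.ge5 v) hle hu

/-- Structure around an edge between a low vertex `v` and a vertex `u` of degree 7. -/
theorem seven [Fintype V] [DecidableEq V] {G : SimpleGraph V} (hX : Ctx G) {u v : V}
    (hv : (Nb G v).card ≤ 6) (hu : (Nb G u).card = 7) (h : G.Adj v u) :
    (Nb G v ∩ Nb G u).card + 2 = (Nb G v).card ∧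
    ((Nb G u \ Nb G v).erase v).card + (Nb G v).card = 8 ∧
    (∀ c ∈ Nb G v ∩ Nb G u, ∀ c' ∈ Nb G v ∩ Nb G u, c ≠ c' → G.Adj c c') ∧
    (∀ c ∈ Nb G v ∩ Nb G u, ∀ b ∈ (Nb G u \ Nb G v).erase v, G.Adj c b) ∧
    ∃ d, En ((Nb G v \ Nb G u).erase u) [d] ∧ ∀ c ∈ Nb G v ∩ Nb G u, G.Adj c d := by
  have e1 := card_adj h
  have e2 := card_adj h.symm
  have hcv := hX.com v hv
  have m1 := miss_le h hcv
  have h5 := hX.ge5 v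
  have hcu := hX.con u (by omega)
  rw [Finset.inter_comm] at e2
  have key : ((Nb G v ∩ Nb G u).card = 4 ∧ ((Nb G v \ Nb G u).erase u).card = 0 ∧
        ((Nb G u \ Nb G v).erase v).card = 2) ∨
      ((Nb G v ∩ Nb G u).card = 5 ∧ ((Nb G v \ Nb G u).erase u).card = 0 ∧
        ((Nb G u \ Nb G v).erase v).card = 1) ∨
      ((Nb G v ∩ Nb G u).card = 3 ∧ ((Nb G v \ Nb G u).erase u).card = 1 ∧
        ((Nb G u \ Nb G v).erase v).card = 3) ∨
      ((Nb G v ∩ Nb G u).card = 4 ∧ ((Nb G v \ Nb G u).erase u).card = 1 ∧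
        ((Nb G u \ Nb G v).erase v).card = 2) := by omega
  have hd : ∀ d, En ((Nb G v \ Nb G u).erase u) [d] → ∀ c ∈ Nb G v ∩ Nb G u, G.Adj c d := by
    intro d hd c hc
    have := (hd.2 d).2 (by simp)
    simp only [Finset.mem_erase, Finset.mem_sdiff, mem_Nb, Finset.mem_inter] at this hc
    rcases hcv d u c this.2.1 h hc.1 this.1 (by rintro rfl; exact this.2.2 hc.2) hc.2.ne with h' | h'
    · exact absurd h'.symm this.2.2
    · exact h'.symm
  rcases key with ⟨hC, hA, hB⟩ | ⟨hC, hA, hB⟩ | ⟨hC, hA, hB⟩ | ⟨hC, hA, hB⟩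
  · exfalso
    obtain ⟨c0, c1, c2, c3, hC⟩ := en4 hC
    obtain ⟨x, y, hB⟩ := en2 hB
    obtain ⟨h1, h2, h3⟩ := asm_adj h hC (en0 hA) hB
    exact hX.hR (b57s_red G v u c0 c1 c2 c3 x y h1 h2 h3 hcv hcu)
  · exfalso
    obtain ⟨c0, c1, c2, c3, c4, hC⟩ := en5 hC
    obtain ⟨x, hB⟩ := en1 hB
    obtain ⟨h1, h2, h3⟩ := asm_adj h hC (en0 hA) hB
    exact hX.hR (b67s_red G v u c0 c1 c2 c3 c4 x h1 h2 h3 hcv hcu)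
  · have hcl : ∀ c ∈ Nb G v ∩ Nb G u, ∀ c' ∈ Nb G v ∩ Nb G u, c ≠ c' → G.Adj c c' := by
      intro c hc c' hc' hne
      by_contra hadj
      have hc'' : c' ∈ (Nb G v ∩ Nb G u).erase c := Finset.mem_erase.2 ⟨hne.symm, hc'⟩
      have q : (((Nb G v ∩ Nb G u).erase c).erase c').card = 1 := by
        rw [Finset.card_erase_of_mem hc'', Finset.card_erase_of_mem hc, hC]
      obtain ⟨c2, hq⟩ := en1 q
      obtain ⟨d, hA⟩ := en1 hA
      obtain ⟨x, y, z, hB⟩ := en3 hB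
      obtain ⟨h1, h2, h3⟩ := asm_adj h ((hq.cons hc'').cons hc) hA hB
      exact hX.hR (b57d1_red G v u c c' c2 d x y z h1 h2 h3 hadj hcv hcu)
    obtain ⟨d, hA⟩ := en1 hA
    refine ⟨by omega, by omega, hcl, ?_, d, hA, hd d hA⟩
    intro c hc b hb
    by_contra hadj
    have q : ((Nb G v ∩ Nb G u).erase c).card = 2 := by rw [Finset.card_erase_of_mem hc, hC]
    obtain ⟨c1, c2, hq⟩ := en2 q
    have q2 : (((Nb G u \ Nb G v).erase v).erase b).card = 2 := by
      rw [Finset.card_erase_of_mem hb, hB]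
    obtain ⟨x, y, hq2⟩ := en2 q2
    have hC' := hq.cons hc
    obtain ⟨h1, h2, h3⟩ := asm_adj h hC' hA (hq2.cons hb)
    have m1 : c1 ∈ Nb G v ∩ Nb G u := (hC'.2 _).2 (by simp)
    have m2 : c2 ∈ Nb G v ∩ Nb G u := (hC'.2 _).2 (by simp)
    have nd := hC'.1
    simp only [List.nodup_cons, List.mem_cons, List.not_mem_nil, or_false, not_or] at nd
    exact hX.hR (b57d2_red G v u c c1 c2 d b x y h1 h2 h3 (hcl _ hc _ m1 nd.1.1) (hcl _ hc _ m2 nd.1.2)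
      (hcl _ m1 _ m2 nd.2.1) hadj hcv hcu)
  · have hcl : ∀ c ∈ Nb G v ∩ Nb G u, ∀ c' ∈ Nb G v ∩ Nb G u, c ≠ c' → G.Adj c c' := by
      intro c hc c' hc' hne
      by_contra hadj
      have hc'' : c' ∈ (Nb G v ∩ Nb G u).erase c := Finset.mem_erase.2 ⟨hne.symm, hc'⟩
      have q : (((Nb G v ∩ Nb G u).erase c).erase c').card = 2 := by
        rw [Finset.card_erase_of_mem hc'', Finset.card_erase_of_mem hc, hC]
      obtain ⟨c2, c3, hq⟩ := en2 q
      obtain ⟨d, hA⟩ := en1 hA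
      obtain ⟨x, y, hB⟩ := en2 hB
      obtain ⟨h1, h2, h3⟩ := asm_adj h ((hq.cons hc'').cons hc) hA hB
      exact hX.hR (b67d1_red G v u c c' c2 c3 d x y h1 h2 h3 hadj hcv hcu)
    obtain ⟨d, hA⟩ := en1 hA
    refine ⟨by omega, by omega, hcl, ?_, d, hA, hd d hA⟩
    intro c hc b hb
    by_contra hadj
    have q : ((Nb G v ∩ Nb G u).erase c).card = 3 := by rw [Finset.card_erase_of_mem hc, hC]
    obtain ⟨c1, c2, c3, hq⟩ := en3 q
    have q2 : (((Nb G u \ Nb G v).erase v).erase b).card = 1 := by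
      rw [Finset.card_erase_of_mem hb, hB]
    obtain ⟨x, hq2⟩ := en1 q2
    have hC' := hq.cons hc
    obtain ⟨h1, h2, h3⟩ := asm_adj h hC' hA (hq2.cons hb)
    have m1 : c1 ∈ Nb G v ∩ Nb G u := (hC'.2 _).2 (by simp)
    have m2 : c2 ∈ Nb G v ∩ Nb G u := (hC'.2 _).2 (by simp)
    have m3 : c3 ∈ Nb G v ∩ Nb G u := (hC'.2 _).2 (by simp)
    have nd := hC'.1
    simp only [List.nodup_cons, List.mem_cons, List.not_mem_nil, or_false, not_or] at nd
    exact hX.hR (b67d2_red G v u c c1 c2 c3 d b x h1 h2 h3 (hcl _ hc _ m1 nd.1.1)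
      (hcl _ hc _ m2 nd.1.2.1) (hcl _ hc _ m3 nd.1.2.2)
      (hcl _ m1 _ m2 nd.2.1.1) (hcl _ m1 _ m3 nd.2.1.2) (hcl _ m2 _ m3 nd.2.2.1) hadj hcv hcu)

/-- Two vertices of degree 5 share at most three neighbours. -/
theorem share5 [Fintype V] [DecidableEq V] {G : SimpleGraph V} (hX : Ctx G) {u v : V} (hne : u ≠ v)
    (hu : (Nb G u).card = 5) (hv : (Nb G v).card = 5) : (Nb G u ∩ Nb G v).card ≤ 3 := by
  by_contra hcon
  have hn := lowlow hX (u := u) (v := v) (by omega) (by omega)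
  have e1 := Finset.card_inter_add_card_sdiff (Nb G u) (Nb G v)
  have e2 := Finset.card_inter_add_card_sdiff (Nb G v) (Nb G u)
  rw [Finset.inter_comm] at e2
  have hcu := hX.com u (by omega)
  have hcv := hX.com v (by omega)
  rcases (by omega : ((Nb G u ∩ Nb G v).card = 5 ∧ (Nb G u \ Nb G v).card = 0 ∧ (Nb G v \ Nb G u).card = 0) ∨
    ((Nb G u ∩ Nb G v).card = 4 ∧ (Nb G u \ Nb G v).card = 1 ∧ (Nb G v \ Nb G u).card = 1)) with
    ⟨hC, hA, hB⟩ | ⟨hC, hA, hB⟩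
  · obtain ⟨c0, c1, c2, c3, c4, hC⟩ := en5 hC
    obtain ⟨h1, h2, h3⟩ := asm_non hn hne hC (en0 hA) (en0 hB)
    exact hX.hR (c55s_red G u v c0 c1 c2 c3 c4 h1 h2 h3 hcu hcv)
  · obtain ⟨c0, c1, c2, c3, hC⟩ := en4 hC
    obtain ⟨x, hA⟩ := en1 hA
    obtain ⟨y, hB⟩ := en1 hB
    obtain ⟨h1, h2, h3⟩ := asm_non hn hne hC hA hB
    exact hX.hR (c55d_red G u v c0 c1 c2 c3 x y h1 h2 h3 hcu hcv)

/-- A vertex of degree 7 has at most one low neighbour. -/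
theorem seven_one [Fintype V] [DecidableEq V] {G : SimpleGraph V} (hX : Ctx G) {u v x : V}
    (hu : (Nb G u).card = 7) (hv : (Nb G v).card ≤ 6) (hx : (Nb G x).card ≤ 6) (hvu : G.Adj v u)
    (hxu : G.Adj x u) : v = x := by
  by_contra hne
  have hn := lowlow hX hv hx
  have hn' := lowlow hX hx hv
  obtain ⟨v1, v2, v3, v4, d, hd, -⟩ := seven hX hv hu hvu
  obtain ⟨x1, x2, x3, x4, -⟩ := seven hX hx hu hxu
  have hxB : x ∈ (Nb G u \ Nb G v).erase v := by
    simp [mem_Nb, hn, hxu.symm, Ne.symm hne]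
  have hvB : v ∈ (Nb G u \ Nb G x).erase x := by
    simp [mem_Nb, hn', hvu.symm, hne]
  have hsub : Nb G v ∩ Nb G u ⊆ Nb G x ∩ Nb G u := by
    intro c hc
    exact Finset.mem_inter.2 ⟨mem_Nb.2 (v4 c hc x hxB).symm, (Finset.mem_inter.1 hc).2⟩
  have hsub' : Nb G x ∩ Nb G u ⊆ Nb G v ∩ Nb G u := by
    intro c hc
    exact Finset.mem_inter.2 ⟨mem_Nb.2 (x4 c hc v hvB).symm, (Finset.mem_inter.1 hc).2⟩
  have heq := Finset.Subset.antisymm hsub hsub'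
  have hceq := congrArg Finset.card heq
  have huC : u ∉ Nb G v ∩ Nb G u := by simp [mem_Nb]
  have hsh : (insert u (Nb G v ∩ Nb G u)) ⊆ Nb G v ∩ Nb G x := by
    intro w hw
    rcases Finset.mem_insert.1 hw with rfl | hw
    · simp [mem_Nb, hvu, hxu]
    · exact Finset.mem_inter.2 ⟨(Finset.mem_inter.1 hw).1, (Finset.mem_inter.1 (hsub hw)).1⟩
  have hshc := Finset.card_le_card hsh
  rw [Finset.card_insert_of_notMem huC] at hshc
  have h5 := hX.ge5 v
  rcases (by omega : (Nb G v).card = 5 ∨ (Nb G v).card = 6) with h | h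
  · have := share5 hX hne h (by omega)
    omega
  · have e1 := Finset.card_inter_add_card_sdiff (Nb G v) (Nb G x)
    have e2 := Finset.card_inter_add_card_sdiff (Nb G x) (Nb G v)
    rw [Finset.inter_comm] at e2
    have hcv := hX.com v hv
    have hcx := hX.com x hx
    rcases (by omega : ((Nb G v ∩ Nb G x).card = 5 ∧ (Nb G v \ Nb G x).card = 1 ∧ (Nb G x \ Nb G v).card = 1) ∨
      (Nb G v \ Nb G x).card = 0 ∧ (Nb G x \ Nb G v).card = 0) with ⟨hC, hA, hB⟩ | ⟨hA, hB⟩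
    · obtain ⟨c0, c1, c2, c3, c4, hC⟩ := en5 hC
      obtain ⟨x', hA⟩ := en1 hA
      obtain ⟨y', hB⟩ := en1 hB
      obtain ⟨h1, h2, h3⟩ := asm_non hn hne hC hA hB
      exact hX.hR (c66d_red G v x c0 c1 c2 c3 c4 x' y' h1 h2 h3 hcv hcx)
    · have hNeq : ∀ w, G.Adj x w ↔ G.Adj v w := by
        intro w
        rw [Finset.card_eq_zero, Finset.sdiff_eq_empty_iff_subset] at hA hB
        rw [← mem_Nb, ← mem_Nb]
        exact ⟨fun h => hB h, fun h => hA h⟩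
      have hC4 : (Nb G v ∩ Nb G u).card = 4 := by omega
      have hB2 : (((Nb G u \ Nb G v).erase v).erase x).card = 1 := by
        rw [Finset.card_erase_of_mem hxB]; omega
      obtain ⟨c0, c1, c2, c3, hC⟩ := en4 hC4
      obtain ⟨y, hB2⟩ := en1 hB2
      obtain ⟨h1, h2, h3⟩ := asm_adj hvu hC hd (hB2.cons hxB)
      have m0 : c0 ∈ Nb G v ∩ Nb G u := (hC.2 _).2 (by simp)
      have m1 : c1 ∈ Nb G v ∩ Nb G u := (hC.2 _).2 (by simp)
      have m2 : c2 ∈ Nb G v ∩ Nb G u := (hC.2 _).2 (by simp)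
      have m3 : c3 ∈ Nb G v ∩ Nb G u := (hC.2 _).2 (by simp)
      have nd := hC.1
      simp only [List.nodup_cons, List.mem_cons, List.not_mem_nil, or_false, not_or] at nd
      refine hX.hR (d66_red G v u c0 c1 c2 c3 x y d ?_ h2 h3 (fun w => (hNeq w).trans (h2 w))
        (v3 _ m0 _ m1 nd.1.1) (v3 _ m0 _ m2 nd.1.2.1) (v3 _ m0 _ m3 nd.1.2.2)
        (v3 _ m1 _ m2 nd.2.1.1) (v3 _ m1 _ m3 nd.2.1.2) (v3 _ m2 _ m3 nd.2.2.1) hcv hcx)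
      refine (List.Perm.nodup_iff ?_).1 h1
      refine .cons _ (.cons _ (.cons _ (.cons _ (.cons _ (.cons _ ?_)))))
      exact (List.perm_append_comm (l₁ := [d]) (l₂ := [x, y]))

/-- Neighbours of a bad low vertex have many non-low neighbours. -/
theorem bad_nonlow [Fintype V] [DecidableEq V] {G : SimpleGraph V} (hX : Ctx G) {u v a : V}
    (hu : (Nb G u).card = 7) (hv : (Nb G v).card ≤ 6) (hvu : G.Adj v u) (hva : G.Adj v a)
    (hua : G.Adj u a) : 7 ≤ ((Nb G a).filter (fun w => 7 ≤ (Nb G w).card)).card := by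
  obtain ⟨v1, v2, v3, v4, d, hd, hd2⟩ := seven hX hv hu hvu
  have ha : a ∈ Nb G v ∩ Nb G u := by simp [mem_Nb, hva, hua]
  have hdm := (hd.2 d).2 (by simp)
  simp only [Finset.mem_erase, Finset.mem_sdiff, mem_Nb] at hdm
  have hnl : ∀ w, G.Adj v w → 7 ≤ (Nb G w).card := by
    intro w hw
    by_contra hcon
    exact lowlow hX hv (by omega) hw
  have hsub : insert u (insert d ((Nb G v ∩ Nb G u).erase a ∪ (Nb G u \ Nb G v).erase v)) ⊆
      (Nb G a).filter (fun w => 7 ≤ (Nb G w).card) := by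
    intro w hw
    simp only [Finset.mem_insert, Finset.mem_union] at hw
    rw [Finset.mem_filter, mem_Nb]
    rcases hw with rfl | rfl | hw | hw
    · exact ⟨hua.symm, by omega⟩
    · exact ⟨hd2 a ha, hnl _ hdm.2.1⟩
    · rw [Finset.mem_erase] at hw
      exact ⟨v3 a ha w hw.2 (Ne.symm hw.1), hnl _ (mem_Nb.1 (Finset.mem_inter.1 hw.2).1)⟩
    · refine ⟨v4 a ha w hw, ?_⟩
      simp only [Finset.mem_erase, Finset.mem_sdiff, mem_Nb] at hw
      by_contra hcon
      exact hw.1 (seven_one hX hu hv (by omega) hvu hw.2.1.symm).symm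
  have hle := Finset.card_le_card hsub
  rw [Finset.card_insert_of_notMem, Finset.card_insert_of_notMem, Finset.card_union_of_disjoint,
    Finset.card_erase_of_mem ha] at hle
  · have := hX.ge5 v; omega
  · rw [Finset.disjoint_left]
    intro w; simp only [Finset.mem_erase, Finset.mem_inter, Finset.mem_sdiff]; tauto
  · simp only [Finset.mem_erase, Finset.mem_inter, Finset.mem_sdiff, Finset.mem_union, mem_Nb]; tauto
  · have := G.loopless.irrefl u
    have hne : u ≠ d := fun h => hdm.1 h.symm
    simp only [Finset.mem_erase, Finset.mem_inter, Finset.mem_sdiff, Finset.mem_union, mem_Nb,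
      Finset.mem_insert]
    tauto

/-- Neighbours of degree at least 7. -/
noncomputable def Wd [Fintype V] (G : SimpleGraph V) (a : V) : Finset V :=
  (Nb G a).filter (fun w => 7 ≤ (Nb G w).card)

theorem mem_Wd [Fintype V] {G : SimpleGraph V} {a w : V} :
    w ∈ Wd G a ↔ G.Adj a w ∧ 7 ≤ (Nb G w).card := by simp [Wd, mem_Nb]

theorem low_W [Fintype V] [DecidableEq V] {G : SimpleGraph V} (hX : Ctx G) {v a : V}
    (hv : (Nb G v).card ≤ 6) (h : G.Adj v a) :
    (Nb G v).card ≤ (Wd G a ∩ Nb G v).card + 2 ∧ (Wd G a ∩ Nb G v).card + 1 ≤ (Nb G v).card := by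
  have e : Wd G a ∩ Nb G v = Nb G v ∩ Nb G a := by
    ext w
    simp only [Finset.mem_inter, mem_Wd, mem_Nb]
    constructor
    · tauto
    · intro hw
      refine ⟨⟨hw.2, ?_⟩, hw.1⟩
      by_contra hcon
      exact lowlow hX hv (by omega) hw.1
  have e1 := card_adj h
  have m1 := miss_le h (hX.com v hv)
  rw [e]
  omega

theorem share_W [Fintype V] [DecidableEq V] {G : SimpleGraph V} (hX : Ctx G) {v x a : V}
    (hv : (Nb G v).card = 5) (hx : (Nb G x).card = 5) (hne : v ≠ x) (h : G.Adj v a) (h' : G.Adj x a) :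
    ((Wd G a ∩ Nb G v) ∩ (Wd G a ∩ Nb G x)).card ≤ 2 := by
  have hs := share5 hX hne hv hx
  have hsub : insert a ((Wd G a ∩ Nb G v) ∩ (Wd G a ∩ Nb G x)) ⊆ Nb G v ∩ Nb G x := by
    intro w hw
    simp only [Finset.mem_insert, Finset.mem_inter, mem_Nb] at hw ⊢
    rcases hw with rfl | hw
    · exact ⟨h, h'⟩
    · tauto
  have := Finset.card_le_card hsub
  rw [Finset.card_insert_of_notMem (by simp [mem_Wd])] at this
  omega

theorem asm8 [Fintype V] [DecidableEq V] {G : SimpleGraph V} {a : V} {K : Finset V}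
    (hK : ∀ w, w ∈ K ↔ G.Adj a w ∧ (Nb G w).card ≤ 6)
    {lk lw : List V} (h1 : En K lk) (h2 : En (Wd G a) lw) :
    (a :: (lk ++ lw)).Nodup ∧ ∀ w, G.Adj a w ↔ w ∈ lk ++ lw := by
  have h3 : En (Nb G a) (lk ++ lw) := by
    refine h1.append h2 ?_ ?_
    · intro w h h'
      rw [hK] at h; rw [mem_Wd] at h'; omega
    · intro w
      rw [hK, mem_Wd, mem_Nb]
      have := le_or_gt (Nb G w).card 6
      constructor
      · intro h; rcases this with h' | h'
        · exact Or.inl ⟨h, h'⟩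
        · exact Or.inr ⟨h, h'⟩
      · tauto
  refine ⟨List.nodup_cons.2 ⟨fun h => ?_, h3.1⟩, fun w => by rw [← h3.2, mem_Nb]⟩
  rw [← h3.2, mem_Nb] at h
  exact G.loopless.irrefl a h

theorem two_of [DecidableEq V] {W A : Finset V} (h : W.card ≤ (W ∩ A).card + 1) {p q : V} (hp : p ∈ W)
    (hq : q ∈ W) (hpq : p ≠ q) : p ∈ A ∨ q ∈ A := by
  by_contra hcon
  push Not at hcon
  have e := Finset.card_inter_add_card_sdiff W A
  have : ({p, q} : Finset V).card ≤ (W \ A).card := Finset.card_le_card (by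
    intro w; simp only [Finset.mem_insert, Finset.mem_singleton, Finset.mem_sdiff]
    rintro (rfl | rfl)
    · exact ⟨hp, hcon.1⟩
    · exact ⟨hq, hcon.2⟩)
  rw [Finset.card_pair hpq] at this
  omega

theorem three_of [DecidableEq V] {W A : Finset V} (h : W.card ≤ (W ∩ A).card + 2) {p q r : V} (hp : p ∈ W)
    (hq : q ∈ W) (hr : r ∈ W) (hpq : p ≠ q) (hpr : p ≠ r) (hqr : q ≠ r) : p ∈ A ∨ q ∈ A ∨ r ∈ A := by
  by_contra hcon
  push Not at hcon
  have e := Finset.card_inter_add_card_sdiff W A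
  have : ({p, q, r} : Finset V).card ≤ (W \ A).card := Finset.card_le_card (by
    intro w; simp only [Finset.mem_insert, Finset.mem_singleton, Finset.mem_sdiff]
    rintro (rfl | rfl | rfl)
    · exact ⟨hp, hcon.1⟩
    · exact ⟨hq, hcon.2.1⟩
    · exact ⟨hr, hcon.2.2⟩)
  rw [Finset.card_eq_three.2 ⟨p, q, r, hpq, hpr, hqr, rfl⟩] at this
  omega

theorem case_e6 [Fintype V] [DecidableEq V] {G : SimpleGraph V} (hX : Ctx G) {a : V} {K : Finset V}
    (hK : ∀ w, w ∈ K ↔ G.Adj a w ∧ (Nb G w).card ≤ 6) (hKc : K.card = 4) (hW : (Wd G a).card = 4)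
    {v : V} (hv : v ∈ K) (hv6 : (Nb G v).card = 6) : False := by
  have q : (K.erase v).card = 3 := by rw [Finset.card_erase_of_mem hv, hKc]
  obtain ⟨v2, v3, v4, hq⟩ := en3 q
  obtain ⟨p, q, r, s, hW'⟩ := en4 hW
  have hK' := hq.cons hv
  obtain ⟨h1, h2⟩ := asm8 hK hK' hW'
  have hm : ∀ w ∈ [v, v2, v3, v4], G.Adj a w ∧ (Nb G w).card ≤ 6 := fun w hw =>
    (hK w).1 ((hK'.2 w).2 hw)
  have hmW : ∀ w ∈ [p, q, r, s], w ∈ Wd G a := fun w hw => (hW'.2 w).2 hw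
  have hnn : ∀ w ∈ [v, v2, v3, v4], ∀ w' ∈ [v, v2, v3, v4], ¬ G.Adj w w' := fun w hw w' hw' =>
    lowlow hX (hm w hw).2 (hm w' hw').2
  have hcl : ∀ w ∈ [v, v2, v3, v4], ∀ y ∈ [p, q, r, s], ∀ z ∈ [p, q, r, s], y ≠ z →
      G.Adj w y ∨ G.Adj w z := by
    intro w hw y hy z hz hyz
    have h3 := low_W hX (hm w hw).2 (hm w hw).1.symm
    have h5 := hX.ge5 w
    simpa only [mem_Nb] using two_of (A := Nb G w) (by omega) (hmW y hy) (hmW z hz) hyz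
  have hall : ∀ y ∈ [p, q, r, s], G.Adj v y := by
    intro y hy
    have h3 := low_W hX (hm v (by simp)).2 (hm v (by simp)).1.symm
    have : Wd G a ∩ Nb G v = Wd G a := Finset.eq_of_subset_of_card_le Finset.inter_subset_left (by omega)
    have := (Finset.ext_iff.1 this y).2 (hmW y hy)
    exact mem_Nb.1 (Finset.mem_inter.1 this).2
  have nd := hW'.1
  simp only [List.nodup_cons, List.mem_cons, List.not_mem_nil, or_false, not_or] at nd
  obtain ⟨⟨_, _, _⟩, ⟨_, _⟩, _, _⟩ := nd
  refine hX.hR (e6_red G a v v2 v3 v4 p q r s h1 h2 (hall _ (by simp)) (hall _ (by simp))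
    (hall _ (by simp)) (hall _ (by simp))
    (hnn _ (by simp) _ (by simp)) (hnn _ (by simp) _ (by simp)) (hnn _ (by simp) _ (by simp))
    (hnn _ (by simp) _ (by simp)) (hnn _ (by simp) _ (by simp)) (hnn _ (by simp) _ (by simp)) ?_)
  simp only [List.forall_mem_cons, List.not_mem_nil, false_imp_iff, implies_true, and_true] at hcl
  simp only [e6_C, List.forall_mem_cons, clT, List.exists_mem_cons_iff, fL]
  simp only [List.getD_cons_succ, List.getD_cons_zero, if_true, List.not_mem_nil, false_and,
      exists_false, or_false]
  simp_all only [ne_eq, not_false_eq_true, true_imp_iff, implies_true, and_true, true_and, not_true_eq_false, false_imp_iff]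

theorem case_e5 [Fintype V] [DecidableEq V] {G : SimpleGraph V} (hX : Ctx G) {a : V} {K : Finset V}
    (hK : ∀ w, w ∈ K ↔ G.Adj a w ∧ (Nb G w).card ≤ 6) (hKc : K.card = 4) (hW : (Wd G a).card = 4)
    (h5 : ∀ v ∈ K, (Nb G v).card = 5) : False := by
  obtain ⟨v1, v2, v3, v4, hK'⟩ := en4 hKc
  have hm : ∀ w ∈ [v1, v2, v3, v4], G.Adj a w ∧ (Nb G w).card ≤ 6 := fun w hw =>
    (hK w).1 ((hK'.2 w).2 hw)
  have hm5 : ∀ w ∈ [v1, v2, v3, v4], (Nb G w).card = 5 := fun w hw => h5 w ((hK'.2 w).2 hw)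
  have hnn : ∀ w ∈ [v1, v2, v3, v4], ∀ w' ∈ [v1, v2, v3, v4], ¬ G.Adj w w' := fun w hw w' hw' =>
    lowlow hX (hm w hw).2 (hm w' hw').2
  have ndK := hK'.1
  simp only [List.nodup_cons, List.mem_cons, List.not_mem_nil, or_false, not_or] at ndK
  have sh := share_W hX (hm5 v1 (by simp)) (hm5 v2 (by simp)) ndK.1.1 (hm v1 (by simp)).1.symm
    (hm v2 (by simp)).1.symm
  have l1 := low_W hX (hm v1 (by simp)).2 (hm v1 (by simp)).1.symm
  have l2 := low_W hX (hm v2 (by simp)).2 (hm v2 (by simp)).1.symm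
  rw [hm5 v1 (by simp)] at l1
  rw [hm5 v2 (by simp)] at l2
  set W := Wd G a with hWdef
  set A := W ∩ Nb G v1 with hA
  set B := W ∩ Nb G v2 with hB
  have hu : (A ∪ B).card ≤ W.card := Finset.card_le_card (by
    intro w; simp only [hA, hB, Finset.mem_union, Finset.mem_inter]; tauto)
  have e1 := Finset.card_union_add_card_inter A B
  have e2 := Finset.card_inter_add_card_sdiff A B
  have e3 := Finset.card_inter_add_card_sdiff B A
  rw [Finset.inter_comm B A] at e3
  obtain ⟨p, q, hI⟩ := en2 (s := A ∩ B) (by omega)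
  obtain ⟨r, hr⟩ := en1 (s := A \ B) (by omega)
  obtain ⟨s, hs⟩ := en1 (s := B \ A) (by omega)
  have hAB : A ∪ B = W := Finset.eq_of_subset_of_card_le (by
    intro w; simp only [hA, hB, Finset.mem_union, Finset.mem_inter]; tauto) (by omega)
  have hWe : En W [p, q, r, s] := by
    refine (hI.append hr (r := A) ?_ ?_).append hs ?_ ?_
    · intro w; simp only [Finset.mem_inter, Finset.mem_sdiff]; tauto
    · intro w; simp only [Finset.mem_inter, Finset.mem_sdiff]; tauto
    · intro w; simp only [Finset.mem_sdiff]; tauto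
    · intro w; rw [← hAB]; simp only [Finset.mem_union, Finset.mem_sdiff]; tauto
  obtain ⟨h1, h2⟩ := asm8 hK hK' hWe
  have hmW : ∀ w ∈ [p, q, r, s], w ∈ W := fun w hw => (hWe.2 w).2 hw
  have hcl : ∀ w ∈ [v1, v2, v3, v4], ∀ y ∈ [p, q, r, s], ∀ z ∈ [p, q, r, s], y ≠ z →
      G.Adj w y ∨ G.Adj w z := by
    intro w hw y hy z hz hyz
    have h3 := low_W hX (hm w hw).2 (hm w hw).1.symm
    rw [← hWdef] at h3
    have h5 := hX.ge5 w
    simpa only [mem_Nb] using two_of (A := Nb G w) (by omega) (hmW y hy) (hmW z hz) hyz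
  have nd := hWe.1
  simp only [List.nodup_cons, List.mem_cons, List.not_mem_nil, or_false, not_or] at nd
  obtain ⟨⟨_, _, _⟩, ⟨_, _⟩, _, _⟩ := nd
  have ip := (hI.2 p).2 (by simp)
  have iq := (hI.2 q).2 (by simp)
  have ir := (hr.2 r).2 (by simp)
  have is := (hs.2 s).2 (by simp)
  simp only [hA, hB, Finset.mem_inter, Finset.mem_sdiff, mem_Nb, not_and] at ip iq ir is
  refine hX.hR (e51_red G a v1 v2 v3 v4 p q r s h1 h2 ip.1.2 iq.1.2 ir.1.2 ip.2.2 iq.2.2 is.1.2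
    (hnn _ (by simp) _ (by simp)) (hnn _ (by simp) _ (by simp)) (hnn _ (by simp) _ (by simp))
    (hnn _ (by simp) _ (by simp)) (hnn _ (by simp) _ (by simp)) (hnn _ (by simp) _ (by simp))
    (is.2 is.1.1) (ir.2 ir.1.1) ?_)
  have hcl3 := hcl v3 (by simp)
  have hcl4 := hcl v4 (by simp)
  simp only [List.forall_mem_cons, List.not_mem_nil, false_imp_iff, implies_true, and_true] at hcl3 hcl4
  simp only [e51_C, List.forall_mem_cons, clT, List.exists_mem_cons_iff, fL]
  simp only [List.getD_cons_succ, List.getD_cons_zero, if_true, List.not_mem_nil, false_and,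
      exists_false, or_false]
  simp_all only [ne_eq, not_false_eq_true, true_imp_iff, implies_true, and_true, true_and, not_true_eq_false, false_imp_iff]

theorem fcl_ok [Fintype V] [DecidableEq V] {G : SimpleGraph V} (hX : Ctx G) {a v1 v2 v3 p q r s t : V}
    (hW : En (Wd G a) [p, q, r, s, t]) (h1 : (Nb G v1).card = 5) (h2 : (Nb G v2).card = 5)
    (h3 : (Nb G v3).card = 5) (a1 : G.Adj v1 a) (a2 : G.Adj v2 a) (a3 : G.Adj v3 a)
    (n13 : v1 ≠ v3) (n23 : v2 ≠ v3) :
    ∀ c ∈ fcl, clT G (fL [a, v1, v2, v3, p, q, r, s, t] a) c := by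
  have hmW : ∀ w ∈ [p, q, r, s, t], w ∈ Wd G a := fun w hw => (hW.2 w).2 hw
  have hc : (Wd G a).card = 5 := by
    have : Wd G a = [p, q, r, s, t].toFinset := by ext w; rw [hW.2, List.mem_toFinset]
    rw [this, List.toFinset_card_of_nodup hW.1]; rfl
  have hth : ∀ x ∈ [p, q, r, s, t], ∀ y ∈ [p, q, r, s, t], ∀ z ∈ [p, q, r, s, t],
      x ≠ y → x ≠ z → y ≠ z → G.Adj v3 x ∨ G.Adj v3 y ∨ G.Adj v3 z := by
    intro x hx y hy z hz hxy hxz hyz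
    have l := low_W hX (by omega) a3
    simpa only [mem_Nb] using three_of (A := Nb G v3) (by omega) (hmW x hx) (hmW y hy) (hmW z hz) hxy hxz hyz
  have hsh : ∀ v, (Nb G v).card = 5 → G.Adj v a → v ≠ v3 →
      ∀ x ∈ [p, q, r, s, t], ∀ y ∈ [p, q, r, s, t], ∀ z ∈ [p, q, r, s, t],
      x ≠ y → x ≠ z → y ≠ z → ¬ G.Adj v x ∨ ¬ G.Adj v3 x ∨ ¬ G.Adj v y ∨ ¬ G.Adj v3 y ∨
        ¬ G.Adj v z ∨ ¬ G.Adj v3 z := by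
    intro v hv hva hne x hx y hy z hz hxy hxz hyz
    by_contra hcon
    push Not at hcon
    have sh := share_W hX hv h3 hne hva a3
    have : ({x, y, z} : Finset V).card ≤ ((Wd G a ∩ Nb G v) ∩ (Wd G a ∩ Nb G v3)).card :=
      Finset.card_le_card (by
        intro w
        simp only [Finset.mem_insert, Finset.mem_singleton, Finset.mem_inter, mem_Nb]
        rintro (rfl | rfl | rfl)
        · have := hmW _ hx; tauto
        · have := hmW _ hy; tauto
        · have := hmW _ hz; tauto)
    rw [Finset.card_eq_three.2 ⟨x, y, z, hxy, hxz, hyz, rfl⟩] at this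
    omega
  have nd := hW.1
  simp only [List.nodup_cons, List.mem_cons, List.not_mem_nil, or_false, not_or] at nd
  obtain ⟨⟨_, _, _, _⟩, ⟨_, _, _⟩, ⟨_, _⟩, _, _⟩ := nd
  simp only [fcl, tri3, List.map_cons, List.map_nil, List.flatMap_cons, List.flatMap_nil,
    List.forall_mem_append, List.append_nil, List.forall_mem_cons, clT, List.exists_mem_cons_iff, fL]
  simp only [List.getD_cons_succ, List.getD_cons_zero, if_true, List.not_mem_nil, false_and,
    exists_false, or_false, Bool.false_eq_true, if_false]
  have g1 := hsh v1 h1 a1 n13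
  have g2 := hsh v2 h2 a2 n23
  refine ⟨⟨?_, ?_, ?_, ?_, ?_, ?_, ?_, ?_, ?_, ?_, by simp⟩, ⟨?_, ?_, ?_, ?_, ?_, ?_, ?_, ?_, ?_, ?_, by simp⟩,
    ⟨?_, ?_, ?_, ?_, ?_, ?_, ?_, ?_, ?_, ?_, by simp⟩⟩
  all_goals first | apply hth | apply g1 | apply g2
  all_goals first | assumption | simp

theorem fcl3_ok [Fintype V] [DecidableEq V] {G : SimpleGraph V} {a v1 v2 v3 p q r s t : V}
    (hW : En (Wd G a) [p, q, r, s, t]) (h3 : (Wd G a ∩ Nb G v3).card ≤ 3) :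
    ∀ c ∈ fcl3, clT G (fL [a, v1, v2, v3, p, q, r, s, t] a) c := by
  have hmW : ∀ w ∈ [p, q, r, s, t], w ∈ Wd G a := fun w hw => (hW.2 w).2 hw
  have hsh : ∀ x y z u, [x, y, z, u].Sublist [p, q, r, s, t] →
      ¬ G.Adj v3 x ∨ ¬ G.Adj v3 y ∨ ¬ G.Adj v3 z ∨ ¬ G.Adj v3 u := by
    intro x y z u hsub
    by_contra hcon
    push Not at hcon
    have hnd := hsub.nodup hW.1
    have : ([x, y, z, u].toFinset).card ≤ (Wd G a ∩ Nb G v3).card :=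
      Finset.card_le_card (by
        intro w hw
        rw [List.mem_toFinset] at hw
        refine Finset.mem_inter.2 ⟨hmW _ (hsub.subset hw), mem_Nb.2 ?_⟩
        simp only [List.mem_cons, List.not_mem_nil, or_false] at hw
        rcases hw with rfl | rfl | rfl | rfl <;> tauto)
    rw [List.toFinset_card_of_nodup hnd] at this
    simp only [List.length_cons, List.length_nil] at this
    omega
  simp only [fcl3, List.map_cons, List.map_nil, List.forall_mem_cons, clT, List.exists_mem_cons_iff, fL]
  simp only [List.getD_cons_succ, List.getD_cons_zero, if_true, List.not_mem_nil, false_and,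
    exists_false, or_false, Bool.false_eq_true, if_false]
  refine ⟨?_, ?_, ?_, ?_, ?_, by simp⟩
  all_goals apply hsh
  · exact .cons _ (List.Sublist.refl _)
  · exact .cons_cons _ (.cons _ (List.Sublist.refl _))
  · exact .cons_cons _ (.cons_cons _ (.cons _ (List.Sublist.refl _)))
  · exact .cons_cons _ (.cons_cons _ (.cons_cons _ (.cons _ (List.Sublist.refl _))))
  · exact .cons_cons _ (.cons_cons _ (.cons_cons _ (.cons_cons _ (.cons _ (List.Sublist.refl _)))))

theorem case_f4 [Fintype V] [DecidableEq V] {G : SimpleGraph V} (hX : Ctx G) {a : V} {K : Finset V}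
    (hK : ∀ w, w ∈ K ↔ G.Adj a w ∧ (Nb G w).card ≤ 6) (hKc : K.card = 3) (hW : (Wd G a).card = 5)
    (h5 : ∀ v ∈ K, (Nb G v).card = 5) {v1 : V} (hv1 : v1 ∈ K) (h4 : (Wd G a ∩ Nb G v1).card = 4) :
    False := by
  have qq : (K.erase v1).card = 2 := by rw [Finset.card_erase_of_mem hv1, hKc]
  obtain ⟨v2, v3, hq⟩ := en2 qq
  have hK' := hq.cons hv1
  have hm : ∀ w ∈ [v1, v2, v3], G.Adj a w ∧ (Nb G w).card ≤ 6 := fun w hw =>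
    (hK w).1 ((hK'.2 w).2 hw)
  have hm5 : ∀ w ∈ [v1, v2, v3], (Nb G w).card = 5 := fun w hw => h5 w ((hK'.2 w).2 hw)
  have hnn : ∀ w ∈ [v1, v2, v3], ∀ w' ∈ [v1, v2, v3], ¬ G.Adj w w' := fun w hw w' hw' =>
    lowlow hX (hm w hw).2 (hm w' hw').2
  have ndK := hK'.1
  simp only [List.nodup_cons, List.mem_cons, List.not_mem_nil, or_false, not_or] at ndK
  have sh := share_W hX (hm5 v1 (by simp)) (hm5 v2 (by simp)) ndK.1.1 (hm v1 (by simp)).1.symm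
    (hm v2 (by simp)).1.symm
  have l2 := low_W hX (hm v2 (by simp)).2 (hm v2 (by simp)).1.symm
  rw [hm5 v2 (by simp)] at l2
  have hv1N : ∀ w, G.Adj v1 w ↔ w = a ∨ w ∈ Wd G a ∩ Nb G v1 := by
    have hva := (hm v1 (by simp)).1.symm
    have : insert a (Wd G a ∩ Nb G v1) = Nb G v1 := by
      refine Finset.eq_of_subset_of_card_le ?_ ?_
      · intro w hw
        rcases Finset.mem_insert.1 hw with rfl | hw
        · exact mem_Nb.2 hva
        · exact (Finset.mem_inter.1 hw).2
      · rw [Finset.card_insert_of_notMem (by simp [mem_Wd]), h4, hm5 v1 (by simp)]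
    intro w
    have h := Finset.ext_iff.1 this w
    rw [Finset.mem_insert, mem_Nb] at h
    exact h.symm
  set W := Wd G a with hWdef
  set A := W ∩ Nb G v1 with hA
  set B := W ∩ Nb G v2 with hB
  have hu : (A ∪ B).card ≤ W.card := Finset.card_le_card (by
    intro w; simp only [hA, hB, Finset.mem_union, Finset.mem_inter]; tauto)
  have e1 := Finset.card_union_add_card_inter A B
  have e2 := Finset.card_inter_add_card_sdiff A B
  have e3 := Finset.card_inter_add_card_sdiff B A
  rw [Finset.inter_comm B A] at e3
  obtain ⟨p, q, hI⟩ := en2 (s := A ∩ B) (by omega)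
  obtain ⟨r, s, hr⟩ := en2 (s := A \ B) (by omega)
  obtain ⟨t, ht⟩ := en1 (s := B \ A) (by omega)
  have hAB : A ∪ B = W := Finset.eq_of_subset_of_card_le (by
    intro w; simp only [hA, hB, Finset.mem_union, Finset.mem_inter]; tauto) (by omega)
  have hAe : En A [p, q, r, s] := by
    refine hI.append hr ?_ ?_
    · intro w; simp only [Finset.mem_inter, Finset.mem_sdiff]; tauto
    · intro w; simp only [Finset.mem_inter, Finset.mem_sdiff]; tauto
  have hWe : En W [p, q, r, s, t] := by
    refine hAe.append ht ?_ ?_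
    · intro w; simp only [Finset.mem_sdiff]; tauto
    · intro w; rw [← hAB]; simp only [Finset.mem_union, Finset.mem_sdiff]; tauto
  obtain ⟨h1, h2⟩ := asm8 hK hK' hWe
  have ip := (hI.2 p).2 (by simp)
  have iq := (hI.2 q).2 (by simp)
  have ir := (hr.2 r).2 (by simp)
  have is := (hr.2 s).2 (by simp)
  have it := (ht.2 t).2 (by simp)
  simp only [hA, hB, Finset.mem_inter, Finset.mem_sdiff, mem_Nb, not_and] at ip iq ir is it
  have hcom : ∀ w ∈ [v1, v2, v3], CoM G w := fun w hw => hX.com w (hm w hw).2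
  have hNa : (Nb G a).card ≤ 9 := by
    have : Nb G a ⊆ [v1, v2, v3, p, q, r, s, t].toFinset := by
      intro w hw
      rw [List.mem_toFinset]
      exact (h2 w).1 (mem_Nb.1 hw)
    refine (Finset.card_le_card this).trans ((List.toFinset_card_le _).trans ?_)
    simp
  refine hX.hR (f41_red G a v1 v2 v3 p q r s t h1 h2 ?_ ip.1.2 iq.1.2 ir.1.2 is.1.2
    ip.2.2 iq.2.2 it.1.2
    (hnn _ (by simp) _ (by simp)) (hnn _ (by simp) _ (by simp)) (hnn _ (by simp) _ (by simp))
    (it.2 it.1.1) (ir.2 ir.1.1) (is.2 is.1.1) (hcom _ (by simp)) (hcom _ (by simp)) (hcom _ (by simp))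
    (hX.con a hNa) ?_)
  · intro w
    rw [hv1N, hAe.2]
    simp only [List.mem_cons]
  · exact fcl_ok hX hWe (hm5 _ (by simp)) (hm5 _ (by simp)) (hm5 _ (by simp)) (hm _ (by simp)).1.symm
      (hm _ (by simp)).1.symm (hm _ (by simp)).1.symm ndK.1.2 ndK.2.1

theorem case_f3 [Fintype V] [DecidableEq V] {G : SimpleGraph V} (hX : Ctx G) {a : V} {K : Finset V}
    (hK : ∀ w, w ∈ K ↔ G.Adj a w ∧ (Nb G w).card ≤ 6) (hKc : K.card = 3) (hW : (Wd G a).card = 5)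
    (h5 : ∀ v ∈ K, (Nb G v).card = 5) : False := by
  obtain ⟨v1, v2, v3, hK'⟩ := en3 hKc
  have hm : ∀ w ∈ [v1, v2, v3], G.Adj a w ∧ (Nb G w).card ≤ 6 := fun w hw =>
    (hK w).1 ((hK'.2 w).2 hw)
  have hm5 : ∀ w ∈ [v1, v2, v3], (Nb G w).card = 5 := fun w hw => h5 w ((hK'.2 w).2 hw)
  have hnn : ∀ w ∈ [v1, v2, v3], ∀ w' ∈ [v1, v2, v3], ¬ G.Adj w w' := fun w hw w' hw' =>
    lowlow hX (hm w hw).2 (hm w' hw').2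
  have h33 : ∀ w ∈ [v1, v2, v3], (Wd G a ∩ Nb G w).card = 3 := by
    intro w hw
    have l := low_W hX (hm w hw).2 (hm w hw).1.symm
    rw [hm5 w hw] at l
    have : (Wd G a ∩ Nb G w).card ≠ 4 := fun h => case_f4 hX hK hKc hW h5 ((hK'.2 w).2 hw) h
    omega
  have ndK := hK'.1
  simp only [List.nodup_cons, List.mem_cons, List.not_mem_nil, or_false, not_or] at ndK
  have sh := share_W hX (hm5 v1 (by simp)) (hm5 v2 (by simp)) ndK.1.1 (hm v1 (by simp)).1.symm
    (hm v2 (by simp)).1.symm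
  have l1 := h33 v1 (by simp)
  have l2 := h33 v2 (by simp)
  have l3 := h33 v3 (by simp)
  have hcom : ∀ w ∈ [v1, v2, v3], CoM G w := fun w hw => hX.com w (hm w hw).2
  set W := Wd G a with hWdef
  set A := W ∩ Nb G v1 with hA
  set B := W ∩ Nb G v2 with hB
  have hsubu : A ∪ B ⊆ W := by
    intro w; simp only [hA, hB, Finset.mem_union, Finset.mem_inter]; tauto
  have hu : (A ∪ B).card ≤ W.card := Finset.card_le_card hsubu
  have e1 := Finset.card_union_add_card_inter A B
  have e2 := Finset.card_inter_add_card_sdiff A B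
  have e3 := Finset.card_inter_add_card_sdiff B A
  have e4 := Finset.card_sdiff_add_card_eq_card hsubu
  rw [Finset.inter_comm B A] at e3
  have hasm : ∀ {l1 l2 l3 l4 : List V}, En (A ∩ B) l1 → En (A \ B) l2 → En (B \ A) l3 →
      En (W \ (A ∪ B)) l4 → En W (l1 ++ l2 ++ l3 ++ l4) := by
    intro l1 l2 l3 l4 h1 h2 h3 h4
    refine ((h1.append h2 (r := A) ?_ ?_).append h3 (r := A ∪ B) ?_ ?_).append h4 ?_ ?_
    · intro w; simp only [Finset.mem_inter, Finset.mem_sdiff]; tauto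
    · intro w; simp only [Finset.mem_inter, Finset.mem_sdiff]; tauto
    · intro w; simp only [Finset.mem_sdiff]; tauto
    · intro w; simp only [Finset.mem_union, Finset.mem_sdiff]; tauto
    · intro w; simp only [Finset.mem_union, Finset.mem_sdiff]; tauto
    · intro w
      have := @hsubu w
      simp only [Finset.mem_union, Finset.mem_sdiff] at this ⊢; tauto
  have hNa : (Nb G a).card ≤ 9 := by
    have : Nb G a ⊆ K ∪ W := by
      intro w hw
      rw [mem_Nb] at hw
      rw [Finset.mem_union, hK, hWdef, mem_Wd]
      have := le_or_gt (Nb G w).card 6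
      rcases this with h | h
      · exact Or.inl ⟨hw, h⟩
      · exact Or.inr ⟨hw, h⟩
    refine (Finset.card_le_card this).trans ((Finset.card_union_le _ _).trans ?_)
    omega
  have hcls : ∀ {p q r s t : V}, En (Wd G a) [p, q, r, s, t] →
      ∀ c ∈ fcl ++ fcl3, clT G (fL [a, v1, v2, v3, p, q, r, s, t] a) c := by
    intro p q r s t hWe
    refine List.forall_mem_append.2 ⟨fcl_ok hX hWe (hm5 _ (by simp)) (hm5 _ (by simp)) (hm5 _ (by simp))
      (hm _ (by simp)).1.symm (hm _ (by simp)).1.symm (hm _ (by simp)).1.symm ndK.1.2 ndK.2.1,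
      fcl3_ok hWe (le_of_eq l3)⟩
  rcases (by omega : (A ∩ B).card = 2 ∨ (A ∩ B).card = 1) with hc | hc
  · obtain ⟨p, q, hI⟩ := en2 (s := A ∩ B) (by omega)
    obtain ⟨r, hr⟩ := en1 (s := A \ B) (by omega)
    obtain ⟨s, hs⟩ := en1 (s := B \ A) (by omega)
    obtain ⟨t, ht⟩ := en1 (s := W \ (A ∪ B)) (by omega)
    have hWe : En W [p, q, r, s, t] := hasm hI hr hs ht
    obtain ⟨h1, h2⟩ := asm8 hK hK' hWe
    have ip := (hI.2 p).2 (by simp)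
    have iq := (hI.2 q).2 (by simp)
    have ir := (hr.2 r).2 (by simp)
    have is := (hs.2 s).2 (by simp)
    have it := (ht.2 t).2 (by simp)
    simp only [hA, hB, Finset.mem_inter, Finset.mem_sdiff, Finset.mem_union, mem_Nb, not_and, not_or]
      at ip iq ir is it
    exact hX.hR (f31_red G a v1 v2 v3 p q r s t h1 h2 ip.1.2 iq.1.2 ir.1.2 ip.2.2 iq.2.2 is.1.2
      (hnn _ (by simp) _ (by simp)) (hnn _ (by simp) _ (by simp)) (hnn _ (by simp) _ (by simp))
      (is.2 is.1.1) (it.2.1 it.1) (ir.2 ir.1.1) (it.2.2 it.1)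
      (hcom _ (by simp)) (hcom _ (by simp)) (hcom _ (by simp)) (hX.con a hNa) (hcls hWe))
  · obtain ⟨p, hI⟩ := en1 (s := A ∩ B) (by omega)
    obtain ⟨q, r, hr⟩ := en2 (s := A \ B) (by omega)
    obtain ⟨s, t, hs⟩ := en2 (s := B \ A) (by omega)
    have ht := en0 (s := W \ (A ∪ B)) (by omega)
    have hWe : En W [p, q, r, s, t] := hasm hI hr hs ht
    obtain ⟨h1, h2⟩ := asm8 hK hK' hWe
    have ip := (hI.2 p).2 (by simp)
    have iq := (hr.2 q).2 (by simp)
    have ir := (hr.2 r).2 (by simp)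
    have is := (hs.2 s).2 (by simp)
    have it := (hs.2 t).2 (by simp)
    simp only [hA, hB, Finset.mem_inter, Finset.mem_sdiff, Finset.mem_union, mem_Nb, not_and, not_or]
      at ip iq ir is it
    exact hX.hR (f32_red G a v1 v2 v3 p q r s t h1 h2 ip.1.2 iq.1.2 ir.1.2 ip.2.2 is.1.2 it.1.2
      (hnn _ (by simp) _ (by simp)) (hnn _ (by simp) _ (by simp)) (hnn _ (by simp) _ (by simp))
      (is.2 is.1.1) (it.2 it.1.1) (iq.2 iq.1.1) (ir.2 ir.1.1)
      (hcom _ (by simp)) (hcom _ (by simp)) (hcom _ (by simp)) (hX.con a hNa) (hcls hWe))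

/-- Vertices of degree at least 8 can afford the charge. -/
theorem big [Fintype V] [DecidableEq V] {G : SimpleGraph V} (hX : Ctx G) {a : V}
    (ha : 8 ≤ (Nb G a).card) :
    12 * ((Nb G a).filter (fun w => (Nb G w).card = 5)).card +
      5 * ((Nb G a).filter (fun w => (Nb G w).card = 6)).card + 210 ≤ 30 * (Nb G a).card := by
  set K5 := (Nb G a).filter (fun w => (Nb G w).card = 5) with hK5
  set K6 := (Nb G a).filter (fun w => (Nb G w).card = 6) with hK6
  have hd56 : Disjoint K5 K6 := by
    rw [Finset.disjoint_left]; intro w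
    simp only [hK5, hK6, Finset.mem_filter]; omega
  set K := K5 ∪ K6 with hKd
  have hK : ∀ w, w ∈ K ↔ G.Adj a w ∧ (Nb G w).card ≤ 6 := by
    intro w
    have := hX.ge5 w
    simp only [hKd, hK5, hK6, Finset.mem_union, Finset.mem_filter, mem_Nb]
    constructor
    · rintro (h | h) <;> exact ⟨h.1, by omega⟩
    · rintro ⟨h, h'⟩
      rcases (by omega : (Nb G w).card = 5 ∨ (Nb G w).card = 6) with h6 | h6
      · exact Or.inl ⟨h, h6⟩
      · exact Or.inr ⟨h, h6⟩
  have hKc : K.card = K5.card + K6.card := Finset.card_union_of_disjoint hd56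
  have hDc : (Nb G a).card = K.card + (Wd G a).card := by
    have hd : Disjoint K (Wd G a) := by
      rw [Finset.disjoint_left]; intro w
      rw [hK, mem_Wd]; omega
    rw [← Finset.card_union_of_disjoint hd]
    congr 1
    ext w
    rw [Finset.mem_union, hK, mem_Wd, mem_Nb]
    have := le_or_gt (Nb G w).card 6
    constructor
    · intro h
      rcases this with h' | h'
      · exact Or.inl ⟨h, h'⟩
      · exact Or.inr ⟨h, h'⟩
    · tauto
  have hw5 : ∀ v ∈ K5, 3 ≤ (Wd G a ∩ Nb G v).card := by
    intro v hv
    simp only [hK5, Finset.mem_filter, mem_Nb] at hv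
    have := low_W hX (by omega) hv.1.symm
    omega
  have hw6 : ∀ v ∈ K6, 4 ≤ (Wd G a ∩ Nb G v).card := by
    intro v hv
    simp only [hK6, Finset.mem_filter, mem_Nb] at hv
    have := low_W hX (by omega) hv.1.symm
    omega
  have hle : ∀ v, (Wd G a ∩ Nb G v).card ≤ (Wd G a).card := fun v =>
    Finset.card_le_card Finset.inter_subset_left
  have hk5 : K5.card = 0 ∨ 3 ≤ (Wd G a).card := by
    rcases Finset.eq_empty_or_nonempty K5 with h | ⟨v, hv⟩
    · left; rw [h]; rfl
    · right; exact (hw5 v hv).trans (hle v)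
  have hk6 : K6.card = 0 ∨ 4 ≤ (Wd G a).card := by
    rcases Finset.eq_empty_or_nonempty K6 with h | ⟨v, hv⟩
    · left; rw [h]; rfl
    · right; exact (hw6 v hv).trans (hle v)
  have h3 : 2 ≤ K5.card → (Wd G a).card ≠ 3 := by
    intro h2 hW
    obtain ⟨v, hv, x, hx, hne⟩ := Finset.one_lt_card.1 h2
    have ev : Wd G a ∩ Nb G v = Wd G a :=
      Finset.eq_of_subset_of_card_le Finset.inter_subset_left (by have := hw5 v hv; omega)
    have ex : Wd G a ∩ Nb G x = Wd G a :=
      Finset.eq_of_subset_of_card_le Finset.inter_subset_left (by have := hw5 x hx; omega)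
    simp only [hK5, Finset.mem_filter, mem_Nb] at hv hx
    have := share_W hX hv.2 hx.2 hne hv.1.symm hx.1.symm
    rw [ev, ex, Finset.inter_self] at this
    omega
  have h4 : K.card = 4 → (Wd G a).card = 4 → False := by
    intro hk hW
    rcases Finset.eq_empty_or_nonempty K6 with h | ⟨v, hv⟩
    · refine case_e5 hX hK hk hW ?_
      intro v hv
      rw [hKd, h, Finset.union_empty, hK5, Finset.mem_filter] at hv
      exact hv.2
    · refine case_e6 hX hK hk hW (v := v) (Finset.mem_union_right _ hv) ?_
      rw [hK6, Finset.mem_filter] at hv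
      exact hv.2
  have h5 : K.card = 3 → K6.card = 0 → (Wd G a).card = 5 → False := by
    intro hk h60 hW
    refine case_f3 hX hK hk hW ?_
    intro v hv
    rw [hKd, Finset.card_eq_zero.1 h60, Finset.union_empty, hK5, Finset.mem_filter] at hv
    exact hv.2
  by_contra hcon
  have h3' : K5.card < 2 ∨ (Wd G a).card ≠ 3 := by
    by_contra hc
    push Not at hc
    exact h3 hc.1 hc.2
  have h4' : K.card ≠ 4 ∨ (Wd G a).card ≠ 4 := by
    by_contra hc
    push Not at hc
    exact h4 hc.1 hc.2
  have h5' : K.card ≠ 3 ∨ K6.card ≠ 0 ∨ (Wd G a).card ≠ 5 := by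
    by_contra hc
    push Not at hc
    exact h5 hc.1 hc.2.1 hc.2.2
  clear h3 h4 h5
  rcases (by omega : 10 ≤ (Nb G a).card ∨ (Nb G a).card = 9 ∨ (Nb G a).card = 8) with h | h | h
  · omega
  · omega
  · omega

open Classical in
noncomputable def wt [Fintype V] (G : SimpleGraph V) (a v : V) : ℕ :=
  if (Nb G v).card ≤ 6 ∧ G.Adj a v then
    (if ∃ u, G.Adj v u ∧ (Nb G u).card = 7 then
      (if ∃ u, (Nb G u).card = 7 ∧ G.Adj v u ∧ G.Adj u a then 30 else 0)
    else if (Nb G v).card = 5 then 12 else 5)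
  else 0

theorem wt_le [Fintype V] (G : SimpleGraph V) (a v : V) : wt G a v ≤ 30 := by
  unfold wt
  split_ifs <;> omega

theorem low_recv [Fintype V] [DecidableEq V] {G : SimpleGraph V} (hX : Ctx G) {x : V}
    (hx : (Nb G x).card ≤ 6) : 210 ≤ 30 * (Nb G x).card + ∑ a, wt G a x := by
  have h5 := hX.ge5 x
  by_cases hb : ∃ u, G.Adj x u ∧ (Nb G u).card = 7
  · obtain ⟨u, hxu, hu⟩ := hb
    have hs := (seven hX hx hu hxu).1
    have h1 : ∑ a ∈ Nb G x ∩ Nb G u, wt G a x ≤ ∑ a, wt G a x :=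
      Finset.sum_le_sum_of_subset (Finset.subset_univ _)
    have h2 : ∑ a ∈ Nb G x ∩ Nb G u, wt G a x = ∑ a ∈ Nb G x ∩ Nb G u, 30 := by
      refine Finset.sum_congr rfl fun a ha => ?_
      simp only [Finset.mem_inter, mem_Nb] at ha
      unfold wt
      rw [if_pos ⟨hx, ha.1.symm⟩, if_pos ⟨u, hxu, hu⟩, if_pos ⟨u, hu, hxu, ha.2⟩]
    rw [Finset.sum_const, smul_eq_mul] at h2
    omega
  · have h1 : ∑ a ∈ Nb G x, wt G a x ≤ ∑ a, wt G a x :=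
      Finset.sum_le_sum_of_subset (Finset.subset_univ _)
    have h2 : ∑ a ∈ Nb G x, wt G a x = ∑ a ∈ Nb G x, (if (Nb G x).card = 5 then 12 else 5) := by
      refine Finset.sum_congr rfl fun a ha => ?_
      rw [mem_Nb] at ha
      unfold wt
      rw [if_pos ⟨hx, ha.symm⟩, if_neg hb]
    rw [Finset.sum_const, smul_eq_mul] at h2
    rcases (by omega : (Nb G x).card = 5 ∨ (Nb G x).card = 6) with h | h
    · rw [if_pos h] at h2; omega
    · rw [if_neg (by omega)] at h2; omega

theorem send_sum [Fintype V] [DecidableEq V] (G : SimpleGraph V) (x : V) :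
    ∑ v, wt G x v = ∑ v ∈ (Nb G x).filter (fun w => (Nb G w).card ≤ 6), wt G x v := by
  symm
  refine Finset.sum_subset (Finset.subset_univ _) fun v _ hv => ?_
  rw [Finset.mem_filter, mem_Nb] at hv
  unfold wt
  rw [if_neg (by tauto)]

theorem local_ineq [Fintype V] [DecidableEq V] {G : SimpleGraph V} (hX : Ctx G) (x : V) :
    210 + ∑ v, wt G x v ≤ 30 * (Nb G x).card + ∑ a, wt G a x := by
  rw [send_sum]
  set K := (Nb G x).filter (fun w => (Nb G w).card ≤ 6) with hK
  have hKm : ∀ v, v ∈ K ↔ G.Adj x v ∧ (Nb G v).card ≤ 6 := by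
    intro v; rw [hK, Finset.mem_filter, mem_Nb]
  by_cases hx : (Nb G x).card ≤ 6
  · have h0 : ∑ v ∈ K, wt G x v = 0 := by
      refine Finset.sum_eq_zero fun v hv => ?_
      rw [hKm] at hv
      exact absurd hv.1 (lowlow hX hx hv.2)
    have := low_recv hX hx
    omega
  suffices h : 210 + ∑ v ∈ K, wt G x v ≤ 30 * (Nb G x).card by omega
  have hsplit : (Nb G x).card = K.card + ((Nb G x).filter (fun w => 7 ≤ (Nb G w).card)).card := by
    rw [← Finset.card_filter_add_card_filter_not (s := Nb G x) (fun w => (Nb G w).card ≤ 6)]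
    congr 2
    refine Finset.filter_congr fun w _ => ?_
    omega
  by_cases hc : ∃ v u, v ∈ K ∧ (Nb G u).card = 7 ∧ G.Adj v u ∧ G.Adj u x
  · obtain ⟨v, u, hv, hu, hvu, hux⟩ := hc
    rw [hKm] at hv
    have h7 := bad_nonlow hX hu hv.2 hvu hv.1.symm hux
    have hle : ∑ v ∈ K, wt G x v ≤ ∑ v ∈ K, 30 := Finset.sum_le_sum fun v _ => wt_le G x v
    rw [Finset.sum_const, smul_eq_mul] at hle
    omega
  have hval : ∀ v ∈ K, (∃ u, G.Adj v u ∧ (Nb G u).card = 7) → wt G x v = 0 := by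
    intro v hv hb
    have hv' := (hKm v).1 hv
    unfold wt
    rw [if_pos ⟨hv'.2, hv'.1⟩, if_pos hb, if_neg]
    rintro ⟨u, h⟩
    exact hc ⟨v, u, hv, h⟩
  rcases (by omega : (Nb G x).card = 7 ∨ 8 ≤ (Nb G x).card) with h7 | h8
  · have h0 : ∑ v ∈ K, wt G x v = 0 :=
      Finset.sum_eq_zero fun v hv => hval v hv ⟨x, ((hKm v).1 hv).1.symm, h7⟩
    omega
  have hle : ∑ v ∈ K, wt G x v ≤ ∑ v ∈ K, ((if (Nb G v).card = 5 then 12 else 0) +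
      (if (Nb G v).card = 6 then 5 else 0)) := by
    refine Finset.sum_le_sum fun v hv => ?_
    by_cases hb : ∃ u, G.Adj v u ∧ (Nb G u).card = 7
    · rw [hval v hv hb]; exact Nat.zero_le _
    have hv' := (hKm v).1 hv
    have := hX.ge5 v
    unfold wt
    rw [if_pos ⟨hv'.2, hv'.1⟩, if_neg hb]
    split_ifs <;> omega
  have hle2 : ∑ v ∈ K, ((if (Nb G v).card = 5 then 12 else 0) + (if (Nb G v).card = 6 then 5 else 0))
      ≤ ∑ v ∈ Nb G x, ((if (Nb G v).card = 5 then 12 else 0) + (if (Nb G v).card = 6 then 5 else 0)) :=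
    Finset.sum_le_sum_of_subset (Finset.filter_subset _ _)
  rw [Finset.sum_add_distrib, Finset.sum_add_distrib, ← Finset.sum_filter, ← Finset.sum_filter,
    ← Finset.sum_filter, ← Finset.sum_filter] at hle2
  rw [Finset.sum_add_distrib, ← Finset.sum_filter, ← Finset.sum_filter] at hle
  simp only [Finset.sum_const, smul_eq_mul] at hle hle2
  have := big hX h8
  omega

theorem sum_Nb [Fintype V] [DecidableEq V] (G : SimpleGraph V) :
    ∑ v, (Nb G v).card = 2 * G.edgeSet.ncard := by
  classical
  have h := G.sum_degrees_eq_twice_card_edges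
  rw [← G.coe_edgeFinset, Set.ncard_coe_finset, ← h]
  refine Finset.sum_congr rfl fun v _ => ?_
  rw [← G.card_neighborFinset_eq_degree]
  congr 1
  ext w
  rw [mem_Nb, mem_neighborFinset]

/-- Every robust finite simple graph with average degree less than 7, i.e. with
`2|E(G)| < 7|V(G)|`, has a reducible vertex set. -/
theorem robust_has_reducible_set [Fintype V] [DecidableEq V] (G : SimpleGraph V)
    (hrob : Robust G)
    (hdeg : 2 * G.edgeSet.ncard < 7 * Fintype.card V) :
    ∃ V₀ : Finset V, ReducibleVertexSet G V₀ := by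
  by_contra hR
  have hX := mkCtx hrob hR
  have h := Finset.sum_le_sum (s := Finset.univ) fun x _ => local_ineq hX x
  rw [Finset.sum_add_distrib, Finset.sum_add_distrib, Finset.sum_comm (f := fun x v => wt G x v),
    ← Finset.mul_sum, sum_Nb, Finset.sum_const, smul_eq_mul, Finset.card_univ] at h
  omega
end

section
/- If H is a finite simple graph containing no odd cycle of length greater than 3, then H is a weak König–Egerváry graph. -/
open SimpleGraph

variable {V : Type*}

/-- `M` is a matching of `H`: a set of pairwise disjoint edges of `H`. -/
def IsMatchingSet [DecidableEq V] (H : SimpleGraph V) (M : Finset (Sym2 V)) : Prop :=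
  ↑M ⊆ H.edgeSet ∧ (M : Set (Sym2 V)).Pairwise fun e f => ∀ x ∈ e, x ∉ f

/-- `Q` is a vertex cover of `H`: a set of vertices meeting every edge of `H`. -/
def IsVertexCoverSet (H : SimpleGraph V) (Q : Finset V) : Prop :=
  ∀ e ∈ H.edgeSet, ∃ x ∈ e, x ∈ Q

/-- `H` is a weak König--Egerváry graph: there are a matching `M` and a vertex set `Q`
with `|Q| ≤ |M|` such that `Q` is a vertex cover of `H - M`. -/
def WKE [DecidableEq V] (H : SimpleGraph V) : Prop :=
  ∃ (M : Finset (Sym2 V)) (Q : Finset V),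
    IsMatchingSet H M ∧ Q.card ≤ M.card ∧ IsVertexCoverSet (H.deleteEdges ↑M) Q

section Helpers

open Classical in
/-- number of non-fixed points -/
noncomputable def wkSz [Fintype V] (m : V → V) : ℕ := (Finset.univ.filter (fun x => m x ≠ x)).card

def WkMt (G : SimpleGraph V) (m : V → V) : Prop :=
  (∀ x, m (m x) = x) ∧ ∀ x, m x ≠ x → G.Adj x (m x)

def WkMx [Fintype V] (G : SimpleGraph V) (m : V → V) : Prop :=
  WkMt G m ∧ ∀ n, WkMt G n → wkSz n ≤ wkSz m

lemma wk_even [Fintype V] (m : V → V) (h : ∀ x, m (m x) = x) : 2 ∣ wkSz m := by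
  classical
  have := Equiv.Perm.two_dvd_card_support (σ := Function.Involutive.toPerm m h)
    (by ext x; rw [pow_two]; exact h x)
  convert this using 1
  unfold wkSz
  congr 1

/-- two missed vertices are not adjacent -/
lemma wk_noadd [Fintype V] {G : SimpleGraph V} {m : V → V} (h : WkMx G m) {u v : V}
    (hu : m u = u) (hv : m v = v) : ¬ G.Adj u v := by
  classical
  intro ha
  have hne := ha.ne
  have inj : ∀ x y, m x = m y → x = y := fun x y e => by rw [← h.1.1 x, e, h.1.1]
  have key : WkMt G (fun x => if x = u then v else if x = v then u else m x) := by
    constructor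
    · intro x
      have h1 := h.1.1 x
      grind
    · intro x hx
      have h1 := h.1.2 x
      have := ha.symm
      grind
  have := h.2 _ key
  apply absurd this
  rw [not_le]
  apply Finset.card_lt_card
  rw [Finset.ssubset_iff_of_subset]
  · exact ⟨u, by simp [hne.symm], by simp [hu]⟩
  · intro x
    simp only [Finset.mem_filter, Finset.mem_univ, true_and]
    grind

open Classical in
noncomputable def wkMix (S : Set V) (m n : V → V) : V → V := fun x => if x ∈ S then m x else n x

lemma wk_mix_mt {G : SimpleGraph V} {m n : V → V} (hm : WkMt G m) (hn : WkMt G n)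
    (S : Set V) (h1 : ∀ x ∈ S, m x ∈ S) (h2 : ∀ x ∈ S, n x ∈ S) : WkMt G (wkMix S m n) := by
  have h3 : ∀ x, x ∉ S → n x ∉ S := fun x hx h => hx (by have := h2 _ h; rwa [hn.1] at this)
  constructor
  · intro x
    have := hm.1 x
    have := hn.1 x
    unfold wkMix
    grind
  · intro x
    have := hm.2 x
    have := hn.2 x
    unfold wkMix
    grind

lemma wk_mix_sz [Fintype V] (S : Set V) (m n : V → V) :
    wkSz (wkMix S m n) + wkSz (wkMix S n m) = wkSz m + wkSz n := by
  classical
  unfold wkSz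
  simp only [Finset.card_filter]
  rw [← Finset.sum_add_distrib, ← Finset.sum_add_distrib]
  apply Finset.sum_congr rfl
  intro x _
  unfold wkMix
  by_cases hx : x ∈ S
  · simp [hx]
  · simp [hx, add_comm]

lemma wk_mix_mx [Fintype V] {G : SimpleGraph V} {m n : V → V} (hm : WkMx G m) (hn : WkMx G n)
    (S : Set V) (h1 : ∀ x ∈ S, m x ∈ S) (h2 : ∀ x ∈ S, n x ∈ S) : WkMx G (wkMix S m n) := by
  refine ⟨wk_mix_mt hm.1 hn.1 S h1 h2, fun k hk => ?_⟩
  have a := wk_mix_sz S m n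
  have b := hm.2 _ (wk_mix_mt hn.1 hm.1 S h2 h1)
  have c := hn.2 _ hk
  omega

lemma wk_path {G : SimpleGraph V} (f : ℕ → V) (n : ℕ) (ha : ∀ i < n, G.Adj (f i) (f (i+1)))
    (hi : ∀ i j, i < j → j ≤ n → f i ≠ f j) :
    ∃ p : G.Walk (f 0) (f n), p.IsPath ∧ p.length = n ∧ (∀ x ∈ p.support, ∃ i ≤ n, x = f i) ∧
      ∀ e ∈ p.edges, ∃ i < n, e = s(f i, f (i+1)) := by
  induction n with
  | zero => exact ⟨Walk.nil, by simp⟩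
  | succ n ih =>
    obtain ⟨p, h1, h2, h3, h4⟩ := ih (fun i h => ha i (by omega)) (fun i j h h' => hi i j h (by omega))
    refine ⟨p.concat (ha n (by omega)), ?_, by simp [h2], ?_, ?_⟩
    · apply h1.concat
      intro hx
      obtain ⟨i, hi1, hi2⟩ := h3 _ hx
      exact hi i (n+1) (by omega) (by omega) hi2.symm
    · intro x hx
      rw [Walk.support_concat] at hx
      simp only [List.concat_eq_append, List.mem_append, List.mem_singleton] at hx
      rcases hx with hx | hx
      · obtain ⟨i, hi1, hi2⟩ := h3 _ hx
        exact ⟨i, by omega, hi2⟩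
      · exact ⟨n+1, le_rfl, hx⟩
    · intro e he
      rw [Walk.edges_concat] at he
      simp only [List.concat_eq_append, List.mem_append, List.mem_singleton] at he
      rcases he with hx | hx
      · obtain ⟨i, hi1, hi2⟩ := h4 _ hx
        exact ⟨i, by omega, hi2⟩
      · exact ⟨n, by omega, hx⟩

/-- alternating sequence -/
def wkSeq (m n : V → V) (u : V) : ℕ → V
  | 0 => u
  | i+1 => if i % 2 = 0 then n (wkSeq m n u i) else m (wkSeq m n u i)

def WkOdd (G : SimpleGraph V) : Prop :=
  ∀ (u : V) (w : G.Walk u u), w.IsCycle → Odd w.length → w.length ≤ 3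

lemma wk_A [Fintype V] {G : SimpleGraph V} (hodd : WkOdd G) {m n : V → V} (hm : WkMx G m)
    (hn : WkMx G n) {u v : V} (hu : m u = u) (hv : n v = v) (ha : G.Adj u v) : m v = n u := by
  classical
  set x := wkSeq m n u with hx
  have x0 : x 0 = u := rfl
  have xe : ∀ i, i % 2 = 0 → x (i+1) = n (x i) := fun i hi => by
    simp [hx, wkSeq, hi]
  have xo : ∀ i, i % 2 = 1 → x (i+1) = m (x i) := fun i hi => by
    simp [hx, wkSeq, hi]
  have mm := hm.1.1
  have nn := hn.1.1
  have me : ∀ i, (i+1) % 2 = 0 → m (x (i+1)) = x i := fun i hi => by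
    rw [xo i (by omega), mm]
  have no : ∀ i, (i+1) % 2 = 1 → n (x (i+1)) = x i := fun i hi => by
    rw [xe i (by omega), nn]
  have hvS : v ∈ Set.range x := by
    by_contra hvS
    have hS1 : ∀ y ∈ Set.range x, m y ∈ Set.range x := by
      rintro _ ⟨i, rfl⟩
      rcases Nat.mod_two_eq_zero_or_one i with h | h
      · cases i with
        | zero => exact ⟨0, by rw [x0, hu]⟩
        | succ i => exact ⟨i, (me i h).symm⟩
      · exact ⟨i+1, xo i h⟩
    have hS2 : ∀ y ∈ Set.range x, n y ∈ Set.range x := by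
      rintro _ ⟨i, rfl⟩
      rcases Nat.mod_two_eq_zero_or_one i with h | h
      · exact ⟨i+1, xe i h⟩
      · cases i with
        | zero => omega
        | succ i => exact ⟨i, (no i h).symm⟩
    refine wk_noadd (wk_mix_mx hm hn _ hS1 hS2) (u := u) (v := v) ?_ ?_ ha
    · unfold wkMix
      rw [if_pos ⟨0, x0⟩, hu]
    · unfold wkMix
      rw [if_neg hvS, hv]
  have hex : ∃ k, x k = v := hvS
  obtain ⟨N, hN, hmin⟩ : ∃ N, x N = v ∧ ∀ k < N, x k ≠ v :=
    ⟨Nat.find hex, Nat.find_spec hex, fun k hk => Nat.find_min hex hk⟩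
  have hNpos : N ≠ 0 := by
    rintro rfl
    exact ha.ne (x0.symm.trans hN)
  have hNe : N % 2 = 0 := by
    by_contra hNe
    obtain ⟨k, rfl⟩ := Nat.exists_eq_succ_of_ne_zero hNpos
    have h := no k (by omega)
    rw [Nat.succ_eq_add_one] at hN
    rw [hN, hv] at h
    exact hmin k (by omega) h.symm
  have same : ∀ i j, i < j → j ≤ N → i % 2 = j % 2 → x i ≠ x j := by
    intro i j hij hj hp he
    have step : ∀ t, x (i+t) = x (j+t) := by
      intro t
      induction t with
      | zero => exact he
      | succ t ih =>
        rcases Nat.mod_two_eq_zero_or_one (i+t) with h | h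
        · rw [← add_assoc, ← add_assoc, xe _ h, xe _ (by omega), ih]
        · rw [← add_assoc, ← add_assoc, xo _ h, xo _ (by omega), ih]
    have := step (N - j)
    rw [show j + (N-j) = N by omega, hN] at this
    exact hmin _ (by omega) this
  have diff : ∀ i j, i < j → j ≤ N → x i ≠ x j := by
    intro i j hij hj he
    by_cases hp : i % 2 = j % 2
    · exact same i j hij hj hp he
    have step : ∀ t ≤ i, x (i-t) = x (j+t) := by
      intro t
      induction t with
      | zero => intro _; exact he
      | succ t ih =>
        intro ht
        have ih := ih (by omega)
        obtain ⟨k, hk⟩ : ∃ k, i - t = k + 1 := ⟨i-t-1, by omega⟩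
        rw [show i - (t+1) = k by omega, ← add_assoc]
        rw [hk] at ih
        rcases Nat.mod_two_eq_zero_or_one (j+t) with h | h
        · rw [xe _ h, ← ih, no k (by omega)]
        · rw [xo _ h, ← ih, me k (by omega)]
    by_cases hc : N - j ≤ i
    · have := step (N-j) hc
      rw [show j + (N-j) = N by omega, hN] at this
      exact hmin _ (by omega) this
    · have h1 := step i le_rfl
      have h2 := xo (j+i) (by omega)
      rw [← h1, Nat.sub_self, x0, hu] at h2
      exact same 0 (j+i+1) (by omega) (by omega) (by omega) (by rw [x0, h2])
  have adj : ∀ i < N, G.Adj (x i) (x (i+1)) := by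
    intro i hi
    have hd := diff i (i+1) (by omega) (by omega)
    rcases Nat.mod_two_eq_zero_or_one i with h | h
    · rw [xe i h] at hd ⊢
      exact hn.1.2 _ hd.symm
    · rw [xo i h] at hd ⊢
      exact hm.1.2 _ hd.symm
  obtain ⟨p, p1, p2, p3, p4⟩ := wk_path x N adj diff
  have haN : G.Adj (x N) (x 0) := by rw [hN, x0]; exact ha.symm
  have hcyc : (Walk.cons haN p).IsCycle := by
    rw [Walk.cons_isCycle_iff]
    refine ⟨p1, fun he => ?_⟩
    obtain ⟨i, hi, he⟩ := p4 _ he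
    rw [Sym2.eq_iff] at he
    rcases he with ⟨h1, h2⟩ | ⟨h1, h2⟩
    · exact diff i N hi le_rfl h1.symm
    · rcases Nat.lt_or_ge (i+1) N with h | h
      · exact diff (i+1) N h le_rfl h1.symm
      · exact diff 0 i (by omega) (by omega) h2
  have := hodd _ _ hcyc (by rw [Walk.length_cons, p2, Nat.odd_iff]; omega)
  rw [Walk.length_cons, p2] at this
  have hN2 : N = 2 := by omega
  subst hN2
  have e1 := xe 0 rfl
  have e2 := xo 1 rfl
  rw [x0] at e1
  simp only [zero_add] at e1
  rw [e1] at e2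
  have e3 : v = m (n u) := by rw [← hN]; exact e2
  rw [e3, mm]

lemma wk_rot [Fintype V] {G : SimpleGraph V} {n : V → V} (hn : WkMx G n) {v a : V}
    (hv : n v = v) (ha : G.Adj v (n a)) :
    ∃ n', WkMx G n' ∧ n' a = a ∧ n' v = n a ∧ n' (n a) = v ∧
      ∀ x, x ≠ v → x ≠ a → x ≠ n a → n' x = n x := by
  classical
  have nn := hn.1.1
  have h1 := ha.ne
  have h2 : a ≠ v := by rintro rfl; exact h1 hv.symm
  have h3 : n a ≠ a := by
    intro h
    exact wk_noadd hn hv h (h ▸ ha)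
  have h4 : ∀ x y, n x = n y → x = y := fun x y e => by rw [← nn x, e, nn]
  let k : V → V := fun x => if x = a then a else if x = v then n a else if x = n a then v else n x
  have hk : WkMt G k := by
    constructor
    · intro x
      have := nn x
      have := nn a
      simp only [k]
      grind
    · intro x
      have := hn.1.2 x
      have := ha.symm
      simp only [k]
      grind
  refine ⟨k, ⟨hk, fun l hl => (hn.2 l hl).trans ?_⟩, by grind, by grind, by grind, by grind⟩
  unfold wkSz
  apply Finset.card_le_card_of_injOn (Equiv.swap v a)
  · intro x hx
    simp only [Finset.coe_filter, Finset.mem_univ, true_and, Set.mem_setOf_eq] at hx ⊢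
    simp only [k, Equiv.swap_apply_def]
    grind
  · exact (Equiv.swap v a).injective.injOn

def WkGood [Fintype V] (G : SimpleGraph V) : Prop :=
  ∀ m, WkMx G m → ∃ Q : Finset V, 2 * Q.card ≤ wkSz m ∧
    ∀ x y, G.Adj x y → m x ≠ y → x ∈ Q ∨ y ∈ Q

lemma wk_base [Fintype V] {G : SimpleGraph V} (hodd : WkOdd G)
    (hmiss : ∀ v, ∃ n, WkMx G n ∧ n v = v) : WkGood G := by
  classical
  choose N hN hNv using hmiss
  -- third vertex
  let w : V → V → V := fun u v => N v u
  have hw : ∀ {u v : V} {n : V → V}, G.Adj u v → WkMx G n → n v = v → n u = w u v := by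
    intro u v n ha hn hv
    have h1 := wk_A hodd (hN u) hn (hNv u) hv ha
    have h2 := wk_A hodd (hN u) (hN v) (hNv u) (hNv v) ha
    exact h1.symm.trans h2
  have hws : ∀ {u v : V}, G.Adj u v → w u v = w v u := by
    intro u v ha
    exact (wk_A hodd (hN u) (hN v) (hNv u) (hNv v) ha).symm
  have hwa : ∀ {u v : V}, G.Adj u v → G.Adj u (w u v) := by
    intro u v ha
    apply (hN v).1.2
    intro h
    exact wk_noadd (hN v) h (hNv v) ha
  have hwt : ∀ {u v : V}, G.Adj u v → w u (w u v) = v := by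
    intro u v ha
    have e : N v (w u v) = u := (hN v).1.1 u
    obtain ⟨n', h1, h2, h3, h4, -⟩ := wk_rot (hN v) (v := v) (a := w u v) (hNv v)
      (by rw [e]; exact ha.symm)
    rw [e] at h4
    exact (hw (hwa ha) h1 h2).symm.trans h4
  have hhit : ∀ (x u : V) (p : G.Walk x u) (v : V) (_ : G.Adj u v) (m : V → V), WkMx G m → m x = x →
      m u = v ∨ m u = w u v ∨ m v = w u v := by
    intro x u p
    induction p with
    | nil =>
      intro v ha m hm hx
      right; right
      rw [hws ha]
      exact hw ha.symm hm hx
    | @cons x y u hxy p ih =>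
      intro v ha m hm hx
      have hz : m y = w y x := hw hxy.symm hm hx
      have hxz : G.Adj x (m y) := by
        rw [hz, hws hxy.symm]; exact hwa hxy
      obtain ⟨m', h1, h2, h3, h4, h5⟩ := wk_rot hm hx hxz
      have mm := hm.1.1
      -- transfer
      have tr : ∀ a b, G.Adj a b → m' a = b → m a = b ∨ m a = w a b ∨ m b = w a b := by
        intro a b hab e
        by_cases c1 : a = x
        · subst c1
          right; right
          rw [h3] at e
          rw [← e, mm, hz, hws hxy.symm, hwt hxy]
        by_cases c2 : a = y
        · subst c2
          exact absurd (h2.symm.trans e) hab.ne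
        by_cases c3 : a = m y
        · right; left
          rw [c3, h4] at e
          subst e
          rw [hws hab, c3, mm, hz, hws hxy.symm, hwt hxy]
        · left
          rw [← h5 a c1 c2 c3, e]
      have hwv : G.Adj v (w u v) := by rw [hws ha]; exact hwa ha.symm
      have e1 : w u (w u v) = v := hwt ha
      have e2 : w v (w u v) = u := by
        rw [hws ha]; exact hwt ha.symm
      have inv : ∀ a b, m a = b → m b = a := fun a b e => by rw [← e, mm]
      rcases ih v ha m' h1 h2 with h | h | h
      · exact tr _ _ ha h
      · have := tr _ _ (hwa ha) h
        rw [e1] at this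
        rcases this with h | h | h
        · exact Or.inr (Or.inl h)
        · exact Or.inl h
        · exact Or.inr (Or.inr (inv _ _ h))
      · have := tr _ _ hwv h
        rw [e2] at this
        rcases this with h | h | h
        · exact Or.inr (Or.inr h)
        · exact Or.inl (inv _ _ h)
        · exact Or.inr (Or.inl (inv _ _ h))
  intro m hm
  have mm := hm.1.1
  refine ⟨(Finset.univ.filter (fun x => m x ≠ x)).image (fun x => w x (m x)), ?_, ?_⟩
  · unfold wkSz
    apply Finset.mul_card_image_le_card
    intro b hb
    obtain ⟨x, hx, rfl⟩ := Finset.mem_image.1 hb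
    simp only [Finset.mem_filter, Finset.mem_univ, true_and] at hx
    rw [← Finset.card_pair hx]
    apply Finset.card_le_card
    intro y hy
    simp only [Finset.mem_insert, Finset.mem_singleton] at hy
    simp only [Finset.mem_filter, Finset.mem_univ, true_and]
    rcases hy with rfl | rfl
    · rw [mm]
      exact ⟨hx.symm, (hws (hm.1.2 _ hx)).symm⟩
    · exact ⟨hx, rfl⟩
  · intro u v ha hne
    obtain ⟨x, hxK, hx⟩ : ∃ x, G.Reachable x u ∧ m x = x := by
      by_contra! hcon
      have step : ∀ k : V → V, WkMt G k → ∀ x ∈ {x | G.Reachable x u}, k x ∈ {x | G.Reachable x u} := by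
        intro k hk x hx
        by_cases e : k x = x
        · rwa [e]
        · exact (hk.2 x e).symm.reachable.trans hx
      have h1 := (hN u).2 _ (wk_mix_mt hm.1 (hN u).1 {x | G.Reachable x u} (step _ hm.1)
        (step _ (hN u).1))
      apply absurd h1
      rw [not_le]
      apply Finset.card_lt_card
      rw [Finset.ssubset_iff_of_subset]
      · refine ⟨u, ?_, by simp [hNv u]⟩
        have hr : G.Reachable u u := Reachable.refl u
        rw [Finset.mem_filter]
        refine ⟨Finset.mem_univ _, ?_⟩
        unfold wkMix
        rw [if_pos (show u ∈ {x | G.Reachable x u} from hr)]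
        exact hcon u hr
      · intro y
        simp only [Finset.mem_filter, Finset.mem_univ, true_and, wkMix, Set.mem_setOf_eq]
        intro hy
        split_ifs with hr
        · exact hcon y hr
        · exact hy
    obtain ⟨p⟩ := hxK
    have hwv : G.Adj v (w u v) := by rw [hws ha]; exact hwa ha.symm
    simp only [Finset.mem_image, Finset.mem_filter, Finset.mem_univ, true_and]
    rcases hhit x u p v ha m hm hx with h | h | h
    · exact absurd h hne
    · right
      exact ⟨u, by rw [h]; exact (hwa ha).ne', by rw [h, hwt ha]⟩
    · left
      exact ⟨v, by rw [h]; exact hwv.ne', by rw [h, hws ha, hwt ha.symm]⟩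

lemma wk_all [Fintype V] (G : SimpleGraph V) (hodd : WkOdd G) : WkGood G := by
  classical
  induction G using WellFoundedLT.induction with
  | ind G ih =>
  by_cases hmiss : ∀ v, ∃ n, WkMx G n ∧ n v = v
  · exact wk_base hodd hmiss
  push Not at hmiss
  obtain ⟨v, hv⟩ := hmiss
  intro m hm
  have mm := hm.1.1
  have hmv := hv m hm
  have inj : ∀ x y, m x = m y → x = y := fun x y e => by rw [← mm x, e, mm]
  let G' : SimpleGraph V :=
    { Adj := fun a b => G.Adj a b ∧ a ≠ v ∧ b ≠ v
      symm := ⟨fun a b h => ⟨h.1.symm, h.2.2, h.2.1⟩⟩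
      loopless := ⟨fun a h => h.1.ne rfl⟩ }
  have hle : G' ≤ G := fun a b h => h.1
  have hlt : G' < G := by
    refine lt_of_le_of_ne hle ?_
    intro h
    have h1 : G'.Adj v (m v) := by rw [h]; exact hm.1.2 v hmv
    exact h1.2.1 rfl
  have hodd' : WkOdd G' := by
    intro u p hp ho
    have := hodd u (p.mapLe hle) (hp.mapLe hle) (by simpa using ho)
    simpa using this
  let k : V → V := fun x => if x = v then v else if x = m v then m v else m x
  have hk : WkMt G' k := by
    constructor
    · intro x
      have := mm x
      have := mm v
      simp only [k]
      grind
    · intro x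
      have := hm.1.2 x
      have := mm x
      simp only [k, G']
      grind
  have hsz : wkSz k + 2 = wkSz m := by
    unfold wkSz
    have : (Finset.univ.filter (fun x => m x ≠ x)) =
        insert v (insert (m v) (Finset.univ.filter (fun x => k x ≠ x))) := by
      ext x
      have := mm v
      simp only [Finset.mem_filter, Finset.mem_univ, true_and, Finset.mem_insert, k]
      grind
    rw [this, Finset.card_insert_of_notMem, Finset.card_insert_of_notMem]
    · simp [k, hmv]
    · simp only [Finset.mem_insert, Finset.mem_filter, k]
      grind
  have hkm : WkMx G' k := by
    refine ⟨hk, fun n hn => ?_⟩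
    by_contra! hlt
    have e1 := wk_even n hn.1
    have e2 := wk_even k hk.1
    have hnv : n v = v := by
      by_contra h
      exact (hn.2 v h).2.1 rfl
    refine hv n ⟨⟨hn.1, fun x hx => hle (hn.2 x hx)⟩, fun l hl => (hm.2 l hl).trans ?_⟩ hnv
    omega
  obtain ⟨Q, hQ1, hQ2⟩ := ih G' hlt hodd' k hkm
  refine ⟨insert v Q, ?_, ?_⟩
  · have := Finset.card_insert_le v Q
    omega
  · intro x y ha hne
    by_cases hx : x = v
    · simp [hx]
    by_cases hy : y = v
    · simp [hy]
    have hkx : k x ≠ y := by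
      have := ha.ne
      simp only [k]
      grind
    rcases hQ2 x y ⟨ha, hx, hy⟩ hkx with h | h
    · simp [h]
    · simp [h]

end Helpers

/-- If `H` is a finite graph with no odd cycle of length greater than 3, then `H` is a weak
König--Egerváry graph. -/
theorem no_long_odd_cycle_wke [Fintype V] [DecidableEq V] (H : SimpleGraph V)
    (hodd : ∀ (u : V) (w : H.Walk u u), w.IsCycle → Odd w.length → w.length ≤ 3) :
    WKE H := by
  classical
  obtain ⟨m, hm⟩ : ∃ m, WkMx H m := by
    have hid : WkMt H id := ⟨fun _ => rfl, fun x h => absurd rfl h⟩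
    obtain ⟨m, h1, h2⟩ := Set.exists_max_image {m | WkMt H m} wkSz (Set.toFinite _) ⟨id, hid⟩
    exact ⟨m, h1, h2⟩
  obtain ⟨Q, hQ1, hQ2⟩ := wk_all H hodd m hm
  have mm := hm.1.1
  refine ⟨(Finset.univ.filter (fun x => m x ≠ x)).image (fun x => s(x, m x)), Q, ⟨?_, ?_⟩, ?_, ?_⟩
  · intro e he
    simp only [Finset.coe_image, Finset.coe_filter, Finset.mem_univ, true_and, Set.mem_image,
      Set.mem_setOf_eq] at he
    obtain ⟨x, hx, rfl⟩ := he
    exact hm.1.2 x hx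
  · intro e he f hf hne z hz hz'
    simp only [Finset.coe_image, Finset.coe_filter, Finset.mem_univ, true_and, Set.mem_image,
      Set.mem_setOf_eq] at he hf
    have key : ∀ x, z ∈ s(x, m x) → s(x, m x) = s(z, m z) := by
      intro x hx
      rcases Sym2.mem_iff.1 hx with rfl | rfl
      · rfl
      · rw [mm, Sym2.eq_swap]
    obtain ⟨x, hx, rfl⟩ := he
    obtain ⟨y, hy, rfl⟩ := hf
    exact hne ((key x hz).trans (key y hz').symm)
  · have : wkSz m ≤ 2 * ((Finset.univ.filter (fun x => m x ≠ x)).image (fun x => s(x, m x))).card := by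
      have h2 : wkSz m = (Finset.univ.filter (fun x => m x ≠ x)).card := by
        unfold wkSz
        congr
      rw [h2]
      apply Finset.card_le_mul_card_image
      intro b hb
      obtain ⟨x, hx, rfl⟩ := Finset.mem_image.1 hb
      refine le_trans (Finset.card_le_card (t := {x, m x}) ?_) Finset.card_le_two
      intro y hy
      simp only [Finset.mem_filter, Finset.mem_univ, true_and] at hy
      have : y ∈ s(x, m x) := by rw [← hy.2]; simp
      simpa using this
    omega
  · intro e
    induction e using Sym2.ind with
    | _ x y =>
    intro he
    rw [mem_edgeSet, deleteEdges_adj] at he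
    obtain ⟨ha, hnot⟩ := he
    have hne : m x ≠ y := by
      intro h
      apply hnot
      simp only [Finset.coe_image, Finset.coe_filter, Finset.mem_univ, true_and, Set.mem_image,
        Set.mem_setOf_eq]
      exact ⟨x, by rw [h]; exact ha.ne', by rw [h]⟩
    rcases hQ2 x y ha hne with h | h
    · exact ⟨x, by simp, h⟩
    · exact ⟨y, by simp, h⟩
end
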